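/- For every constant c > 2/3, there exists N₀ such that for all integers N ≥ N₀ one has Q(N) < N^c, where Q(N) denotes the maximum number of perfect squares contained in an arithmetic progression of length N. -/

import Mathlib

open scoped Classical in
/-- The number of indices `n ∈ {0, …, N-1}` such that `a + n * d` is an integer square. -/
noncomputable def squaresInAP (N : ℕ) (a d : ℤ) : ℕ :=
  ((Finset.range N).filter fun n => ∃ m : ℤ, a + (n : ℤ) * d = m ^ 2).card

section PartA1


/-! ### Canonical height attached to a quasi-quadratic function -/

theorem bgp_canonical {A : Type*} [AddCommGroup A] (h : A → ℝ) (C : ℝ)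
    (h0 : ∀ P, 0 ≤ h P)
    (hpar : ∀ P Q, |h (P + Q) + h (P - Q) - 2 * h P - 2 * h Q| ≤ C) :
    ∃ g : A → ℝ, (∀ P, 0 ≤ g P) ∧ (∀ P Q, g (P + Q) + g (P - Q) = 2 * g P + 2 * g Q) ∧
      ∀ P, |g P - h P| ≤ C := by
  have hC : 0 ≤ C := (abs_nonneg _).trans (hpar 0 0)
  have hz : h 0 ≤ C / 2 := by
    have := (abs_le.1 (hpar 0 0)).1
    simp at this
    linarith
  have hd : ∀ P, |h (P + P) - 4 * h P| ≤ 3 / 2 * C := by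
    intro P
    have := abs_le.1 (hpar P P)
    simp only [sub_self] at this
    have h00 := h0 0
    rw [abs_le]; constructor <;> linarith
  set u : A → ℕ → ℝ := fun P n => h ((2 ^ n : ℕ) • P) / 4 ^ n with hu
  have hstep : ∀ P n, dist (u P n) (u P (n + 1)) ≤ (3 / 8 * C) * (1 / 4) ^ n := by
    intro P n
    have h1 := hd ((2 ^ n : ℕ) • P)
    have h2 : (2 ^ (n + 1) : ℕ) • P = (2 ^ n : ℕ) • P + (2 ^ n : ℕ) • P := by
      rw [← add_nsmul]; congr 1; ring
    rw [Real.dist_eq, abs_sub_comm]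
    simp only [hu, h2]
    have : h ((2 ^ n : ℕ) • P + (2 ^ n : ℕ) • P) / 4 ^ (n + 1) - h ((2 ^ n : ℕ) • P) / 4 ^ n
        = (h ((2 ^ n : ℕ) • P + (2 ^ n : ℕ) • P) - 4 * h ((2 ^ n : ℕ) • P)) / 4 ^ (n + 1) := by
      field_simp
      ring
    rw [this, abs_div, abs_of_pos (by positivity : (0 : ℝ) < 4 ^ (n + 1)),
      div_le_iff₀ (by positivity)]
    refine h1.trans (le_of_eq ?_)
    rw [pow_succ, one_div, inv_pow]
    field_simp
    ring
  have hcau : ∀ P, CauchySeq (u P) := fun P =>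
    cauchySeq_of_le_geometric (1 / 4) (3 / 8 * C) (by norm_num) (hstep P)
  choose g hg using fun P => cauchySeq_tendsto_of_complete (hcau P)
  refine ⟨g, fun P => ?_, fun P Q => ?_, fun P => ?_⟩
  · exact ge_of_tendsto' (hg P) fun n => div_nonneg (h0 _) (by positivity)
  · have hl : Filter.Tendsto (fun n => u (P + Q) n + u (P - Q) n - 2 * u P n - 2 * u Q n)
        Filter.atTop (nhds (g (P + Q) + g (P - Q) - 2 * g P - 2 * g Q)) :=
      (((hg _).add (hg _)).sub ((hg _).const_mul 2)).sub ((hg _).const_mul 2)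
    have hl0 : Filter.Tendsto (fun n => u (P + Q) n + u (P - Q) n - 2 * u P n - 2 * u Q n)
        Filter.atTop (nhds 0) := by
      have : Filter.Tendsto (fun n : ℕ => C * (1 / 4 : ℝ) ^ n) Filter.atTop (nhds 0) := by
        simpa using (tendsto_pow_atTop_nhds_zero_of_lt_one (r := (1 / 4 : ℝ))
          (by norm_num) (by norm_num)).const_mul C
      refine squeeze_zero_norm (fun n => ?_) this
      rw [Real.norm_eq_abs]
      have h1 := hpar ((2 ^ n : ℕ) • P) ((2 ^ n : ℕ) • Q)
      simp only [hu, nsmul_add, nsmul_sub]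
      have : ∀ a b c d : ℝ, a / 4 ^ n + b / 4 ^ n - 2 * (c / 4 ^ n) - 2 * (d / 4 ^ n)
          = (a + b - 2 * c - 2 * d) / 4 ^ n := by intros; ring
      rw [this, abs_div, abs_of_pos (by positivity : (0 : ℝ) < 4 ^ n), div_le_iff₀ (by positivity)]
      refine h1.trans (le_of_eq ?_)
      rw [one_div, inv_pow]; field_simp
    have := tendsto_nhds_unique hl hl0
    linarith
  · have := dist_le_of_le_geometric_of_tendsto₀ (1 / 4) (3 / 8 * C) (by norm_num) (hstep P) (hg P)
    rw [Real.dist_eq, abs_sub_comm] at this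
    simp only [hu, pow_zero, one_smul, div_one] at this
    refine this.trans ?_
    have e : 3 / 8 * C / (1 - 1 / 4) = C / 2 := by ring
    rw [e]; linarith

/-- Iterated descent classes. -/
theorem bgp_classes {A : Type*} [AddCommGroup A] {F : Type} [Fintype F] (φ : A → F)
    (hφ : ∀ P Q, φ P = φ Q → ∃ R, P - Q = (2 : ℕ) • R) (j : ℕ) :
    ∃ ψ : A → (Fin j → F), ∀ P Q, ψ P = ψ Q → ∃ R, P - Q = (2 ^ j : ℕ) • R := by
  induction j with
  | zero => exact ⟨fun _ => Fin.elim0, fun P Q _ => ⟨P - Q, by simp⟩⟩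
  | succ j ih =>
    obtain ⟨ψ, hψ⟩ := ih
    have : ∀ f : F, ∃ S : A, ∀ P, φ P = f → φ S = f := by
      intro f
      by_cases hf : ∃ P, φ P = f
      · obtain ⟨P, hP⟩ := hf; exact ⟨P, fun _ _ => hP⟩
      · exact ⟨0, fun P hP => absurd ⟨P, hP⟩ hf⟩
    choose S hS using this
    have : ∀ P, ∃ R, P - S (φ P) = (2 : ℕ) • R := fun P => hφ _ _ (hS (φ P) P rfl).symm
    choose half hhalf using this
    refine ⟨fun P => Fin.cons (φ P) (ψ (half P)), fun P Q hPQ => ?_⟩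
    have h1 := Fin.cons_inj.1 hPQ
    obtain ⟨R, hR⟩ := hψ _ _ h1.2
    refine ⟨R, ?_⟩
    have h2 := hhalf P
    have h3 := hhalf Q
    rw [h1.1] at h2
    have : P - Q = (2 : ℕ) • (half P - half Q) := by
      rw [nsmul_sub, ← h2, ← h3]; abel
    rw [this, hR, smul_smul]; congr 1; ring

/-- Bilinear form of a quadratic function. -/
theorem bgp_bilin {A : Type*} [AddCommGroup A] (g : A → ℝ)
    (hg : ∀ P Q, g (P + Q) + g (P - Q) = 2 * g P + 2 * g Q) :
    ∃ b : A →+ A →+ ℝ, (∀ P, b P P = g P) ∧ (∀ P Q, b P Q = b Q P) := by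
  have g0 : g 0 = 0 := by have := hg 0 0; simp at this; linarith
  have key : ∀ x y z, g (x + y + z) = g (x + y) + g (y + z) + g (x + z) - g x - g y - g z := by
    intro x y z
    have h1 := hg (x + y) z
    have h2 := hg (x - z) y
    have h3 := hg x (y + z)
    have h4 := hg x z
    have e1 : x - z + y = x + y - z := by abel
    have e2 : x - z - y = x - (y + z) := by abel
    have e3 : x + (y + z) = x + y + z := by abel
    rw [e1, e2] at h2
    rw [e3] at h3
    linarith
  have hneg : ∀ x, g (-x) = g x := by
    intro x
    have := hg 0 x
    simp at this; linarith
  refine ⟨AddMonoidHom.mk' (fun P => AddMonoidHom.mk' (fun Q => (g (P + Q) - g P - g Q) / 2) ?_) ?_,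
    ?_, ?_⟩
  · intro x y
    have := key P x y
    rw [← add_assoc, this]; ring
  · intro x y
    ext z
    simp only [AddMonoidHom.mk'_apply, AddMonoidHom.add_apply]
    rw [key x y z]; ring
  · intro P
    have := hg P P
    simp only [sub_self, g0] at this
    simp only [AddMonoidHom.mk'_apply]
    linarith
  · intro P Q
    simp only [AddMonoidHom.mk'_apply]
    rw [add_comm]; ring

end PartA1

section PartA2


/-! ### Rank bound and packing -/

theorem bgp_rank {A : Type*} [AddCommGroup A] {F : Type} [Fintype F] (φ : A → F)
    (hφ : ∀ P Q, φ P = φ Q → ∃ R, P - Q = (2 : ℕ) • R)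
    (b : A →+ A →+ ℝ) (μ : ℝ) (hμ : 0 < μ) (hμ' : ∀ P, 0 < b P P → μ ≤ b P P)
    {V : Type*} [NormedAddCommGroup V] [InnerProductSpace ℝ V]
    {ι : Type*} [Fintype ι] (w : ι → A) (v : ι → V) (hv : LinearIndependent ℝ v)
    (hvw : ∀ i j, inner ℝ (v i) (v j) = b (w i) (w j)) :
    2 ^ Fintype.card ι ≤ Fintype.card F := by
  classical
  by_contra! hlt
  set ρ := Fintype.card ι with hρ
  set B := Fintype.card F with hB
  have hρ0 : ρ ≠ 0 := by
    rintro h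
    rw [h, pow_zero] at hlt
    have : Nonempty F := ⟨φ 0⟩
    have := Fintype.card_pos (α := F)
    omega
  set β : ℝ := (B : ℝ) ^ ((1 : ℝ) / ρ) with hβ
  have hβ0 : 0 ≤ β := by positivity
  have hβρ : β ^ ρ = B := by
    rw [hβ, ← Real.rpow_natCast, ← Real.rpow_mul (by positivity)]
    field_simp
    simp
  have hβ2 : β < 2 := by
    by_contra! h2
    have : (2 : ℝ) ^ ρ ≤ β ^ ρ := pow_le_pow_left₀ (by norm_num) h2 _
    rw [hβρ] at this
    have : 2 ^ ρ ≤ B := by exact_mod_cast this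
    omega
  set D : ℝ := ∑ i, ‖v i‖ with hD
  -- choose j
  obtain ⟨j, hj⟩ : ∃ j : ℕ, ((β / 2) ^ j * D) ^ 2 < μ := by
    have : Filter.Tendsto (fun j : ℕ => ((β / 2) ^ j * D) ^ 2) Filter.atTop (nhds 0) := by
      have := (tendsto_pow_atTop_nhds_zero_of_lt_one (r := β / 2) (by positivity)
        (by linarith)).mul_const D
      simpa using this.pow 2
    exact (this.eventually (gt_mem_nhds hμ)).exists
  set L := ⌊β ^ j⌋₊ with hL
  have hL1 : (L : ℝ) ≤ β ^ j := Nat.floor_le (by positivity)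
  have hL2 : β ^ j < L + 1 := Nat.lt_floor_add_one _
  obtain ⟨ψ, hψ⟩ := bgp_classes φ hφ j
  have hcard : Fintype.card (Fin j → F) < Fintype.card (ι → Fin (L + 1)) := by
    simp only [Fintype.card_fun, Fintype.card_fin, ← hB, ← hρ]
    have : ((B ^ j : ℕ) : ℝ) < (((L + 1) ^ ρ : ℕ) : ℝ) := by
      push_cast
      rw [← hβρ, ← pow_mul, mul_comm, pow_mul]
      exact pow_lt_pow_left₀ hL2 (by positivity) hρ0
    exact_mod_cast this
  obtain ⟨c, c', hne, hcc⟩ := Fintype.exists_ne_map_eq_of_card_lt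
    (fun c : ι → Fin (L + 1) => ψ (∑ i, (c i : ℕ) • w i)) hcard
  obtain ⟨R, hR⟩ := hψ _ _ hcc
  set e : ι → ℤ := fun i => (c i : ℤ) - (c' i : ℤ) with he
  have hsum : ∑ i, e i • w i = (2 ^ j : ℕ) • R := by
    rw [← hR, ← Finset.sum_sub_distrib]
    refine Finset.sum_congr rfl fun i _ => ?_
    simp [he, sub_smul]
  have hnorm : ‖∑ i, (e i : ℝ) • v i‖ ^ 2 = 4 ^ j * b R R := by
    rw [← real_inner_self_eq_norm_sq]
    have : b (∑ i, e i • w i) (∑ i, e i • w i) = 4 ^ j * b R R := by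
      rw [hsum]
      simp only [map_nsmul, AddMonoidHom.nsmul_apply, nsmul_eq_mul]
      push_cast
      rw [show (4 : ℝ) = 2 * 2 by norm_num, mul_pow]; ring
    rw [← this]
    simp only [sum_inner, inner_sum, inner_smul_left, inner_smul_right, hvw, map_sum,
      AddMonoidHom.finsetSum_apply, map_zsmul, AddMonoidHom.zsmul_apply, zsmul_eq_mul]
    simp
  have hpos : 0 < ‖∑ i, (e i : ℝ) • v i‖ := by
    rw [norm_pos_iff]
    intro h0
    have := Fintype.linearIndependent_iff.1 hv _ h0
    apply hne
    funext i
    have hi := this i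
    have : (e i) = 0 := by exact_mod_cast hi
    simp only [he] at this
    apply Fin.ext
    omega
  have hle : ‖∑ i, (e i : ℝ) • v i‖ ≤ β ^ j * D := by
    refine (norm_sum_le _ _).trans ?_
    rw [hD, Finset.mul_sum]
    refine Finset.sum_le_sum fun i _ => ?_
    rw [norm_smul]
    refine mul_le_mul_of_nonneg_right ?_ (norm_nonneg _)
    refine le_trans ?_ hL1
    rw [Real.norm_eq_abs, ← Int.cast_abs]
    have : |e i| ≤ L := by
      have h1 := (c i).2
      have h2 := (c' i).2
      simp only [he]
      rw [abs_le]; omega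
    exact_mod_cast this
  have h4 : (0 : ℝ) < 4 ^ j := by positivity
  have hRpos : 0 < b R R := by
    have : 0 < 4 ^ j * b R R := by rw [← hnorm]; positivity
    exact pos_of_mul_pos_right this h4.le
  have h1 := hμ' R hRpos
  have h2 : 4 ^ j * b R R ≤ (β ^ j * D) ^ 2 := by
    rw [← hnorm]; exact pow_le_pow_left₀ hpos.le hle 2
  have h3 : ((β / 2) ^ j * D) ^ 2 * 4 ^ j = (β ^ j * D) ^ 2 := by
    rw [show (4 : ℝ) = 2 ^ 2 by norm_num, ← pow_mul, mul_comm 2 j, pow_mul, ← mul_pow]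
    congr 1
    rw [div_pow]; field_simp
  nlinarith

theorem bgp_psd {A : Type*} [AddCommGroup A] (b : A →+ A →+ ℝ) (hb : ∀ P, 0 ≤ b P P)
    (hs : ∀ P Q, b P Q = b Q P)
    {ι : Type*} [Fintype ι] [DecidableEq ι] (w : ι → A) :
    (Matrix.of fun i j => b (w i) (w j)).PosSemidef := by
  refine Matrix.PosSemidef.of_dotProduct_mulVec_nonneg ?_ ?_
  · ext i j; simp [Matrix.conjTranspose, hs]
  · intro x
    have hintg : ∀ c : ι → ℤ, 0 ≤ ∑ i, ∑ j, (c i : ℝ) * (c j : ℝ) * b (w i) (w j) := by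
      intro c
      have := hb (∑ i, c i • w i)
      simp only [map_sum, AddMonoidHom.finsetSum_apply, map_zsmul, AddMonoidHom.zsmul_apply,
        zsmul_eq_mul] at this
      simp only [Finset.mul_sum] at this
      refine this.trans (le_of_eq ?_)
      refine Finset.sum_congr rfl fun i _ => Finset.sum_congr rfl fun k _ => ?_
      rw [hs]; ring
    have hlim : Filter.Tendsto (fun n : ℕ => ∑ i, ∑ j,
        ((⌊x i * n⌋ : ℝ) / n) * ((⌊x j * n⌋ : ℝ) / n) * b (w i) (w j)) Filter.atTop
        (nhds (∑ i, ∑ j, x i * x j * b (w i) (w j))) := by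
      refine tendsto_finsetSum _ fun i _ => tendsto_finsetSum _ fun j _ => ?_
      have h : ∀ y : ℝ, Filter.Tendsto (fun n : ℕ => (⌊y * n⌋ : ℝ) / n) Filter.atTop (nhds y) :=
        by
        intro y
        rw [tendsto_iff_norm_sub_tendsto_zero]
        refine squeeze_zero' (Filter.Eventually.of_forall fun n => norm_nonneg _) ?_
          (tendsto_one_div_atTop_nhds_zero_nat (𝕜 := ℝ))
        filter_upwards [Filter.eventually_gt_atTop 0] with n hn
        have hn' : (0 : ℝ) < n := by exact_mod_cast hn
        have h1 := Int.floor_le (y * n)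
        have h2 := Int.lt_floor_add_one (y * n)
        rw [Real.norm_eq_abs, show (⌊y * n⌋ : ℝ) / n - y = (⌊y * n⌋ - y * n) / n by
          field_simp, abs_div, abs_of_pos hn']
        gcongr
        rw [abs_le]; constructor <;> linarith
      exact ((h _).mul (h _)).mul_const _
    have h0 : 0 ≤ ∑ i, ∑ j, x i * x j * b (w i) (w j) := by
      refine ge_of_tendsto' hlim fun n => ?_
      have := hintg (fun i => ⌊x i * n⌋)
      have e : ∑ i, ∑ j, ((⌊x i * n⌋ : ℝ) / n) * ((⌊x j * n⌋ : ℝ) / n) * b (w i) (w j)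
        = (∑ i, ∑ j, (⌊x i * n⌋ : ℝ) * (⌊x j * n⌋ : ℝ) * b (w i) (w j)) * ((1 / n) * (1 / n)) := by
        simp only [Finset.sum_mul]
        refine Finset.sum_congr rfl fun i _ => Finset.sum_congr rfl fun k _ => ?_
        ring
      rw [e]
      positivity
    refine h0.trans (le_of_eq ?_)
    simp only [dotProduct, Matrix.mulVec, Finset.mul_sum]
    refine Finset.sum_congr rfl fun i _ => Finset.sum_congr rfl fun k _ => ?_
    simp; ring

end PartA2

section PartA3


theorem bgp_sq_le {a b : ℝ} (h : a ^ 2 ≤ b ^ 2) (hb : 0 ≤ b) : a ≤ b := by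
  by_contra! hlt; nlinarith

open scoped MatrixOrder in
theorem bgp_psd_vectors {ι : Type*} [Fintype ι] [DecidableEq ι] (G : Matrix ι ι ℝ)
    (hG : G.PosSemidef) : ∃ v : ι → EuclideanSpace ℝ ι, ∀ i j, inner ℝ (v i) (v j) = G i j := by
  obtain ⟨M, hM⟩ := CStarAlgebra.nonneg_iff_eq_star_mul_self.1 hG.nonneg
  refine ⟨fun i => WithLp.toLp 2 (fun k => M k i), fun i j => ?_⟩
  rw [hM]
  simp [Matrix.mul_apply, PiLp.inner_apply, Matrix.star_apply, mul_comm]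

theorem bgp_packing {A : Type*} [AddCommGroup A] {F : Type} [Fintype F] (φ : A → F)
    (hφ : ∀ P Q, φ P = φ Q → ∃ R, P - Q = (2 : ℕ) • R)
    (h : A → ℝ) (C : ℝ) (h0 : ∀ P, 0 ≤ h P)
    (hpar : ∀ P Q, |h (P + Q) + h (P - Q) - 2 * h P - 2 * h Q| ≤ C)
    (hN : ∀ r : ℝ, {P | h P ≤ r}.Finite)
    (X : Finset A) (U W : ℝ) (hU : ∀ P ∈ X, h P ≤ U)
    (hW : ∀ P ∈ X, ∀ Q ∈ X, P ≠ Q → W ≤ h (P - Q)) (hCW : C < W)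
    (hUW : U + C ≤ 4 * (W - C)) : X.card ≤ Fintype.card F ^ 3 := by
  classical
  obtain ⟨g, g0, gpar, gh⟩ := bgp_canonical h C h0 hpar
  obtain ⟨b, hb, hs⟩ := bgp_bilin g gpar
  obtain ⟨μ, hμ, hμ'⟩ : ∃ μ : ℝ, 0 < μ ∧ ∀ P, 0 < b P P → μ ≤ b P P := by
    have hfin : {P | 0 < g P ∧ g P ≤ 1}.Finite := by
      refine (hN (1 + C)).subset ?_
      rintro P ⟨_, h1⟩
      have := (abs_le.1 (gh P)).1
      show h P ≤ 1 + C
      linarith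
    rcases Set.eq_empty_or_nonempty {P | 0 < g P ∧ g P ≤ 1} with he | hne
    · refine ⟨1, one_pos, fun P hP => ?_⟩
      rw [hb] at hP ⊢
      by_contra! h1
      have : P ∈ {P | 0 < g P ∧ g P ≤ 1} := ⟨hP, h1.le⟩
      rw [he] at this
      exact this
    · obtain ⟨P0, hP0, hmin⟩ := Set.exists_min_image _ g hfin hne
      refine ⟨g P0, hP0.1, fun P hP => ?_⟩
      rw [hb] at hP ⊢
      by_cases h1 : g P ≤ 1
      · exact hmin P ⟨hP, h1⟩
      · exact hP0.2.trans (not_le.1 h1).le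
  obtain ⟨v, hv⟩ := bgp_psd_vectors _
    (bgp_psd b (fun P => by rw [hb]; exact g0 P) hs (fun P : X => (P : A)))
  simp only [Matrix.of_apply] at hv
  obtain ⟨s, hsub, hspan, hind⟩ := exists_linearIndependent ℝ (Set.range v)
  have hsfin : s.Finite := (Set.finite_range v).subset hsub
  have : Fintype s := hsfin.fintype
  choose w hw using fun y : s => hsub y.2
  have hrank : 2 ^ Fintype.card s ≤ Fintype.card F := by
    refine bgp_rank φ hφ b μ hμ hμ' (fun y : s => (w y : A)) (fun y : s => (y : EuclideanSpace ℝ X))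
      hind fun i j => ?_
    rw [← hv, hw, hw]
  set E := Submodule.span ℝ (Set.range v) with hE
  have hfr : Module.finrank ℝ E = Fintype.card s := by
    rw [← hspan, finrank_span_set_eq_card hind, Set.toFinset_card]
  have hD : 0 < W - C := by linarith
  set lam : ℝ := (Real.sqrt (W - C))⁻¹ with hlam
  have hsq : 0 < Real.sqrt (W - C) := Real.sqrt_pos.2 hD
  have hlam0 : 0 < lam := by positivity
  have hnorm : ∀ P : X, ‖v P‖ ≤ 2 * Real.sqrt (W - C) := by
    intro P
    have h1 : ‖v P‖ ^ 2 = g P := by rw [← real_inner_self_eq_norm_sq, hv, hb]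
    refine bgp_sq_le ?_ (by positivity)
    rw [h1, mul_pow, Real.sq_sqrt hD.le]
    have := (abs_le.1 (gh P)).2
    have := hU P P.2
    linarith
  have hsep : ∀ P Q : X, P ≠ Q → Real.sqrt (W - C) ≤ ‖v P - v Q‖ := by
    intro P Q hPQ
    have h1 : ‖v P - v Q‖ ^ 2 = g (P - Q) := by
      rw [← real_inner_self_eq_norm_sq, ← hb]
      simp only [inner_sub_left, inner_sub_right, hv, map_sub, AddMonoidHom.sub_apply]
    have h2 : Real.sqrt (W - C) ^ 2 ≤ ‖v P - v Q‖ ^ 2 := by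
      rw [h1, Real.sq_sqrt hD.le]
      have := (abs_le.1 (gh (P - Q))).1
      have := hW P P.2 Q Q.2 (fun h => hPQ (Subtype.ext h))
      linarith
    exact bgp_sq_le h2 (norm_nonneg _)
  let f : X → E := fun P => lam • ⟨v P, Submodule.subset_span ⟨P, rfl⟩⟩
  have hfs : ∀ P Q : X, P ≠ Q → 1 ≤ ‖f P - f Q‖ := by
    intro P Q hPQ
    have : f P - f Q = lam • (⟨v P - v Q, Submodule.sub_mem _ (Submodule.subset_span ⟨P, rfl⟩)
      (Submodule.subset_span ⟨Q, rfl⟩)⟩ : E) := by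
      simp only [f, ← smul_sub]; rfl
    rw [this, norm_smul, Real.norm_eq_abs, abs_of_pos hlam0]
    have := hsep P Q hPQ
    calc (1 : ℝ) = lam * Real.sqrt (W - C) := by rw [hlam]; field_simp
      _ ≤ _ := by gcongr; exact this
  have hfinj : Function.Injective f := by
    intro P Q hPQ
    by_contra hne
    have := hfs P Q hne
    rw [hPQ, sub_self, norm_zero] at this
    linarith
  have hpack := Besicovitch.card_le_of_separated (Finset.univ.image f) (by
    intro c hc
    obtain ⟨P, _, rfl⟩ := Finset.mem_image.1 hc
    simp only [f]
    rw [norm_smul, Real.norm_eq_abs, abs_of_pos hlam0]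
    calc _ ≤ lam * (2 * Real.sqrt (W - C)) := by gcongr; exact hnorm P
      _ = 2 := by rw [hlam]; field_simp) (by
    intro c hc d hd hcd
    obtain ⟨P, _, rfl⟩ := Finset.mem_image.1 hc
    obtain ⟨Q, _, rfl⟩ := Finset.mem_image.1 hd
    exact hfs P Q (fun h => hcd (by rw [h])))
  rw [Finset.card_image_of_injective _ hfinj, Finset.card_univ, Fintype.card_coe, hfr] at hpack
  calc X.card ≤ 5 ^ Fintype.card s := hpack
    _ ≤ 8 ^ Fintype.card s := Nat.pow_le_pow_left (by norm_num) _
    _ = (2 ^ Fintype.card s) ^ 3 := by rw [← pow_mul, mul_comm, pow_mul]; norm_num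
    _ ≤ _ := Nat.pow_le_pow_left hrank 3

end PartA3

section PartB1


open WeierstrassCurve.Affine in
/-- The affine curve `y ^ 2 = x ^ 3 + a₂ x ^ 2 + a₄ x + a₆` over `ℚ`. -/
def bgpW (a₂ a₄ a₆ : ℚ) : WeierstrassCurve.Affine ℚ := ⟨0, a₂, 0, a₄, a₆⟩

namespace BGP
open WeierstrassCurve.Affine WeierstrassCurve.Affine.Point

variable {a₂ a₄ a₆ : ℚ}

theorem eqn {x y : ℚ} (h : (bgpW a₂ a₄ a₆).Nonsingular x y) :
    y ^ 2 = x ^ 3 + a₂ * x ^ 2 + a₄ * x + a₆ := by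
  have := (equation_iff _ _).1 h.1
  simpa [bgpW] using this

theorem neg_pt {x y : ℚ} (h : (bgpW a₂ a₄ a₆).Nonsingular x y) :
    ∃ h', -(some x y h) = some x (-y) h' := by
  have e : (bgpW a₂ a₄ a₆).negY x y = -y := by simp [negY, bgpW]
  refine ⟨e ▸ ((nonsingular_neg _ _).2 h), ?_⟩
  rw [neg_some]
  simp only [e]

theorem add_ne {x₁ y₁ x₂ y₂ : ℚ} (h₁ : (bgpW a₂ a₄ a₆).Nonsingular x₁ y₁)
    (h₂ : (bgpW a₂ a₄ a₆).Nonsingular x₂ y₂) (hx : x₁ ≠ x₂) :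
    ∃ h', some x₁ y₁ h₁ + some x₂ y₂ h₂ =
      some (((y₁ - y₂) / (x₁ - x₂)) ^ 2 - a₂ - x₁ - x₂)
        (-((y₁ - y₂) / (x₁ - x₂) * (((y₁ - y₂) / (x₁ - x₂)) ^ 2 - a₂ - x₁ - x₂ - x₁) + y₁)) h' := by
  have e1 : (bgpW a₂ a₄ a₆).slope x₁ x₂ y₁ y₂ = (y₁ - y₂) / (x₁ - x₂) := slope_of_X_ne hx
  have e2 : (bgpW a₂ a₄ a₆).addX x₁ x₂ ((y₁ - y₂) / (x₁ - x₂)) =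
    (((y₁ - y₂) / (x₁ - x₂)) ^ 2 - a₂ - x₁ - x₂) := by simp [addX, bgpW]
  have e3 : (bgpW a₂ a₄ a₆).addY x₁ x₂ y₁ ((y₁ - y₂) / (x₁ - x₂)) =
    (-((y₁ - y₂) / (x₁ - x₂) * (((y₁ - y₂) / (x₁ - x₂)) ^ 2 - a₂ - x₁ - x₂ - x₁) + y₁)) := by
    simp [addY, negAddY, negY, addX, bgpW]
  have := add_of_X_ne (h₁ := h₁) (h₂ := h₂) hx
  have hn := nonsingular_add h₁ h₂ (fun h => hx h.1)
  rw [e1, e2, e3] at hn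
  refine ⟨hn, ?_⟩
  rw [this]
  simp only [e1, e2, e3]

theorem add_self {x y : ℚ} (h : (bgpW a₂ a₄ a₆).Nonsingular x y) (hy : y ≠ 0) :
    ∃ h', some x y h + some x y h =
      some (((3 * x ^ 2 + 2 * a₂ * x + a₄) / (2 * y)) ^ 2 - a₂ - x - x)
        (-((3 * x ^ 2 + 2 * a₂ * x + a₄) / (2 * y) *
          (((3 * x ^ 2 + 2 * a₂ * x + a₄) / (2 * y)) ^ 2 - a₂ - x - x - x) + y)) h' := by
  have hy' : y ≠ (bgpW a₂ a₄ a₆).negY x y := by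
    simp only [negY, bgpW]; intro h; apply hy; linarith
  have e1 : (bgpW a₂ a₄ a₆).slope x x y y = (3 * x ^ 2 + 2 * a₂ * x + a₄) / (2 * y) := by
    rw [slope_of_Y_ne rfl hy']
    simp [negY, bgpW]; congr 1; ring
  set l := (3 * x ^ 2 + 2 * a₂ * x + a₄) / (2 * y)
  have e2 : (bgpW a₂ a₄ a₆).addX x x l = (l ^ 2 - a₂ - x - x) := by simp [addX, bgpW]
  have e3 : (bgpW a₂ a₄ a₆).addY x x y l = (-(l * (l ^ 2 - a₂ - x - x - x) + y)) := by
    simp [addY, negAddY, negY, addX, bgpW]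
  have := add_self_of_Y_ne (h₁ := h) hy'
  have hn := nonsingular_add h h (fun h => hy' h.2)
  rw [e1, e2, e3] at hn
  refine ⟨hn, ?_⟩
  rw [this]
  simp only [e1, e2, e3]

theorem add_self_zero {x : ℚ} (h : (bgpW a₂ a₄ a₆).Nonsingular x 0) :
    some x 0 h + some x 0 h = 0 :=
  add_self_of_Y_eq (by simp [negY, bgpW])

/-- The three forms of the addition-and-subtraction map. -/
def F0 (a₂ a₄ a₆ s t u : ℚ) : ℚ :=
  s ^ 2 - 2 * a₄ * s * u - 4 * a₆ * t * u - (4 * a₂ * a₆ - a₄ ^ 2) * u ^ 2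
def F1 (a₂ a₄ a₆ s t u : ℚ) : ℚ := 2 * t * s + 4 * a₂ * s * u + 2 * a₄ * t * u + 4 * a₆ * u ^ 2
def F2 (s t u : ℚ) : ℚ := t ^ 2 - 4 * s * u

def Rel (P Q : (bgpW a₂ a₄ a₆).Point) : Prop :=
  ∃ l : ℚ, F0 a₂ a₄ a₆ (P.sym2x Q 0) (P.sym2x Q 1) (P.sym2x Q 2) = l * (P + Q).sym2x (P - Q) 0 ∧
    F1 a₂ a₄ a₆ (P.sym2x Q 0) (P.sym2x Q 1) (P.sym2x Q 2) = l * (P + Q).sym2x (P - Q) 1 ∧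
    F2 (P.sym2x Q 0) (P.sym2x Q 1) (P.sym2x Q 2) = l * (P + Q).sym2x (P - Q) 2

theorem rel_zero_left (Q : (bgpW a₂ a₄ a₆).Point) : Rel 0 Q := by
  refine ⟨1, ?_⟩
  rw [zero_add, zero_sub, sym2x_neg_right]
  rcases Q with _ | ⟨x, y, h⟩
  · simp [← zero_def, F0, F1, F2]
  · simp [F0, F1, F2]; constructor <;> ring

theorem rel_comm {P Q : (bgpW a₂ a₄ a₆).Point} (h : Rel P Q) : Rel Q P := by
  unfold Rel at *
  rwa [sym2x_comm Q P, add_comm Q P, ← neg_sub P Q, sym2x_neg_right]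

theorem rel_neg {P Q : (bgpW a₂ a₄ a₆).Point} (h : Rel P (-Q)) : Rel P Q := by
  unfold Rel at *
  rwa [sym2x_neg_right, sub_neg_eq_add, ← sub_eq_add_neg, sym2x_comm (P - Q)] at h

theorem rel_self (P : (bgpW a₂ a₄ a₆).Point) : Rel P P := by
  rcases P with _ | ⟨x, y, h⟩
  · exact rel_zero_left _
  · have he := eqn h
    by_cases hy : y = 0
    · subst hy
      refine ⟨F0 a₂ a₄ a₆ (x * x) (x + x) 1, ?_⟩
      rw [add_self_zero h, sub_self]
      simp [F0, F1, F2]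
      constructor
      · linear_combination (-4) * he
      · ring
    · obtain ⟨h', e⟩ := add_self h hy
      refine ⟨4 * y ^ 2, ?_⟩
      rw [e, sub_self]
      simp [F0, F1, F2]
      refine ⟨?_, ?_, ?_⟩
      · field_simp
        linear_combination (16 * a₂ + 32 * x) * he
      · linear_combination (-4) * he
      · ring

theorem rel (P Q : (bgpW a₂ a₄ a₆).Point) : Rel P Q := by
  rcases P with _ | ⟨x, y, h⟩
  · exact rel_zero_left _
  rcases Q with _ | ⟨x', y', h'⟩
  · exact rel_comm (rel_zero_left _)
  by_cases hx : x = x'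
  · rcases X_eq_iff.1 hx with h1 | h1
    · rw [h1]; exact rel_self _
    · rw [← neg_eq_iff_eq_neg] at h1; rw [← h1]; exact rel_neg (by rw [neg_neg]; exact rel_self _)
  · have he := eqn h
    have he' := eqn h'
    obtain ⟨h1, e1⟩ := add_ne h h' hx
    obtain ⟨h2, e2⟩ := neg_pt h'
    obtain ⟨h3, e3⟩ := add_ne h h2 hx
    have hd : x - x' ≠ 0 := sub_ne_zero.2 hx
    refine ⟨(x - x') ^ 2, ?_⟩
    rw [sub_eq_add_neg (some x y h), e2, e1, e3]
    simp [F0, F1, F2]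
    refine ⟨?_, ?_, ?_⟩
    · field_simp
      linear_combination (-(y ^ 2 - y' ^ 2 + (x ^ 3 + a₂ * x ^ 2 + a₄ * x) - (x' ^ 3 + a₂ * x' ^ 2
        + a₄ * x')) + 2 * (a₂ + x + x') * (x - x') ^ 2) * he + ((y ^ 2 - y' ^ 2 + (x ^ 3 + a₂ * x ^ 2
        + a₄ * x) - (x' ^ 3 + a₂ * x' ^ 2 + a₄ * x')) + 2 * (a₂ + x + x') * (x - x') ^ 2) * he'
    · field_simp
      linear_combination (-2) * he + (-2) * he'
    · ring

end BGP

end PartB1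

section PartB2


namespace BGP
open WeierstrassCurve.Affine WeierstrassCurve.Affine.Point

/-- Polynomial bound: `|x| ≤ T ^ k * σ ^ d`. -/
def HB (T σ x : ℝ) (k d : ℕ) : Prop := |x| ≤ T ^ k * σ ^ d

section HB
variable {T σ x y : ℝ} {k l d m : ℕ}

theorem HB.mono (h : HB T σ x k d) (hT : 128 ≤ T) (hσ : 0 ≤ σ) (hkl : k ≤ l) : HB T σ x l d := by
  refine le_trans h ?_
  have : T ^ k ≤ T ^ l := pow_le_pow_right₀ (by linarith) hkl
  gcongr

theorem HB.fin (hT : 128 ≤ T) (hσ : 0 ≤ σ) (h : HB T σ x k d) (hd : d = m) (hkl : k ≤ l) :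
    |x| ≤ T ^ l * σ ^ m := by
  subst hd; exact h.mono hT hσ hkl

theorem HB.add (hT : 128 ≤ T) (hσ : 0 ≤ σ) (h1 : HB T σ x k d) (h2 : HB T σ y l m)
    (hd : m = d) : HB T σ (x + y) (max k l + 1) d := by
  subst hd
  have h1' := h1.mono hT hσ (le_max_left k l)
  have h2' := h2.mono hT hσ (le_max_right k l)
  unfold HB at *
  have h3 : 0 ≤ T ^ (max k l) * σ ^ m := by positivity
  calc |x + y| ≤ |x| + |y| := abs_add_le _ _
    _ ≤ 2 * (T ^ (max k l) * σ ^ m) := by linarith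
    _ ≤ T * (T ^ (max k l) * σ ^ m) := by gcongr; linarith
    _ = _ := by ring

theorem HB.neg (h1 : HB T σ x k d) : HB T σ (-x) k d := by
  unfold HB at *; rwa [abs_neg]

theorem HB.sub (hT : 128 ≤ T) (hσ : 0 ≤ σ) (h1 : HB T σ x k d) (h2 : HB T σ y l m)
    (hd : m = d) : HB T σ (x - y) (max k l + 1) d := by
  rw [sub_eq_add_neg]; exact HB.add hT hσ h1 h2.neg hd

theorem HB.mul (h1 : HB T σ x k d) (h2 : HB T σ y l m) : HB T σ (x * y) (k + l) (d + m) := by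
  unfold HB at *
  rw [abs_mul]
  calc |x| * |y| ≤ (T ^ k * σ ^ d) * (T ^ l * σ ^ m) :=
        mul_le_mul h1 h2 (abs_nonneg _) ((abs_nonneg _).trans h1)
    _ = _ := by ring

theorem HB.pow (h1 : HB T σ x k d) (n : ℕ) : HB T σ (x ^ n) (k * n) (d * n) := by
  unfold HB at *
  rw [abs_pow]
  calc |x| ^ n ≤ (T ^ k * σ ^ d) ^ n := pow_le_pow_left₀ (abs_nonneg _) h1 n
    _ = _ := by rw [mul_pow, ← pow_mul, ← pow_mul]

theorem HB.const (h : |x| ≤ T) : HB T σ x 1 0 := by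
  unfold HB; simpa using h

theorem HB.var (h : |x| ≤ σ) : HB T σ x 0 1 := by
  unfold HB; simpa using h
end HB

/-- integral versions of the forms -/
def G0 (a₂ a₄ a₆ s t u : ℤ) : ℤ :=
  s ^ 2 - 2 * a₄ * s * u - 4 * a₆ * t * u - (4 * a₂ * a₆ - a₄ ^ 2) * u ^ 2
def G1 (a₂ a₄ a₆ s t u : ℤ) : ℤ := 2 * t * s + 4 * a₂ * s * u + 2 * a₄ * t * u + 4 * a₆ * u ^ 2
def G2 (s t u : ℤ) : ℤ := t ^ 2 - 4 * s * u

/-- discriminant in terms of the `b` invariants -/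
def dsc (b₂ b₄ b₆ b₈ : ℤ) : ℤ := -b₂ ^ 2 * b₈ - 8 * b₄ ^ 3 - 27 * b₆ ^ 2 + 9 * b₂ * b₄ * b₆

def D (a₂ a₄ a₆ : ℤ) : ℤ := dsc (4 * a₂) (2 * a₄) (4 * a₆) (4 * a₂ * a₆ - a₄ ^ 2)

theorem hb_G {T σ : ℝ} (hT : 128 ≤ T) (hσ : 0 ≤ σ) {a₂ a₄ a₆ s t u : ℤ}
    (h2 : |(a₂ : ℝ)| ≤ T) (h4 : |(a₄ : ℝ)| ≤ T) (h6 : |(a₆ : ℝ)| ≤ T)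
    (hs : |(s : ℝ)| ≤ σ) (ht : |(t : ℝ)| ≤ σ) (hu : |(u : ℝ)| ≤ σ) :
    |(G0 a₂ a₄ a₆ s t u : ℝ)| ≤ T ^ 10 * σ ^ 2 ∧ |(G1 a₂ a₄ a₆ s t u : ℝ)| ≤ T ^ 10 * σ ^ 2 ∧
    |(G2 s t u : ℝ)| ≤ T ^ 10 * σ ^ 2 := by
  have c2 : |(2 : ℝ)| ≤ T := by rw [abs_of_pos (by norm_num)]; linarith
  have c4 : |(4 : ℝ)| ≤ T := by rw [abs_of_pos (by norm_num)]; linarith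
  refine ⟨?_, ?_, ?_⟩ <;> simp only [G0, G1, G2] <;> push_cast <;>
    apply HB.fin hT hσ
  all_goals
    repeat' first
        | with_reducible apply HB.add hT hσ | with_reducible apply HB.sub hT hσ
        | with_reducible apply HB.neg
        | with_reducible apply HB.mul | with_reducible apply HB.pow
        | exact HB.var (by assumption) | exact HB.const (by assumption)
  all_goals norm_num

theorem hb_D {T : ℝ} (hT : 128 ≤ T) {a₂ a₄ a₆ : ℤ}
    (h2 : |(a₂ : ℝ)| ≤ T) (h4 : |(a₄ : ℝ)| ≤ T) (h6 : |(a₆ : ℝ)| ≤ T) :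
    |(D a₂ a₄ a₆ : ℝ)| ≤ T ^ 20 := by
  have c2 : |(2 : ℝ)| ≤ T := by rw [abs_of_pos (by norm_num)]; linarith
  have c4 : |(4 : ℝ)| ≤ T := by rw [abs_of_pos (by norm_num)]; linarith
  have c8 : |(8 : ℝ)| ≤ T := by rw [abs_of_pos (by norm_num)]; linarith
  have c9 : |(9 : ℝ)| ≤ T := by rw [abs_of_pos (by norm_num)]; linarith
  have c27 : |(27 : ℝ)| ≤ T := by rw [abs_of_pos (by norm_num)]; linarith
  have : |(D a₂ a₄ a₆ : ℝ)| ≤ T ^ 20 * 1 ^ 0 := by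
    simp only [D, dsc]
    push_cast
    apply HB.fin hT zero_le_one
    repeat' first
        | with_reducible apply HB.add hT zero_le_one | with_reducible apply HB.sub hT zero_le_one
        | with_reducible apply HB.neg
        | with_reducible apply HB.mul | with_reducible apply HB.pow
        | exact HB.const (by assumption)
    all_goals norm_num
  simpa using this

theorem elim_s {T σ : ℝ} (hT : 128 ≤ T) (hσ : 0 ≤ σ) {a₂ a₄ a₆ s t u : ℤ}
    (h2 : |(a₂ : ℝ)| ≤ T) (h4 : |(a₄ : ℝ)| ≤ T) (h6 : |(a₆ : ℝ)| ≤ T)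
    (hs : |(s : ℝ)| ≤ σ) (ht : |(t : ℝ)| ≤ σ) (hu : |(u : ℝ)| ≤ σ) :
    ∃ c₀ c₁ c₂ : ℤ, |(c₀ : ℝ)| ≤ T ^ 60 * σ ^ 2 ∧ |(c₁ : ℝ)| ≤ T ^ 60 * σ ^ 2 ∧
      |(c₂ : ℝ)| ≤ T ^ 60 * σ ^ 2 ∧
      c₀ * G0 a₂ a₄ a₆ s t u + c₁ * G1 a₂ a₄ a₆ s t u + c₂ * G2 s t u = D a₂ a₄ a₆ * s ^ 4 := by
  have k2 : |(2 : ℝ)| ≤ T := by rw [abs_of_pos (by norm_num)]; linarith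
  have k3 : |(3 : ℝ)| ≤ T := by rw [abs_of_pos (by norm_num)]; linarith
  have k4 : |(4 : ℝ)| ≤ T := by rw [abs_of_pos (by norm_num)]; linarith
  have k5 : |(5 : ℝ)| ≤ T := by rw [abs_of_pos (by norm_num)]; linarith
  have k6 : |(6 : ℝ)| ≤ T := by rw [abs_of_pos (by norm_num)]; linarith
  have k7 : |(7 : ℝ)| ≤ T := by rw [abs_of_pos (by norm_num)]; linarith
  have k8 : |(8 : ℝ)| ≤ T := by rw [abs_of_pos (by norm_num)]; linarith
  have k9 : |(9 : ℝ)| ≤ T := by rw [abs_of_pos (by norm_num)]; linarith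
  have k10 : |(10 : ℝ)| ≤ T := by rw [abs_of_pos (by norm_num)]; linarith
  have k12 : |(12 : ℝ)| ≤ T := by rw [abs_of_pos (by norm_num)]; linarith
  have k16 : |(16 : ℝ)| ≤ T := by rw [abs_of_pos (by norm_num)]; linarith
  have k27 : |(27 : ℝ)| ≤ T := by rw [abs_of_pos (by norm_num)]; linarith
  have k28 : |(28 : ℝ)| ≤ T := by rw [abs_of_pos (by norm_num)]; linarith
  have k32 : |(32 : ℝ)| ≤ T := by rw [abs_of_pos (by norm_num)]; linarith
  have k48 : |(48 : ℝ)| ≤ T := by rw [abs_of_pos (by norm_num)]; linarith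
  have k64 : |(64 : ℝ)| ≤ T := by rw [abs_of_pos (by norm_num)]; linarith
  have k96 : |(96 : ℝ)| ≤ T := by rw [abs_of_pos (by norm_num)]; linarith
  obtain ⟨b₂, hb2⟩ : ∃ b₂ : ℤ, b₂ = 4 * a₂ := ⟨_, rfl⟩
  obtain ⟨b₄, hb4⟩ : ∃ b₄ : ℤ, b₄ = 2 * a₄ := ⟨_, rfl⟩
  obtain ⟨b₆, hb6⟩ : ∃ b₆ : ℤ, b₆ = 4 * a₆ := ⟨_, rfl⟩
  obtain ⟨b₈, hb8⟩ : ∃ b₈ : ℤ, b₈ = 4 * a₂ * a₆ - a₄ ^ 2 := ⟨_, rfl⟩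
  refine ⟨(-b₂ ^ 2 * b₈ + 9 * b₂ * b₄ * b₆ - 8 * b₄ ^ 3 - 27 * b₆ ^ 2) * s ^ 2 +
        (2 * b₂ * b₄ * b₈ - 2 * b₄ ^ 2 * b₆ - 10 * b₆ * b₈) * s * t +
        (-b₂ * b₆ * b₈ + b₄ * b₆ ^ 2) * s * u +
        (3 * b₄ ^ 2 * b₈ - 3 * b₄ * b₆ ^ 2) * t ^ 2 +
        (3 * b₄ * b₆ * b₈ - 3 * b₆ ^ 3) * t * u,
    (-b₂ * b₄ * b₈ + b₄ ^ 2 * b₆ + 5 * b₆ * b₈) * s ^ 2 +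
        (2 * b₂ * b₆ * b₈ - 2 * b₄ * b₆ ^ 2 - 10 * b₈ ^ 2) * s * t +
        (-b₂ * b₈ ^ 2 + b₄ * b₆ * b₈) * s * u +
        (3 * b₄ * b₆ * b₈ - 3 * b₆ ^ 3) * t ^ 2 +
        (3 * b₄ * b₈ ^ 2 - 3 * b₆ ^ 2 * b₈) * t * u,
    (b₂ * b₆ * b₈ - 8 * b₄ ^ 2 * b₈ + 7 * b₄ * b₆ ^ 2) * s ^ 2 +
        (-6 * b₄ * b₆ * b₈ + 6 * b₆ ^ 3) * s * t +
        (-8 * b₄ * b₈ ^ 2 + 8 * b₆ ^ 2 * b₈) * s * u, ?_, ?_, ?_, ?_⟩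
  rotate_right
  · rw [hb2, hb4, hb6, hb8]; simp only [G0, G1, G2, D, dsc]; ring
  all_goals
    subst hb2 hb4 hb6 hb8
    push_cast
    apply HB.fin hT hσ
    repeat' first
        | with_reducible apply HB.add hT hσ | with_reducible apply HB.sub hT hσ
        | with_reducible apply HB.neg
        | with_reducible apply HB.mul | with_reducible apply HB.pow
        | exact HB.var (by assumption) | exact HB.const (by assumption)
    all_goals norm_num

theorem elim_t {T σ : ℝ} (hT : 128 ≤ T) (hσ : 0 ≤ σ) {a₂ a₄ a₆ s t u : ℤ}
    (h2 : |(a₂ : ℝ)| ≤ T) (h4 : |(a₄ : ℝ)| ≤ T) (h6 : |(a₆ : ℝ)| ≤ T)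
    (hs : |(s : ℝ)| ≤ σ) (ht : |(t : ℝ)| ≤ σ) (hu : |(u : ℝ)| ≤ σ) :
    ∃ c₀ c₁ c₂ : ℤ, |(c₀ : ℝ)| ≤ T ^ 60 * σ ^ 2 ∧ |(c₁ : ℝ)| ≤ T ^ 60 * σ ^ 2 ∧
      |(c₂ : ℝ)| ≤ T ^ 60 * σ ^ 2 ∧
      c₀ * G0 a₂ a₄ a₆ s t u + c₁ * G1 a₂ a₄ a₆ s t u + c₂ * G2 s t u = D a₂ a₄ a₆ * t ^ 4 := by
  have k2 : |(2 : ℝ)| ≤ T := by rw [abs_of_pos (by norm_num)]; linarith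
  have k3 : |(3 : ℝ)| ≤ T := by rw [abs_of_pos (by norm_num)]; linarith
  have k4 : |(4 : ℝ)| ≤ T := by rw [abs_of_pos (by norm_num)]; linarith
  have k5 : |(5 : ℝ)| ≤ T := by rw [abs_of_pos (by norm_num)]; linarith
  have k6 : |(6 : ℝ)| ≤ T := by rw [abs_of_pos (by norm_num)]; linarith
  have k7 : |(7 : ℝ)| ≤ T := by rw [abs_of_pos (by norm_num)]; linarith
  have k8 : |(8 : ℝ)| ≤ T := by rw [abs_of_pos (by norm_num)]; linarith
  have k9 : |(9 : ℝ)| ≤ T := by rw [abs_of_pos (by norm_num)]; linarith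
  have k10 : |(10 : ℝ)| ≤ T := by rw [abs_of_pos (by norm_num)]; linarith
  have k12 : |(12 : ℝ)| ≤ T := by rw [abs_of_pos (by norm_num)]; linarith
  have k16 : |(16 : ℝ)| ≤ T := by rw [abs_of_pos (by norm_num)]; linarith
  have k27 : |(27 : ℝ)| ≤ T := by rw [abs_of_pos (by norm_num)]; linarith
  have k28 : |(28 : ℝ)| ≤ T := by rw [abs_of_pos (by norm_num)]; linarith
  have k32 : |(32 : ℝ)| ≤ T := by rw [abs_of_pos (by norm_num)]; linarith
  have k48 : |(48 : ℝ)| ≤ T := by rw [abs_of_pos (by norm_num)]; linarith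
  have k64 : |(64 : ℝ)| ≤ T := by rw [abs_of_pos (by norm_num)]; linarith
  have k96 : |(96 : ℝ)| ≤ T := by rw [abs_of_pos (by norm_num)]; linarith
  obtain ⟨b₂, hb2⟩ : ∃ b₂ : ℤ, b₂ = 4 * a₂ := ⟨_, rfl⟩
  obtain ⟨b₄, hb4⟩ : ∃ b₄ : ℤ, b₄ = 2 * a₄ := ⟨_, rfl⟩
  obtain ⟨b₆, hb6⟩ : ∃ b₆ : ℤ, b₆ = 4 * a₆ := ⟨_, rfl⟩
  obtain ⟨b₈, hb8⟩ : ∃ b₈ : ℤ, b₈ = 4 * a₂ * a₆ - a₄ ^ 2 := ⟨_, rfl⟩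
  refine ⟨(96 * b₆) * s * t + (12 * b₂ * b₆ - 64 * b₈) * t ^ 2 +
        (16 * b₄ * b₆) * t * u,
    (-48 * b₆) * s ^ 2 + (32 * b₈) * s * t +
        (-4 * b₂ * b₈ + 16 * b₄ * b₆) * t ^ 2 + (16 * b₄ * b₈) * t * u,
    (-12 * b₂ * b₆) * s ^ 2 + (8 * b₂ * b₈ - 32 * b₄ * b₆) * s * t +
        (-12 * b₆ ^ 2) * s * u +
        (-b₂ ^ 2 * b₈ + 9 * b₂ * b₄ * b₆ - 8 * b₄ ^ 3 - 27 * b₆ ^ 2) * t ^ 2 +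
        (4 * b₂ * b₄ * b₈ - 4 * b₂ * b₆ ^ 2) * t * u, ?_, ?_, ?_, ?_⟩
  rotate_right
  · rw [hb2, hb4, hb6, hb8]; simp only [G0, G1, G2, D, dsc]; ring
  all_goals
    subst hb2 hb4 hb6 hb8
    push_cast
    apply HB.fin hT hσ
    repeat' first
        | with_reducible apply HB.add hT hσ | with_reducible apply HB.sub hT hσ
        | with_reducible apply HB.neg
        | with_reducible apply HB.mul | with_reducible apply HB.pow
        | exact HB.var (by assumption) | exact HB.const (by assumption)
    all_goals norm_num

theorem elim_u {T σ : ℝ} (hT : 128 ≤ T) (hσ : 0 ≤ σ) {a₂ a₄ a₆ s t u : ℤ}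
    (h2 : |(a₂ : ℝ)| ≤ T) (h4 : |(a₄ : ℝ)| ≤ T) (h6 : |(a₆ : ℝ)| ≤ T)
    (hs : |(s : ℝ)| ≤ σ) (ht : |(t : ℝ)| ≤ σ) (hu : |(u : ℝ)| ≤ σ) :
    ∃ c₀ c₁ c₂ : ℤ, |(c₀ : ℝ)| ≤ T ^ 60 * σ ^ 2 ∧ |(c₁ : ℝ)| ≤ T ^ 60 * σ ^ 2 ∧
      |(c₂ : ℝ)| ≤ T ^ 60 * σ ^ 2 ∧
      c₀ * G0 a₂ a₄ a₆ s t u + c₁ * G1 a₂ a₄ a₆ s t u + c₂ * G2 s t u = D a₂ a₄ a₆ * u ^ 4 := by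
  have k2 : |(2 : ℝ)| ≤ T := by rw [abs_of_pos (by norm_num)]; linarith
  have k3 : |(3 : ℝ)| ≤ T := by rw [abs_of_pos (by norm_num)]; linarith
  have k4 : |(4 : ℝ)| ≤ T := by rw [abs_of_pos (by norm_num)]; linarith
  have k5 : |(5 : ℝ)| ≤ T := by rw [abs_of_pos (by norm_num)]; linarith
  have k6 : |(6 : ℝ)| ≤ T := by rw [abs_of_pos (by norm_num)]; linarith
  have k7 : |(7 : ℝ)| ≤ T := by rw [abs_of_pos (by norm_num)]; linarith
  have k8 : |(8 : ℝ)| ≤ T := by rw [abs_of_pos (by norm_num)]; linarith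
  have k9 : |(9 : ℝ)| ≤ T := by rw [abs_of_pos (by norm_num)]; linarith
  have k10 : |(10 : ℝ)| ≤ T := by rw [abs_of_pos (by norm_num)]; linarith
  have k12 : |(12 : ℝ)| ≤ T := by rw [abs_of_pos (by norm_num)]; linarith
  have k16 : |(16 : ℝ)| ≤ T := by rw [abs_of_pos (by norm_num)]; linarith
  have k27 : |(27 : ℝ)| ≤ T := by rw [abs_of_pos (by norm_num)]; linarith
  have k28 : |(28 : ℝ)| ≤ T := by rw [abs_of_pos (by norm_num)]; linarith
  have k32 : |(32 : ℝ)| ≤ T := by rw [abs_of_pos (by norm_num)]; linarith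
  have k48 : |(48 : ℝ)| ≤ T := by rw [abs_of_pos (by norm_num)]; linarith
  have k64 : |(64 : ℝ)| ≤ T := by rw [abs_of_pos (by norm_num)]; linarith
  have k96 : |(96 : ℝ)| ≤ T := by rw [abs_of_pos (by norm_num)]; linarith
  obtain ⟨b₂, hb2⟩ : ∃ b₂ : ℤ, b₂ = 4 * a₂ := ⟨_, rfl⟩
  obtain ⟨b₄, hb4⟩ : ∃ b₄ : ℤ, b₄ = 2 * a₄ := ⟨_, rfl⟩
  obtain ⟨b₆, hb6⟩ : ∃ b₆ : ℤ, b₆ = 4 * a₆ := ⟨_, rfl⟩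
  obtain ⟨b₈, hb8⟩ : ∃ b₈ : ℤ, b₈ = 4 * a₂ * a₆ - a₄ ^ 2 := ⟨_, rfl⟩
  refine ⟨(-12) * t ^ 2 + (-4 * b₂) * t * u + (b₂ ^ 2 - 32 * b₄) * u ^ 2,
    6 * s * t + (-b₂) * s * u + (-5 * b₄) * t * u + (b₂ * b₄ - 27 * b₆) * u ^ 2,
    (-8 * b₄) * s * u + (-12 * b₆) * t * u + (b₄ ^ 2 - 28 * b₈) * u ^ 2, ?_, ?_, ?_, ?_⟩
  rotate_right
  · rw [hb2, hb4, hb6, hb8]; simp only [G0, G1, G2, D, dsc]; ring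
  all_goals
    subst hb2 hb4 hb6 hb8
    push_cast
    apply HB.fin hT hσ
    repeat' first
        | with_reducible apply HB.add hT hσ | with_reducible apply HB.sub hT hσ
        | with_reducible apply HB.neg
        | with_reducible apply HB.mul | with_reducible apply HB.pow
        | exact HB.var (by assumption) | exact HB.const (by assumption)
    all_goals norm_num

end BGP

end PartB2

section PartB3


namespace BGP
open WeierstrassCurve.Affine WeierstrassCurve.Affine.Point

theorem sym_lower (a b c e : ℝ) : max |a| |b| * max |c| |e| ≤
    2 * max |a * c| (max |a * e + c * b| |b * e|) := by
  set m := max |a * c| (max |a * e + c * b| |b * e|) with hm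
  have h1 : |a| * |c| ≤ m := by rw [← abs_mul]; exact le_max_left _ _
  have h2 : |a * e + c * b| ≤ m := (le_max_left _ _).trans (le_max_right _ _)
  have h3 : |b| * |e| ≤ m := by
    rw [← abs_mul]; exact (le_max_right _ _).trans (le_max_right _ _)
  have h4 : |a| * |e| - |c| * |b| ≤ m := by
    have := abs_sub_abs_le_abs_sub (a * e) (-(c * b))
    rw [abs_neg, abs_mul, abs_mul, sub_neg_eq_add] at this
    linarith
  have h5 : |c| * |b| - |a| * |e| ≤ m := by
    have := abs_sub_abs_le_abs_sub (c * b) (-(a * e))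
    rw [abs_neg, abs_mul, abs_mul, sub_neg_eq_add, add_comm] at this
    linarith
  have hm0 : 0 ≤ m := (abs_nonneg _).trans h2
  have key : ∀ p q r s : ℝ, 0 ≤ p → 0 ≤ q → 0 ≤ r → 0 ≤ s → p * r ≤ m → q * s ≤ m →
      p * s - r * q ≤ m → p * s ≤ 2 * m := by
    intro p q r s hp hq hr hs h1 h3 h4
    by_contra! h
    have h6 : m < r * q := by linarith
    have h7 : (p * s) * (r * q) ≤ m * m := by
      calc (p * s) * (r * q) = (p * r) * (q * s) := by ring
        _ ≤ m * m := mul_le_mul h1 h3 (by positivity) hm0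
    nlinarith
  have ha := abs_nonneg a
  have hb := abs_nonneg b
  have hc := abs_nonneg c
  have he := abs_nonneg e
  rcases le_total |a| |b| with hab | hab <;> rcases le_total |c| |e| with hce | hce
  · rw [max_eq_right hab, max_eq_right hce]; linarith
  · rw [max_eq_right hab, max_eq_left hce, mul_comm]
    exact key |c| |e| |a| |b| hc he ha hb (by linarith [mul_comm |a| |c|])
      (by linarith [mul_comm |b| |e|]) h5
  · rw [max_eq_left hab, max_eq_right hce]
    exact key |a| |b| |c| |e| ha hb hc he h1 h3 h4
  · rw [max_eq_left hab, max_eq_left hce]; linarith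

theorem sym_upper (a b c e : ℝ) : max |a * c| (max |a * e + c * b| |b * e|) ≤
    2 * (max |a| |b| * max |c| |e|) := by
  have h1 := le_max_left |a| |b|
  have h2 := le_max_right |a| |b|
  have h3 := le_max_left |c| |e|
  have h4 := le_max_right |c| |e|
  set x := max |a| |b|
  set y := max |c| |e|
  have hx : 0 ≤ x := (abs_nonneg _).trans h1
  have hy : 0 ≤ y := (abs_nonneg _).trans h3
  have e1 : |a * c| ≤ x * y := by rw [abs_mul]; gcongr
  have e2 : |a * e| ≤ x * y := by rw [abs_mul]; gcongr
  have e3 : |c * b| ≤ x * y := by rw [abs_mul, mul_comm]; gcongr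
  have e4 : |b * e| ≤ x * y := by rw [abs_mul]; gcongr
  have hxy : 0 ≤ x * y := by positivity
  refine max_le (by linarith) (max_le ?_ (by linarith))
  linarith [abs_add_le (a * e) (c * b)]

theorem prim_sym {p q p' q' : ℤ} (h : IsCoprime p q) (h' : IsCoprime p' q') (r : ℕ)
    (hr : r.Prime) (h1 : (r : ℤ) ∣ p * p') (h2 : (r : ℤ) ∣ p * q' + p' * q)
    (h3 : (r : ℤ) ∣ q * q') : False := by
  have hp := Nat.prime_iff_prime_int.1 hr
  have nc : ∀ x y : ℤ, IsCoprime x y → (r : ℤ) ∣ x → (r : ℤ) ∣ y → False := by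
    intro x y hxy hx hy
    exact hp.not_isUnit (hxy.isUnit_of_dvd' hx hy)
  rcases hp.dvd_or_dvd h1 with ha | ha
  · have hq' := (hp.dvd_or_dvd h3).resolve_left (nc p q h ha)
    have : (r : ℤ) ∣ p' * q := (dvd_add_right (Dvd.dvd.mul_right ha _)).1 h2
    rcases hp.dvd_or_dvd this with hb | hb
    · exact nc _ _ h' hb hq'
    · exact nc _ _ h ha hb
  · have hq' := (hp.dvd_or_dvd h3).resolve_right (nc p' q' h' ha)
    have : (r : ℤ) ∣ p * q' := (dvd_add_left (Dvd.dvd.mul_right ha _)).1 h2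
    rcases hp.dvd_or_dvd this with hb | hb
    · exact nc _ _ h hb hq'
    · exact nc _ _ h' ha hb

theorem int_of_prim {x y z : ℤ} (hp : ∀ r : ℕ, r.Prime → (r : ℤ) ∣ x → (r : ℤ) ∣ y →
    (r : ℤ) ∣ z → False) (l : ℚ) {f g k : ℤ} (hx : (f : ℚ) = l * x) (hy : (g : ℚ) = l * y)
    (hz : (k : ℚ) = l * z) : ∃ m : ℤ, l = m := by
  have key : ∀ {f x : ℤ}, (f : ℚ) = l * x → (l.den : ℤ) ∣ x := by
    intro f x hx
    have h1 : l * l.den = l.num := Rat.mul_den_eq_num l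
    have : l.num * x = l.den * f := by
      have : (l.num * x : ℚ) = l.den * f := by rw [hx, ← h1]; ring
      exact_mod_cast this
    have hc : IsCoprime (l.den : ℤ) l.num := by
      rw [isCoprime_comm, Int.isCoprime_iff_gcd_eq_one]; simpa [Int.gcd] using l.reduced
    exact hc.dvd_of_dvd_mul_left ⟨f, this⟩
  by_cases h1 : l.den = 1
  · exact ⟨l.num, ((Rat.den_eq_one_iff l).1 h1).symm⟩
  · obtain ⟨r, hr, hd⟩ := Nat.exists_prime_and_dvd h1
    have hd' : (r : ℤ) ∣ l.den := by exact_mod_cast hd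
    exact (hp r hr (hd'.trans (key hx)) (hd'.trans (key hy)) (hd'.trans (key hz))).elim

variable {a₂ a₄ a₆ : ℚ}

/-- numerator of the `x`-coordinate -/
def pn : (bgpW a₂ a₄ a₆).Point → ℤ
  | .zero => 1
  | .some x _ _ => x.num
/-- denominator of the `x`-coordinate -/
def pd : (bgpW a₂ a₄ a₆).Point → ℤ
  | .zero => 0
  | .some x _ _ => x.den

/-- naive exponential height -/
noncomputable def Mx (P : (bgpW a₂ a₄ a₆).Point) : ℝ := max |(pn P : ℝ)| |(pd P : ℝ)|
/-- naive logarithmic height -/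
noncomputable def hgt (P : (bgpW a₂ a₄ a₆).Point) : ℝ := Real.log (Mx P)

theorem pcop (P : (bgpW a₂ a₄ a₆).Point) : IsCoprime (pn P) (pd P) := by
  rcases P with _ | ⟨x, y, h⟩
  · exact isCoprime_one_left
  · simp only [pn, pd]
    rw [Int.isCoprime_iff_gcd_eq_one]; simpa [Int.gcd] using x.reduced

theorem one_le_Mx (P : (bgpW a₂ a₄ a₆).Point) : 1 ≤ Mx P := by
  rcases P with _ | ⟨x, y, h⟩
  · simp [Mx, pn, pd]
  · refine le_trans ?_ (le_max_right _ _)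
    simp only [pd]
    have := x.den_pos
    rw [Int.cast_natCast, Nat.abs_cast]
    exact_mod_cast this

theorem hgt_nonneg (P : (bgpW a₂ a₄ a₆).Point) : 0 ≤ hgt P := Real.log_nonneg (one_le_Mx P)

theorem xRep_pn (P : (bgpW a₂ a₄ a₆).Point) : ∃ c : ℚ, c ≠ 0 ∧ (pn P : ℚ) = c * P.xRep 0 ∧
    (pd P : ℚ) = c * P.xRep 1 := by
  rcases P with _ | ⟨x, y, h⟩
  · exact ⟨1, one_ne_zero, by simp [pn, ← zero_def], by simp [pd, ← zero_def]⟩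
  · refine ⟨x.den, by exact_mod_cast x.den_ne_zero, ?_, by simp [pd]⟩
    simp only [pn, xRep_some, Matrix.cons_val_zero]
    rw [mul_comm]; exact (Rat.mul_den_eq_num x).symm

/-- the integral symmetric triple -/
def S0 (P Q : (bgpW a₂ a₄ a₆).Point) : ℤ := pn P * pn Q
def S1 (P Q : (bgpW a₂ a₄ a₆).Point) : ℤ := pn P * pd Q + pn Q * pd P
def S2 (P Q : (bgpW a₂ a₄ a₆).Point) : ℤ := pd P * pd Q

theorem sym2x_S (P Q : (bgpW a₂ a₄ a₆).Point) : ∃ c : ℚ, c ≠ 0 ∧ (S0 P Q : ℚ) = c * P.sym2x Q 0 ∧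
    (S1 P Q : ℚ) = c * P.sym2x Q 1 ∧ (S2 P Q : ℚ) = c * P.sym2x Q 2 := by
  obtain ⟨c, hc, h1, h2⟩ := xRep_pn P
  obtain ⟨c', hc', h1', h2'⟩ := xRep_pn Q
  refine ⟨c * c', mul_ne_zero hc hc', ?_, ?_, ?_⟩ <;>
    simp [S0, S1, S2, sym2x, h1, h2, h1', h2'] <;> ring

theorem rel_int {a₂ a₄ a₆ : ℤ} (hD : D a₂ a₄ a₆ ≠ 0) (P Q : (bgpW a₂ a₄ a₆).Point) :
    ∃ m : ℤ, m ≠ 0 ∧ m ∣ D a₂ a₄ a₆ ∧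
    G0 a₂ a₄ a₆ (S0 P Q) (S1 P Q) (S2 P Q) = m * S0 (P + Q) (P - Q) ∧
    G1 a₂ a₄ a₆ (S0 P Q) (S1 P Q) (S2 P Q) = m * S1 (P + Q) (P - Q) ∧
    G2 (S0 P Q) (S1 P Q) (S2 P Q) = m * S2 (P + Q) (P - Q) := by
  obtain ⟨l, r0, r1, r2⟩ := rel P Q
  obtain ⟨c, hc, e0, e1, e2⟩ := sym2x_S P Q
  obtain ⟨c', hc', f0, f1, f2⟩ := sym2x_S (P + Q) (P - Q)
  have g0 : (G0 a₂ a₄ a₆ (S0 P Q) (S1 P Q) (S2 P Q) : ℚ) =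
      (c ^ 2 * l / c') * S0 (P + Q) (P - Q) := by
    rw [f0]; field_simp; rw [mul_assoc, ← r0]; simp only [G0, F0]; push_cast; rw [e0, e1, e2]; ring
  have g1 : (G1 a₂ a₄ a₆ (S0 P Q) (S1 P Q) (S2 P Q) : ℚ) =
      (c ^ 2 * l / c') * S1 (P + Q) (P - Q) := by
    rw [f1]; field_simp; rw [mul_assoc, ← r1]; simp only [G1, F1]; push_cast; rw [e0, e1, e2]; ring
  have g2 : (G2 (S0 P Q) (S1 P Q) (S2 P Q) : ℚ) =
      (c ^ 2 * l / c') * S2 (P + Q) (P - Q) := by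
    rw [f2]; field_simp; rw [mul_assoc, ← r2]; simp only [G2, F2]; push_cast; rw [e0, e1, e2]; ring
  obtain ⟨m, hm⟩ := int_of_prim (fun r hr => prim_sym (pcop (P + Q)) (pcop (P - Q)) r hr) _ g0 g1 g2
  rw [hm] at g0 g1 g2
  have g0 : G0 a₂ a₄ a₆ (S0 P Q) (S1 P Q) (S2 P Q) = m * S0 (P + Q) (P - Q) := by exact_mod_cast g0
  have g1 : G1 a₂ a₄ a₆ (S0 P Q) (S1 P Q) (S2 P Q) = m * S1 (P + Q) (P - Q) := by exact_mod_cast g1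
  have g2 : G2 (S0 P Q) (S1 P Q) (S2 P Q) = m * S2 (P + Q) (P - Q) := by exact_mod_cast g2
  obtain ⟨T, hT, h2, h4, h6⟩ : ∃ T : ℝ, 128 ≤ T ∧ |(a₂ : ℝ)| ≤ T ∧ |(a₄ : ℝ)| ≤ T ∧ |(a₆ : ℝ)| ≤ T :=
    ⟨max 128 (max |(a₂ : ℝ)| (max |(a₄ : ℝ)| |(a₆ : ℝ)|)), by simp, by simp, by simp, by simp⟩
  obtain ⟨σ, hσ, hs, ht, hu⟩ : ∃ T : ℝ, 0 ≤ T ∧ |(S0 P Q : ℝ)| ≤ T ∧ |(S1 P Q : ℝ)| ≤ T ∧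
      |(S2 P Q : ℝ)| ≤ T :=
    ⟨max 0 (max |(S0 P Q : ℝ)| (max |(S1 P Q : ℝ)| |(S2 P Q : ℝ)|)), by simp, by simp, by simp, by simp⟩
  obtain ⟨u0, u1, u2, -, -, -, hu'⟩ := elim_u hT hσ h2 h4 h6 hs ht hu
  obtain ⟨t0, t1, t2, -, -, -, ht'⟩ := elim_t hT hσ h2 h4 h6 hs ht hu
  obtain ⟨s0, s1, s2, -, -, -, hs'⟩ := elim_s hT hσ h2 h4 h6 hs ht hu
  rw [g0, g1, g2] at hu' ht' hs'
  have prim := fun r hr => prim_sym (pcop P) (pcop Q) r hr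
  have hm0 : m ≠ 0 := by
    rintro rfl
    simp only [zero_mul, mul_zero, add_zero] at hu' ht' hs'
    have z0 := (mul_eq_zero.1 hs'.symm).resolve_left hD
    have z1 := (mul_eq_zero.1 ht'.symm).resolve_left hD
    have z2 := (mul_eq_zero.1 hu'.symm).resolve_left hD
    rw [pow_eq_zero_iff (by norm_num)] at z0 z1 z2
    simp only [S0, S1, S2] at z0 z1 z2
    exact prim 2 Nat.prime_two (by rw [z0]; exact dvd_zero _) (by rw [z1]; exact dvd_zero _)
      (by rw [z2]; exact dvd_zero _)
  have hmQ : (m : ℚ) ≠ 0 := by exact_mod_cast hm0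
  refine ⟨m, hm0, ?_, g0, g1, g2⟩
  have : ∃ k : ℤ, (D a₂ a₄ a₆ / m : ℚ) = k := by
    refine int_of_prim (x := S0 P Q ^ 4) (y := S1 P Q ^ 4) (z := S2 P Q ^ 4)
      (f := s0 * S0 (P + Q) (P - Q) + s1 * S1 (P + Q) (P - Q) + s2 * S2 (P + Q) (P - Q))
      (g := t0 * S0 (P + Q) (P - Q) + t1 * S1 (P + Q) (P - Q) + t2 * S2 (P + Q) (P - Q))
      (k := u0 * S0 (P + Q) (P - Q) + u1 * S1 (P + Q) (P - Q) + u2 * S2 (P + Q) (P - Q)) ?_ _ ?_ ?_ ?_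
    · intro r hr h0 h1 h2
      have hp := Nat.prime_iff_prime_int.1 hr
      exact prim r hr (hp.dvd_of_dvd_pow h0) (hp.dvd_of_dvd_pow h1) (hp.dvd_of_dvd_pow h2)
    · field_simp
      have hsQ := congrArg (Int.cast : ℤ → ℚ) hs'
      push_cast at hsQ ⊢
      linear_combination hsQ
    · field_simp
      have htQ := congrArg (Int.cast : ℤ → ℚ) ht'
      push_cast at htQ ⊢
      linear_combination htQ
    · field_simp
      have huQ := congrArg (Int.cast : ℤ → ℚ) hu'
      push_cast at huQ ⊢
      linear_combination huQ
  obtain ⟨k, hk⟩ := this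
  refine ⟨k, ?_⟩
  rw [div_eq_iff hmQ] at hk
  have : D a₂ a₄ a₆ = k * m := by exact_mod_cast hk
  rw [this, mul_comm]

theorem quasi_par {a₂ a₄ a₆ : ℤ} (hD : D a₂ a₄ a₆ ≠ 0) {T : ℝ} (hT : 128 ≤ T)
    (h2 : |(a₂ : ℝ)| ≤ T) (h4 : |(a₄ : ℝ)| ≤ T) (h6 : |(a₆ : ℝ)| ≤ T)
    (P Q : (bgpW a₂ a₄ a₆).Point) :
    |hgt (P + Q) + hgt (P - Q) - 2 * hgt P - 2 * hgt Q| ≤ 100 * Real.log T := by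
  obtain ⟨m, hm0, hmD, g0, g1, g2⟩ := rel_int hD P Q
  have hT0 : 0 < T := by linarith
  set σ : ℝ := max |(S0 P Q : ℝ)| (max |(S1 P Q : ℝ)| |(S2 P Q : ℝ)|) with hσd
  set σ' : ℝ := max |(S0 (P + Q) (P - Q) : ℝ)| (max |(S1 (P + Q) (P - Q) : ℝ)|
    |(S2 (P + Q) (P - Q) : ℝ)|) with hσd'
  have hs : |(S0 P Q : ℝ)| ≤ σ := by simp [hσd]
  have ht : |(S1 P Q : ℝ)| ≤ σ := by simp [hσd]
  have hu : |(S2 P Q : ℝ)| ≤ σ := by simp [hσd]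
  have hs' : |(S0 (P + Q) (P - Q) : ℝ)| ≤ σ' := by simp [hσd']
  have ht' : |(S1 (P + Q) (P - Q) : ℝ)| ≤ σ' := by simp [hσd']
  have hu' : |(S2 (P + Q) (P - Q) : ℝ)| ≤ σ' := by simp [hσd']
  have l1 : Mx P * Mx Q ≤ 2 * σ := by
    have := sym_lower (pn P) (pd P) (pn Q) (pd Q)
    simpa [Mx, hσd, S0, S1, S2] using this
  have l2 : σ ≤ 2 * (Mx P * Mx Q) := by
    have := sym_upper (pn P) (pd P) (pn Q) (pd Q)
    simpa only [Mx, hσd, S0, S1, S2, Int.cast_mul, Int.cast_add] using this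
  have l1' : Mx (P + Q) * Mx (P - Q) ≤ 2 * σ' := by
    have := sym_lower (pn (P + Q)) (pd (P + Q)) (pn (P - Q)) (pd (P - Q))
    simpa only [Mx, hσd', S0, S1, S2, Int.cast_mul, Int.cast_add] using this
  have l2' : σ' ≤ 2 * (Mx (P + Q) * Mx (P - Q)) := by
    have := sym_upper (pn (P + Q)) (pd (P + Q)) (pn (P - Q)) (pd (P - Q))
    simpa only [Mx, hσd', S0, S1, S2, Int.cast_mul, Int.cast_add] using this
  have o1 := one_le_Mx P
  have o2 := one_le_Mx Q
  have o3 := one_le_Mx (P + Q)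
  have o4 := one_le_Mx (P - Q)
  have hσ : 0 < σ := by nlinarith
  have hσ' : 0 < σ' := by nlinarith
  obtain ⟨b0, b1, b2⟩ := hb_G hT hσ.le h2 h4 h6 hs ht hu
  rw [g0] at b0; rw [g1] at b1; rw [g2] at b2
  have hm1 : (1 : ℝ) ≤ |(m : ℝ)| := by
    rw [← Int.cast_abs]; exact_mod_cast Int.one_le_abs hm0
  have hmT : |(m : ℝ)| ≤ T ^ 20 := by
    refine le_trans ?_ (hb_D hT h2 h4 h6)
    rw [← Int.cast_abs, ← Int.cast_abs]
    have := Int.le_of_dvd (abs_pos.2 hD) ((abs_dvd_abs m (D a₂ a₄ a₆)).2 hmD)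
    exact_mod_cast this
  -- upper bound
  have up : σ' ≤ T ^ 10 * σ ^ 2 := by
    have key : ∀ x : ℤ, |((m * x : ℤ) : ℝ)| ≤ T ^ 10 * σ ^ 2 → |(x : ℝ)| ≤ T ^ 10 * σ ^ 2 := by
      intro x hx
      rw [Int.cast_mul, abs_mul] at hx
      nlinarith [abs_nonneg (x : ℝ)]
    exact max_le (key _ b0) (max_le (key _ b1) (key _ b2))
  -- lower bound
  have lo : σ ^ 2 ≤ T ^ 81 * σ' := by
    have hD1 : (1 : ℝ) ≤ |(D a₂ a₄ a₆ : ℝ)| := by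
      rw [← Int.cast_abs]; exact_mod_cast Int.one_le_abs hD
    have gg : ∀ x : ℤ, |(x : ℝ)| ≤ σ' → |((m * x : ℤ) : ℝ)| ≤ T ^ 20 * σ' := by
      intro x hx
      rw [Int.cast_mul, abs_mul]; gcongr
    have key : ∀ x : ℤ, (∃ c₀ c₁ c₂ : ℤ, |(c₀ : ℝ)| ≤ T ^ 60 * σ ^ 2 ∧ |(c₁ : ℝ)| ≤ T ^ 60 * σ ^ 2 ∧
      |(c₂ : ℝ)| ≤ T ^ 60 * σ ^ 2 ∧
      c₀ * G0 a₂ a₄ a₆ (S0 P Q) (S1 P Q) (S2 P Q) + c₁ * G1 a₂ a₄ a₆ (S0 P Q) (S1 P Q) (S2 P Q)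
        + c₂ * G2 (S0 P Q) (S1 P Q) (S2 P Q) = D a₂ a₄ a₆ * x ^ 4) →
        |(x : ℝ)| ^ 4 ≤ σ ^ 2 * (T ^ 81 * σ') := by
      rintro x ⟨c0, c1, c2, h0, h1, h2, he⟩
      rw [g0, g1, g2] at he
      have he' : (c0 : ℝ) * ((m * S0 (P + Q) (P - Q) : ℤ) : ℝ) + c1 *
        ((m * S1 (P + Q) (P - Q) : ℤ) : ℝ) + c2 * ((m * S2 (P + Q) (P - Q) : ℤ) : ℝ) =
        D a₂ a₄ a₆ * x ^ 4 := by exact_mod_cast he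
      have q0 := mul_le_mul h0 (gg _ hs') (abs_nonneg _) (by positivity)
      have q1 := mul_le_mul h1 (gg _ ht') (abs_nonneg _) (by positivity)
      have q2 := mul_le_mul h2 (gg _ hu') (abs_nonneg _) (by positivity)
      rw [← abs_mul] at q0 q1 q2
      calc |(x : ℝ)| ^ 4 ≤ |(D a₂ a₄ a₆ : ℝ)| * |(x : ℝ)| ^ 4 := le_mul_of_one_le_left (by positivity) hD1
        _ = |(D a₂ a₄ a₆ : ℝ) * x ^ 4| := by rw [abs_mul, abs_pow]
        _ ≤ 3 * (T ^ 60 * σ ^ 2 * (T ^ 20 * σ')) := by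
            rw [← he']
            refine (abs_add_three _ _ _).trans ?_
            linarith
        _ ≤ T * (T ^ 60 * σ ^ 2 * (T ^ 20 * σ')) := by
            have : 0 ≤ (T ^ 60 * σ ^ 2 * (T ^ 20 * σ')) := by positivity
            gcongr; linarith
        _ = _ := by ring
    have k0 := key _ (elim_s hT hσ.le h2 h4 h6 hs ht hu)
    have k1 := key _ (elim_t hT hσ.le h2 h4 h6 hs ht hu)
    have k2 := key _ (elim_u hT hσ.le h2 h4 h6 hs ht hu)
    have : σ ^ 4 ≤ σ ^ 2 * (T ^ 81 * σ') := by
      rcases max_choice |(S0 P Q : ℝ)| (max |(S1 P Q : ℝ)| |(S2 P Q : ℝ)|) with h | h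
      · rw [← hσd] at h; rw [h] at k0 ⊢; exact k0
      · rw [← hσd] at h
        rcases max_choice |(S1 P Q : ℝ)| |(S2 P Q : ℝ)| with h' | h' <;> rw [h'] at h
        · rw [h] at k1 ⊢; exact k1
        · rw [h] at k2 ⊢; exact k2
    have h4 : σ ^ 4 = σ ^ 2 * σ ^ 2 := by ring
    rw [h4] at this
    exact le_of_mul_le_mul_left this (by positivity)
  have p1 : 0 < Mx P := by linarith
  have p2 : 0 < Mx Q := by linarith
  have p3 : 0 < Mx (P + Q) := by linarith
  have p4 : 0 < Mx (P - Q) := by linarith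
  have e1 : Mx (P + Q) * Mx (P - Q) ≤ T ^ 100 * (Mx P * Mx Q) ^ 2 := by
    calc Mx (P + Q) * Mx (P - Q) ≤ 2 * σ' := l1'
      _ ≤ 2 * (T ^ 10 * (2 * (Mx P * Mx Q)) ^ 2) := by
        refine mul_le_mul_of_nonneg_left (up.trans ?_) (by norm_num); gcongr
      _ = 8 * T ^ 10 * (Mx P * Mx Q) ^ 2 := by ring
      _ ≤ T ^ 90 * T ^ 10 * (Mx P * Mx Q) ^ 2 := by
        gcongr
        calc (8 : ℝ) ≤ T := by linarith
          _ ≤ T ^ 90 := le_self_pow₀ (by linarith) (by norm_num)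
      _ = _ := by ring
  have e2 : (Mx P * Mx Q) ^ 2 ≤ T ^ 100 * (Mx (P + Q) * Mx (P - Q)) := by
    calc (Mx P * Mx Q) ^ 2 ≤ (2 * σ) ^ 2 := by gcongr
      _ = 4 * σ ^ 2 := by ring
      _ ≤ 4 * (T ^ 81 * (2 * (Mx (P + Q) * Mx (P - Q)))) := by
        refine mul_le_mul_of_nonneg_left (lo.trans ?_) (by norm_num); gcongr
      _ = 8 * T ^ 81 * (Mx (P + Q) * Mx (P - Q)) := by ring
      _ ≤ T ^ 19 * T ^ 81 * (Mx (P + Q) * Mx (P - Q)) := by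
        gcongr
        calc (8 : ℝ) ≤ T := by linarith
          _ ≤ T ^ 19 := le_self_pow₀ (by linarith) (by norm_num)
      _ = _ := by ring
  have f1 := Real.log_le_log (by positivity) e1
  have f2 := Real.log_le_log (by positivity) e2
  rw [Real.log_mul (by positivity) (by positivity), Real.log_mul (by positivity) (by positivity),
    Real.log_pow, Real.log_pow, Real.log_mul (by positivity) (by positivity)] at f1
  rw [Real.log_mul (by positivity) (by positivity), Real.log_pow,
    Real.log_mul (by positivity) (by positivity), Real.log_mul (by positivity) (by positivity),
    Real.log_pow] at f2
  push_cast at f1 f2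
  unfold hgt
  rw [abs_le]
  constructor <;> linarith

theorem northcott (a₂ a₄ a₆ : ℚ) (r : ℝ) : {P : (bgpW a₂ a₄ a₆).Point | hgt P ≤ r}.Finite := by
  obtain ⟨n, hn⟩ := exists_nat_ge (Real.exp r)
  -- points with bounded x coordinate
  have hsub : ∀ P : (bgpW a₂ a₄ a₆).Point, hgt P ≤ r → pn P ∈ Set.Icc (-(n : ℤ)) n ∧
      pd P ∈ Set.Icc (-(n : ℤ)) n := by
    intro P hP
    have hM : Mx P ≤ n := by
      refine le_trans ?_ hn
      rwa [← Real.log_le_iff_le_exp (by linarith [one_le_Mx P])]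
    have h1 := abs_le.1 ((le_max_left _ _).trans hM)
    have h2 := abs_le.1 ((le_max_right _ _).trans hM)
    exact ⟨⟨by exact_mod_cast h1.1, by exact_mod_cast h1.2⟩,
      ⟨by exact_mod_cast h2.1, by exact_mod_cast h2.2⟩⟩
  have hfin : (Set.Icc (-(n : ℤ)) n ×ˢ Set.Icc (-(n : ℤ)) n).Finite :=
    (Set.finite_Icc _ _).prod (Set.finite_Icc _ _)
  refine Set.Finite.of_finite_fibers (fun P : (bgpW a₂ a₄ a₆).Point => (pn P, pd P))
    (hfin.subset ?_) ?_
  · rintro _ ⟨P, hP, rfl⟩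
    exact hsub P hP
  · rintro ⟨a, b⟩ -
    by_cases hne : ∃ P0 : (bgpW a₂ a₄ a₆).Point, (pn P0, pd P0) = (a, b)
    · obtain ⟨P0, h0⟩ := hne
      refine (Set.toFinite {P0, -P0}).subset ?_
      rintro P ⟨-, hP⟩
      have hPP : (pn P, pd P) = (pn P0, pd P0) := by rw [h0]; exact hP
      rw [Prod.mk.injEq] at hPP
      have : P.xRep = P0.xRep := by
        rcases P with _ | ⟨x, y, h⟩ <;> rcases P0 with _ | ⟨x', y', h'⟩
        · rfl
        · have := hPP.2; simp [pd] at this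
          exact absurd this.symm (by exact_mod_cast x'.den_ne_zero)
        · have := hPP.2; simp [pd] at this
        · simp only [pn, pd] at hPP
          have : x = x' := Rat.ext hPP.1 (by exact_mod_cast hPP.2)
          simp [this]
      rcases eq_or_eq_neg_of_xRep_eq_xRep this with h | h
      · left; exact h
      · right; exact h
    · convert Set.finite_empty
      ext P
      simp only [Set.mem_inter_iff, Set.mem_preimage, Set.mem_singleton_iff, Set.mem_empty_iff_false,
        iff_false, not_and]
      intro _ h
      exact hne ⟨P, h⟩
end BGP

end PartB3

section PartB4


namespace BGP
open WeierstrassCurve.Affine WeierstrassCurve.Affine.Point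

theorem val_even {p : ℕ} [Fact p.Prime] {u v w y : ℚ} (hu : u ≠ 0) (hv : v ≠ 0) (hw : w ≠ 0)
    (hy : y ^ 2 = u * v * w) (huv : v - u ≠ 0) (huw : w - u ≠ 0)
    (h1 : padicValRat p (v - u) = 0) (h2 : padicValRat p (w - u) = 0) :
    Even (padicValRat p u) := by
  have hs : (2 : ℤ) * padicValRat p y = padicValRat p u + padicValRat p v + padicValRat p w := by
    rw [← padicValRat.mul hu hv, ← padicValRat.mul (mul_ne_zero hu hv) hw, ← hy, padicValRat.pow]
    rfl
  have key : ∀ z : ℚ, z ≠ 0 → z - u ≠ 0 → padicValRat p (z - u) = 0 →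
      (padicValRat p u < 0 → padicValRat p z = padicValRat p u) ∧
      (0 < padicValRat p u → padicValRat p z = 0) := by
    intro z hz hzu hv
    constructor
    · intro h
      have := padicValRat.add_eq_of_lt (p := p) (q := u) (r := z - u) (by simpa using hz) hu hzu
        (by rw [hv]; exact h)
      simpa using this
    · intro h
      have := padicValRat.add_eq_of_lt (p := p) (q := z - u) (r := u) (by simpa using hz) hzu hu
        (by rw [hv]; exact h)
      rw [hv] at this
      simpa using this
  have k1 := key v hv huv h1
  have k2 := key w hw huw h2
  rw [Int.even_iff]
  rcases lt_trichotomy (padicValRat p u) 0 with h | h | h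
  · have := k1.1 h
    have := k2.1 h
    omega
  · omega
  · have := k1.2 h
    have := k2.2 h
    omega

theorem sq_of_even {q : ℚ} (hq : 0 < q) (h : ∀ p : ℕ, p.Prime → Even (padicValRat p q)) :
    ∃ r : ℚ, q = r ^ 2 := by
  have hnum : 0 < q.num := Rat.num_pos.2 hq
  obtain ⟨a, b, hab, ha⟩ := Nat.sq_mul_squarefree (q.num.natAbs * q.den)
  have hm : ((q.num.natAbs * q.den : ℕ) : ℚ) = q * (q.den : ℚ) ^ 2 := by
    push_cast
    have h1 : ((q.num.natAbs : ℕ) : ℚ) = (q.num : ℚ) := by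
      have : ((q.num.natAbs : ℕ) : ℤ) = q.num := Int.natAbs_of_nonneg hnum.le
      rw [← Int.cast_natCast, this]
    rw [h1]
    nth_rewrite 3 [← Rat.num_div_den q]
    field_simp
  have hden : (q.den : ℚ) ≠ 0 := by exact_mod_cast q.den_nz
  have hab' : (b : ℚ) ^ 2 * a = q * (q.den : ℚ) ^ 2 := by rw [← hm, ← hab]; push_cast; ring
  have hne : q * (q.den : ℚ) ^ 2 ≠ 0 := by positivity
  have hb0 : (b : ℚ) ≠ 0 := by rintro h0; rw [h0] at hab'; apply hne; rw [← hab']; ring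
  have ha0 : (a : ℚ) ≠ 0 := by rintro h0; rw [h0] at hab'; apply hne; rw [← hab']; ring
  have ha1 : a = 1 := by
    by_contra hne1
    obtain ⟨p, hp, hpa⟩ := Nat.exists_prime_and_dvd hne1
    have := Fact.mk hp
    have e := congrArg (padicValRat p) hab'
    rw [padicValRat.mul (pow_ne_zero _ hb0) ha0, padicValRat.mul hq.ne' (pow_ne_zero _ hden),
      padicValRat.pow, padicValRat.pow] at e
    have e1 : padicValRat p (a : ℚ) = 1 := by
      rw [padicValRat.of_nat]
      have h1 : padicValNat p a ≤ 1 := by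
        by_contra! h2
        have h3 : p ^ 2 ∣ a := (pow_dvd_pow p h2).trans pow_padicValNat_dvd
        rw [pow_two] at h3
        exact hp.not_isUnit (ha p h3)
      have h2 : 1 ≤ padicValNat p a :=
        one_le_padicValNat_of_dvd (by exact_mod_cast ha0) hpa
      exact_mod_cast le_antisymm h1 h2
    obtain ⟨k, hk⟩ := h p hp
    rw [e1, hk] at e
    push_cast at e
    omega
  refine ⟨b / q.den, ?_⟩
  rw [ha1] at hab'
  field_simp
  push_cast at hab'
  linarith

theorem halve {e1 e2 e3 : ℚ} (h12 : e1 ≠ e2) (h13 : e1 ≠ e3) (h23 : e2 ≠ e3) {x y : ℚ}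
    (h : (bgpW (-(e1 + e2 + e3)) (e1 * e2 + e1 * e3 + e2 * e3) (-(e1 * e2 * e3))).Nonsingular x y)
    {r1 r2 r3 : ℚ} (h1 : x - e1 = r1 ^ 2) (h2 : x - e2 = r2 ^ 2) (h3 : x - e3 = r3 ^ 2) :
    ∃ R, some x y h = R + R := by
  wlog hy : y = r1 * r2 * r3 generalizing r1
  · refine this (r1 := -r1) (by rw [h1]; ring) ?_
    have he := eqn h
    have : (y - r1 * r2 * r3) * (y + r1 * r2 * r3) = 0 := by
      have : y ^ 2 = (x - e1) * (x - e2) * (x - e3) := by rw [he]; ring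
      rw [h1, h2, h3] at this
      linear_combination this
    rcases mul_eq_zero.1 this with h0 | h0
    · exact absurd (by linarith) hy
    · linarith
  have E1 : e1 = x - r1 ^ 2 := by linarith
  have E2 : e2 = x - r2 ^ 2 := by linarith
  have E3 : e3 = x - r3 ^ 2 := by linarith
  have A : r1 + r2 ≠ 0 := by
    intro h0; apply h12; rw [E1, E2]; linear_combination (r2 - r1) * h0
  have B : r1 + r3 ≠ 0 := by
    intro h0; apply h13; rw [E1, E3]; linear_combination (r3 - r1) * h0
  have C : r2 + r3 ≠ 0 := by
    intro h0; apply h23; rw [E2, E3]; linear_combination (r3 - r2) * h0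
  have hy0 : (r1 + r2) * (r1 + r3) * (r2 + r3) ≠ 0 := mul_ne_zero (mul_ne_zero A B) C
  have hn : (bgpW (-(e1 + e2 + e3)) (e1 * e2 + e1 * e3 + e2 * e3) (-(e1 * e2 * e3))).Nonsingular
      (x + r1 * r2 + r1 * r3 + r2 * r3) ((r1 + r2) * (r1 + r3) * (r2 + r3)) := by
    rw [nonsingular_iff', equation_iff]
    refine ⟨?_, Or.inr ?_⟩
    · simp only [bgpW]
      rw [E1, E2, E3]
      ring
    · simp only [bgpW]
      simpa using hy0
  refine ⟨some _ _ hn, ?_⟩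
  obtain ⟨h', e⟩ := add_self hn hy0
  rw [e]
  have hl : (3 * (x + r1 * r2 + r1 * r3 + r2 * r3) ^ 2 + 2 * (-(e1 + e2 + e3)) *
      (x + r1 * r2 + r1 * r3 + r2 * r3) + (e1 * e2 + e1 * e3 + e2 * e3)) /
      (2 * ((r1 + r2) * (r1 + r3) * (r2 + r3))) = r1 + r2 + r3 := by
    rw [div_eq_iff (mul_ne_zero two_ne_zero hy0), E1, E2, E3]
    ring
  simp only [hl, some.injEq]
  constructor
  · rw [E1, E2, E3]; ring
  · rw [hy, E1, E2, E3]; ring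

theorem chord_id {e f g x1 y1 x2 y2 l : ℚ} (hx : x1 - x2 ≠ 0)
    (h1 : y1 ^ 2 = (x1 - e) * (x1 - f) * (x1 - g)) (h2 : y2 ^ 2 = (x2 - e) * (x2 - f) * (x2 - g))
    (hl : l * (x1 - x2) = y1 + y2) :
    (x1 - e) * (x2 - e) * (l ^ 2 + (e + f + g) - x1 - x2 - e) = (y1 + l * (e - x1)) ^ 2 := by
  apply mul_left_cancel₀ hx
  linear_combination (l * (x1 - e) * (- (x1 - x2)) + (x1 - e) * (y1 - y2)) * hl  +
    (x2 - e) * h1 - (x1 - e) * h2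


theorem val_int {p : ℕ} {z : ℤ} (h : ¬ (p : ℤ) ∣ z) : padicValRat p (z : ℚ) = 0 := by
  rw [padicValRat.of_int]
  exact_mod_cast padicValInt.eq_zero_of_not_dvd h

/-- The exceptional primes. -/
def exS (e1 e2 e3 : ℤ) : Finset ℕ := ((e1 - e2) * (e1 - e3) * (e2 - e3)).natAbs.primeFactors

theorem even_of_not_mem {e f g : ℤ} {n : ℤ} (hef : e - f ∣ n) (heg : e - g ∣ n) (hn : n ≠ 0)
    {p : ℕ} (hp : p.Prime)
    (hS : p ∉ n.natAbs.primeFactors) {x y : ℚ} (hy0 : y ≠ 0)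
    (hy : y ^ 2 = (x - e) * (x - f) * (x - g)) : Even (padicValRat p (x - e)) := by
  have := Fact.mk hp
  have hpn : ¬ (p : ℤ) ∣ n := by
    intro h
    apply hS
    rw [Nat.mem_primeFactors]
    exact ⟨hp, Int.natCast_dvd.1 h, by simpa using hn⟩
  have hne : y ^ 2 ≠ 0 := pow_ne_zero _ hy0
  rw [hy] at hne
  have h3 := right_ne_zero_of_mul hne
  have h12 := left_ne_zero_of_mul hne
  have hef0 : e - f ≠ 0 := fun h => hn (by rw [h] at hef; exact zero_dvd_iff.1 hef)
  have heg0 : e - g ≠ 0 := fun h => hn (by rw [h] at heg; exact zero_dvd_iff.1 heg)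
  have ef : (x - f) - (x - e) = ((e - f : ℤ) : ℚ) := by push_cast; ring
  have eg : (x - g) - (x - e) = ((e - g : ℤ) : ℚ) := by push_cast; ring
  refine val_even (left_ne_zero_of_mul h12) (right_ne_zero_of_mul h12) h3 hy ?_ ?_ ?_ ?_
  · rw [ef]; exact_mod_cast hef0
  · rw [eg]; exact_mod_cast heg0
  · rw [ef]; exact val_int (fun h => hpn (h.trans hef))
  · rw [eg]; exact val_int (fun h => hpn (h.trans heg))

theorem sq_pair {e f g : ℤ} {n : ℤ} (hef : e - f ∣ n) (heg : e - g ∣ n) (hn : n ≠ 0)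
    {x y x' y' : ℚ} (hy0 : y ≠ 0) (hy0' : y' ≠ 0)
    (hy : y ^ 2 = (x - e) * (x - f) * (x - g)) (hy' : y' ^ 2 = (x' - e) * (x' - f) * (x' - g))
    (hs : 0 < x - e ↔ 0 < x' - e)
    (hv : ∀ p ∈ n.natAbs.primeFactors, Even (padicValRat p (x - e)) ↔
      Even (padicValRat p (x' - e))) :
    ∃ r : ℚ, r ≠ 0 ∧ (x - e) * (x' - e) = r ^ 2 := by
  have hu : x - e ≠ 0 := by
    intro h; rw [h] at hy; exact hy0 (pow_eq_zero_iff two_ne_zero |>.1 (by rw [hy]; ring))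
  have hu' : x' - e ≠ 0 := by
    intro h; rw [h] at hy'; exact hy0' (pow_eq_zero_iff two_ne_zero |>.1 (by rw [hy']; ring))
  have hpos : 0 < (x - e) * (x' - e) := by
    rcases lt_or_gt_of_ne hu with h | h
    · have : x' - e < 0 := lt_of_le_of_ne (not_lt.1 (fun h2 => absurd (hs.2 h2) (not_lt.2 h.le))) hu'
      exact mul_pos_of_neg_of_neg h this
    · exact mul_pos h (hs.1 h)
  obtain ⟨r, hr⟩ := sq_of_even hpos (by
    intro p hp
    have := Fact.mk hp
    rw [padicValRat.mul hu hu']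
    by_cases hpS : p ∈ n.natAbs.primeFactors
    · exact Int.even_add.2 (hv p hpS)
    · exact (even_of_not_mem hef heg hn hp hpS hy0 hy).add
        (even_of_not_mem hef heg hn hp hpS hy0' hy'))
  refine ⟨r, ?_, hr⟩
  rintro rfl
  rw [hr] at hpos
  simp at hpos

open scoped Classical in
/-- The descent map. -/
noncomputable def phi (e1 e2 e3 : ℤ) {a₂ a₄ a₆ : ℚ} : (bgpW a₂ a₄ a₆).Point →
    Fin 4 ⊕ (Bool × Bool × (exS e1 e2 e3 → Bool) × (exS e1 e2 e3 → Bool))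
  | .zero => Sum.inl 0
  | .some x y _ => if y = 0 then (if x = e1 then Sum.inl 1 else if x = e2 then Sum.inl 2 else
      Sum.inl 3) else
      Sum.inr (decide (0 < x - e1), decide (0 < x - e2),
        fun p => decide (Even (padicValRat p (x - e1))),
        fun p => decide (Even (padicValRat p (x - e2))))

theorem phi_zero_ne {e1 e2 e3 : ℤ} {a₂ a₄ a₆ : ℚ} {x y : ℚ}
    (h : (bgpW a₂ a₄ a₆).Nonsingular x y) :
    phi e1 e2 e3 (zero : (bgpW a₂ a₄ a₆).Point) ≠ phi e1 e2 e3 (some x y h) := by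
  simp only [phi]
  split_ifs <;> simp

theorem sub_chord {a₂ a₄ a₆ : ℚ} {x1 y1 x2 y2 : ℚ} (hP : (bgpW a₂ a₄ a₆).Nonsingular x1 y1)
    (hQ : (bgpW a₂ a₄ a₆).Nonsingular x2 y2) (hx : x1 ≠ x2) :
    ∃ l x3 y3 h, l * (x1 - x2) = y1 + y2 ∧ x3 = l ^ 2 - a₂ - x1 - x2 ∧
      some x1 y1 hP - some x2 y2 hQ = some x3 y3 h := by
  obtain ⟨hneg, en⟩ := neg_pt hQ
  obtain ⟨hR, eR⟩ := add_ne hP hneg hx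
  have hxx : x1 - x2 ≠ 0 := sub_ne_zero.2 hx
  refine ⟨_, _, _, hR, ?_, rfl, ?_⟩
  · field_simp; ring
  · rw [sub_eq_add_neg, en, eR]

theorem chord_halve {e1 e2 e3 : ℚ} (q12 : e1 ≠ e2) (q13 : e1 ≠ e3) (q23 : e2 ≠ e3)
    {x1 y1 x2 y2 : ℚ}
    (hP : (bgpW (-(e1 + e2 + e3)) (e1 * e2 + e1 * e3 + e2 * e3) (-(e1 * e2 * e3))).Nonsingular x1 y1)
    (hQ : (bgpW (-(e1 + e2 + e3)) (e1 * e2 + e1 * e3 + e2 * e3) (-(e1 * e2 * e3))).Nonsingular x2 y2)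
    (hy1 : y1 ≠ 0) (hy2 : y2 ≠ 0)
    (hx : x1 ≠ x2) {s1 s2 : ℚ} (hs1 : s1 ≠ 0) (hs2 : s2 ≠ 0)
    (k1 : (x1 - e1) * (x2 - e1) = s1 ^ 2) (k2 : (x1 - e2) * (x2 - e2) = s2 ^ 2) :
    ∃ R, some x1 y1 hP - some x2 y2 hQ = (2 : ℕ) • R := by
  have c1 : y1 ^ 2 = (x1 - e1) * (x1 - e2) * (x1 - e3) := by rw [eqn hP]; ring
  have c2 : y2 ^ 2 = (x2 - e1) * (x2 - e2) * (x2 - e3) := by rw [eqn hQ]; ring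
  have k3 : (x1 - e3) * (x2 - e3) = (y1 * y2 / (s1 * s2)) ^ 2 := by
    rw [div_pow, mul_pow, mul_pow, ← k1, ← k2, c1, c2, eq_div_iff]
    · ring
    · rw [k1, k2]; positivity
  have hs3 : y1 * y2 / (s1 * s2) ≠ 0 := by positivity
  obtain ⟨l, x3, y3, hR, hl', hx3, e⟩ := sub_chord hP hQ hx
  have hxx : x1 - x2 ≠ 0 := sub_ne_zero.2 hx
  rw [e]
  have i1 := chord_id (e := e1) (f := e2) (g := e3) hxx c1 c2 hl'
  have i2 := chord_id (e := e2) (f := e1) (g := e3) hxx (by rw [c1]; ring) (by rw [c2]; ring) hl'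
  have i3 := chord_id (e := e3) (f := e1) (g := e2) hxx (by rw [c1]; ring) (by rw [c2]; ring) hl'
  rw [k1] at i1
  rw [k2] at i2
  rw [k3] at i3
  obtain ⟨R, hR'⟩ := halve q12 q13 q23 hR (r1 := (y1 + l * (e1 - x1)) / s1)
    (r2 := (y1 + l * (e2 - x1)) / s2) (r3 := (y1 + l * (e3 - x1)) / (y1 * y2 / (s1 * s2)))
    (by rw [div_pow, ← i1, eq_div_iff (by positivity), hx3]; ring)
    (by rw [div_pow, ← i2, eq_div_iff (by positivity), hx3]; ring)
    (by rw [div_pow, ← i3, eq_div_iff (by positivity), hx3]; ring)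
  exact ⟨R, by rw [two_nsmul, hR']⟩

theorem phi_tors {e1 e2 e3 : ℤ} (h12 : e1 ≠ e2) (h13 : e1 ≠ e3) (h23 : e2 ≠ e3)
    {a₂ a₄ a₆ : ℚ} {x1 y1 x2 y2 : ℚ}
    (hP : (bgpW a₂ a₄ a₆).Nonsingular x1 y1) (hQ : (bgpW a₂ a₄ a₆).Nonsingular x2 y2)
    (hy1 : y1 = 0) (hy2 : y2 = 0) (r1 : x1 = e1 ∨ x1 = e2 ∨ x1 = e3)
    (r2 : x2 = e1 ∨ x2 = e2 ∨ x2 = e3)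
    (h : phi e1 e2 e3 (some x1 y1 hP) = phi e1 e2 e3 (some x2 y2 hQ)) : x1 = x2 := by
  have q12 : (e1 : ℚ) ≠ e2 := by exact_mod_cast h12
  have q13 : (e1 : ℚ) ≠ e3 := by exact_mod_cast h13
  have q23 : (e2 : ℚ) ≠ e3 := by exact_mod_cast h23
  simp only [phi, hy1, hy2, if_true] at h
  rcases r1 with r | r | r <;> rcases r2 with s | s | s <;> rw [r, s] at h ⊢ <;> exfalso
  · rw [if_pos rfl, if_neg q12.symm, if_pos rfl] at h
    exact absurd (Sum.inl.inj h) (by decide)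
  · rw [if_pos rfl, if_neg q13.symm, if_neg q23.symm] at h
    exact absurd (Sum.inl.inj h) (by decide)
  · rw [if_pos rfl, if_neg q12.symm, if_pos rfl] at h
    exact absurd (Sum.inl.inj h) (by decide)
  · rw [if_neg q12.symm, if_pos rfl, if_neg q13.symm, if_neg q23.symm] at h
    exact absurd (Sum.inl.inj h) (by decide)
  · rw [if_neg q13.symm, if_neg q23.symm, if_pos rfl] at h
    exact absurd (Sum.inl.inj h) (by decide)
  · rw [if_neg q13.symm, if_neg q23.symm, if_neg q12.symm, if_pos rfl] at h
    exact absurd (Sum.inl.inj h) (by decide)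

theorem phi_spec {e1 e2 e3 : ℤ} (h12 : e1 ≠ e2) (h13 : e1 ≠ e3) (h23 : e2 ≠ e3)
    {a₂ a₄ a₆ : ℚ} (h2 : a₂ = -(e1 + e2 + e3)) (h4 : a₄ = e1 * e2 + e1 * e3 + e2 * e3)
    (h6 : a₆ = -(e1 * e2 * e3)) (P Q : (bgpW a₂ a₄ a₆).Point)
    (h : phi e1 e2 e3 P = phi e1 e2 e3 Q) : ∃ R, P - Q = (2 : ℕ) • R := by
  subst h2 h4 h6
  have q12 : (e1 : ℚ) ≠ e2 := by exact_mod_cast h12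
  have q13 : (e1 : ℚ) ≠ e3 := by exact_mod_cast h13
  have q23 : (e2 : ℚ) ≠ e3 := by exact_mod_cast h23
  by_cases hPQ : P = Q
  · exact ⟨0, by rw [hPQ]; simp⟩
  rcases P with _ | ⟨x1, y1, hP⟩
  · rcases Q with _ | ⟨x2, y2, hQ⟩
    · exact absurd rfl hPQ
    · exact absurd h (phi_zero_ne _)
  rcases Q with _ | ⟨x2, y2, hQ⟩
  · exact absurd h.symm (phi_zero_ne _)
  have c1 : y1 ^ 2 = (x1 - e1) * (x1 - e2) * (x1 - e3) := by rw [eqn hP]; ring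
  have c2 : y2 ^ 2 = (x2 - e1) * (x2 - e2) * (x2 - e3) := by rw [eqn hQ]; ring
  have root : ∀ x y : ℚ, y ^ 2 = (x - e1) * (x - e2) * (x - e3) → y = 0 →
      x = e1 ∨ x = e2 ∨ x = e3 := by
    intro x y hh hy
    rw [hy] at hh
    have : (x - e1) * (x - e2) * (x - e3) = 0 := by rw [← hh]; ring
    rcases mul_eq_zero.1 this with h | h
    · rcases mul_eq_zero.1 h with h | h
      · left; linarith
      · right; left; linarith
    · right; right; linarith
  by_cases hy1 : y1 = 0
  · by_cases hy2 : y2 = 0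
    · exfalso
      apply hPQ
      have : x1 = x2 := by
        exact phi_tors h12 h13 h23 hP hQ hy1 hy2 (root _ _ c1 hy1) (root _ _ c2 hy2) h
      subst this; subst hy1; subst hy2; rfl
    · exfalso
      simp only [phi, hy1, hy2, if_true, if_false] at h
      split_ifs at h
  by_cases hy2 : y2 = 0
  · exfalso
    simp only [phi, hy1, hy2, if_true, if_false] at h
    split_ifs at h
  by_cases hx : x1 = x2
  · rcases X_eq_iff.1 hx with h1 | h1
    · exact absurd h1 hPQ
    · exact ⟨some x1 y1 hP, by rw [h1, two_nsmul]; abel⟩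
  simp only [phi, hy1, hy2, if_false, Sum.inr.injEq, Prod.mk.injEq, decide_eq_decide] at h
  obtain ⟨g1, g2, g3, g4⟩ := h
  set n := (e1 - e2) * (e1 - e3) * (e2 - e3) with hn
  have hn0 : n ≠ 0 := mul_ne_zero (mul_ne_zero (sub_ne_zero.2 h12) (sub_ne_zero.2 h13))
    (sub_ne_zero.2 h23)
  obtain ⟨s1, hs1, k1⟩ := sq_pair (n := n) (e := e1) (f := e2) (g := e3) ⟨(e1 - e3) * (e2 - e3), by rw [hn]; ring⟩
    ⟨(e1 - e2) * (e2 - e3), by rw [hn]; ring⟩ hn0 hy1 hy2 c1 c2 g1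
    (fun p hp => by have := congrFun g3 ⟨p, hp⟩; simpa using this)
  obtain ⟨s2, hs2, k2⟩ := sq_pair (n := n) (e := e2) (f := e1) (g := e3) ⟨-(e1 - e3) * (e2 - e3), by rw [hn]; ring⟩
    ⟨(e1 - e2) * (e1 - e3), by rw [hn]; ring⟩ hn0 hy1 hy2 (by rw [c1]; ring) (by rw [c2]; ring) g2
    (fun p hp => by have := congrFun g4 ⟨p, hp⟩; simpa using this)
  exact chord_halve q12 q13 q23 hP hQ hy1 hy2 hx hs1 hs2 k1 k2

theorem card_F (e1 e2 e3 : ℤ) :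
    Fintype.card (Fin 4 ⊕ (Bool × Bool × (exS e1 e2 e3 → Bool) × (exS e1 e2 e3 → Bool))) ≤
      4 ^ ((exS e1 e2 e3).card + 2) := by
  simp only [Fintype.card_sum, Fintype.card_fin, Fintype.card_prod, Fintype.card_bool,
    Fintype.card_fun, Fintype.card_coe]
  rw [← mul_pow, pow_add]
  norm_num
  have : 1 ≤ 4 ^ (exS e1 e2 e3).card := Nat.one_le_pow _ _ (by norm_num)
  omega

end BGP

end PartB4

section PartB5


namespace BGP
open WeierstrassCurve.Affine WeierstrassCurve.Affine.Point

theorem quartic_root {a d g0 g1 g2 g3 g4 : ℤ} {G : ℝ} (hc : IsCoprime a d) (hd : d ≠ 0)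
    (h : g0 * a ^ 4 + g1 * a ^ 3 * d + g2 * a ^ 2 * d ^ 2 + g3 * a * d ^ 3 + g4 * d ^ 4 = 0)
    (hne : ¬ (g0 = 0 ∧ g1 = 0 ∧ g2 = 0)) (h0 : |(g0 : ℝ)| ≤ G)
    (h1 : |(g1 : ℝ)| ≤ G) (h2 : |(g2 : ℝ)| ≤ G) (h3 : |(g3 : ℝ)| ≤ G) (h4 : |(g4 : ℝ)| ≤ G) :
    |(a : ℝ)| ≤ G ∧ |(d : ℝ)| ≤ G := by
  have hG : 0 ≤ G := (abs_nonneg _).trans h0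
  have key : ∀ z g : ℤ, g ≠ 0 → z ∣ g → |(g : ℝ)| ≤ G → |(z : ℝ)| ≤ G := by
    intro z g hg hz hb
    refine le_trans ?_ hb
    have := Int.natAbs_dvd_natAbs.2 hz
    have := Nat.le_of_dvd (Int.natAbs_pos.2 hg) this
    rw [← Int.cast_abs, ← Int.cast_abs, Int.abs_eq_natAbs, Int.abs_eq_natAbs]
    exact_mod_cast this
  constructor
  · by_cases ha : a = 0
    · subst ha; simpa using hG
    · have red : ∀ k g r : ℤ, ∀ j : ℕ, g * d ^ j = a * r → a ∣ g := by
        intro k g r j e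
        exact (hc.pow_right (n := j)).dvd_of_dvd_mul_right ⟨r, e⟩
      by_cases k4 : g4 = 0
      · by_cases k3 : g3 = 0
        · by_cases k2 : g2 = 0
          · by_cases k1 : g1 = 0
            · by_cases k0 : g0 = 0
              · exact absurd ⟨k0, k1, k2⟩ hne
              · exfalso
                rw [k4, k3, k2, k1] at h
                have : g0 * a ^ 4 = 0 := by linarith
                rcases mul_eq_zero.1 this with h | h
                · exact k0 h
                · exact ha (pow_eq_zero_iff (by norm_num) |>.1 h)
            · refine key a g1 k1 (red 0 g1 (-g0) 1 ?_) h1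
              rw [k4, k3, k2] at h
              apply mul_left_cancel₀ (pow_ne_zero 3 ha)
              linear_combination h
          · refine key a g2 k2 (red 0 g2 (-(g0 * a + g1 * d)) 2 ?_) h2
            rw [k4, k3] at h
            apply mul_left_cancel₀ (pow_ne_zero 2 ha)
            linear_combination h
        · refine key a g3 k3 (red 0 g3 (-(g0 * a ^ 2 + g1 * a * d + g2 * d ^ 2)) 3 ?_) h3
          rw [k4] at h
          apply mul_left_cancel₀ (pow_ne_zero 1 ha)
          linear_combination h
      · refine key a g4 k4 (red 0 g4 (-(g0 * a ^ 3 + g1 * a ^ 2 * d + g2 * a * d ^ 2 +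
          g3 * d ^ 3)) 4 ?_) h4
        linear_combination h
  · have red : ∀ g r : ℤ, ∀ j : ℕ, g * a ^ j = d * r → d ∣ g := by
      intro g r j e
      exact (hc.symm.pow_right (n := j)).dvd_of_dvd_mul_right ⟨r, e⟩
    by_cases k0 : g0 = 0
    · by_cases k1 : g1 = 0
      · by_cases k2 : g2 = 0
        · exact absurd ⟨k0, k1, k2⟩ hne
        · refine key d g2 k2 (red g2 (-(g3 * a + g4 * d)) 2 ?_) h2
          rw [k0, k1] at h
          apply mul_left_cancel₀ (pow_ne_zero 2 hd)
          linear_combination h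
      · refine key d g1 k1 (red g1 (-(g2 * a ^ 2 + g3 * a * d + g4 * d ^ 2)) 3 ?_) h1
        rw [k0] at h
        apply mul_left_cancel₀ (pow_ne_zero 1 hd)
        linear_combination h
    · refine key d g0 k0 (red g0 (-(g1 * a ^ 3 + g2 * a ^ 2 * d + g3 * a * d ^ 2 +
          g4 * d ^ 3)) 4 ?_) h0
      linear_combination h

theorem gap_core {T M : ℝ} (hT : 128 ≤ T) (hM : 0 ≤ M) {a₂ a₄ a₆ s p t m r a d U V : ℤ}
    (b2 : |(a₂ : ℝ)| ≤ T) (b4 : |(a₄ : ℝ)| ≤ T) (b6 : |(a₆ : ℝ)| ≤ T)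
    (bs : |(s : ℝ)| ≤ T) (bp : |(p : ℝ)| ≤ T) (bt : |(t : ℝ)| ≤ T) (bm : |(m : ℝ)| ≤ T)
    (br : |(r : ℝ)| ≤ T) (bU : |(U : ℝ)| ≤ M) (bV : |(V : ℝ)| ≤ M)
    (hc : IsCoprime a d) (hd : d ≠ 0) (h4 : a₄ ≠ 0) (h6 : a₆ ≠ 0) (hs : s ≠ 0) (hV : V ≠ 0)
    (h : G2 (p * d ^ 2) (d * (s * a + t * d)) (a ^ 2 + m * a * d + r * d ^ 2) * U ^ 2
      - G1 a₂ a₄ a₆ (p * d ^ 2) (d * (s * a + t * d)) (a ^ 2 + m * a * d + r * d ^ 2) * (U * V)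
      + G0 a₂ a₄ a₆ (p * d ^ 2) (d * (s * a + t * d)) (a ^ 2 + m * a * d + r * d ^ 2) * V ^ 2
        = 0) :
    |(a : ℝ)| ≤ T ^ 20 * M ^ 2 ∧ |(d : ℝ)| ≤ T ^ 20 * M ^ 2 := by
  have c2 : |(2 : ℝ)| ≤ T := by rw [abs_of_pos (by norm_num)]; linarith
  have c4 : |(4 : ℝ)| ≤ T := by rw [abs_of_pos (by norm_num)]; linarith
  have c8 : |(8 : ℝ)| ≤ T := by rw [abs_of_pos (by norm_num)]; linarith
  refine quartic_root (g0 := -(4 * a₆) * (U * V) + (a₄ ^ 2 - 4 * a₂ * a₆) * V ^ 2)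
    (g1 := -(8 * a₆ * m + 2 * a₄ * s) * (U * V)
      + (2 * m * (a₄ ^ 2 - 4 * a₂ * a₆) - 4 * a₆ * s) * V ^ 2)
    (g2 := (s ^ 2 - 4 * p) * U ^ 2 - (4 * a₆ * (m ^ 2 + 2 * r) + 2 * a₄ * (s * m + t)
      + 4 * a₂ * p) * (U * V) + ((a₄ ^ 2 - 4 * a₂ * a₆) * (m ^ 2 + 2 * r) - 4 * a₆ * (s * m + t)
      - 2 * a₄ * p) * V ^ 2)
    (g3 := (2 * s * t - 4 * p * m) * U ^ 2 - (8 * a₆ * m * r + 2 * a₄ * (s * r + t * m)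
      + 4 * a₂ * p * m + 2 * p * s) * (U * V) + ((a₄ ^ 2 - 4 * a₂ * a₆) * (2 * m * r)
      - 4 * a₆ * (s * r + t * m) - 2 * a₄ * p * m) * V ^ 2)
    (g4 := (t ^ 2 - 4 * p * r) * U ^ 2 - (4 * a₆ * r ^ 2 + 2 * a₄ * t * r + 4 * a₂ * p * r
      + 2 * p * t) * (U * V) + ((a₄ ^ 2 - 4 * a₂ * a₆) * r ^ 2 - 4 * a₆ * t * r
      - 2 * a₄ * p * r + p ^ 2) * V ^ 2) hc hd ?_ ?_ ?_ ?_ ?_ ?_ ?_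
  · rw [← h]; unfold G0 G1 G2; ring
  · rintro ⟨e0, e1, e2⟩
    have f0 : -(4 * a₆) * U + (a₄ ^ 2 - 4 * a₂ * a₆) * V = 0 := by
      apply mul_left_cancel₀ hV; linear_combination e0
    have f1 : a₄ * U + 2 * a₆ * V = 0 := by
      apply mul_left_cancel₀ hV
      apply mul_left_cancel₀ hs
      apply mul_left_cancel₀ (two_ne_zero (α := ℤ))
      linear_combination 2 * m * e0 - e1
    have f2 : 2 * U ^ 2 + 2 * a₂ * U * V + a₄ * V ^ 2 = 0 := by
      apply mul_left_cancel₀ h4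
      linear_combination V * f0 + 2 * (U + a₂ * V) * f1
    have f3 : s ^ 2 * U ^ 2 = 0 := by
      linear_combination e2 + 2 * p * f2 + 2 * V * (s * m + t) * f1 - (m ^ 2 + 2 * r) * e0
    have hU : U = 0 := by
      rcases mul_eq_zero.1 f3 with h | h
      · exact absurd (pow_eq_zero_iff (by norm_num) |>.1 h) hs
      · exact pow_eq_zero_iff (by norm_num) |>.1 h
    rw [hU] at f1
    have : a₆ * V = 0 := by linarith
    exact (mul_ne_zero h6 hV) this
  all_goals
    push_cast
    apply HB.fin hT hM
    repeat' first
      | with_reducible apply HB.add hT hM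
      | with_reducible apply HB.sub hT hM
      | with_reducible apply HB.neg
      | with_reducible apply HB.mul
      | with_reducible apply HB.pow
      | exact HB.var (by assumption)
      | exact HB.const (by assumption)
    all_goals norm_num

theorem gap_points {T : ℝ} (hT : 128 ≤ T) {a₂ a₄ a₆ α n α' n' a d : ℤ}
    (b2 : |(a₂ : ℝ)| ≤ T) (b4 : |(a₄ : ℝ)| ≤ T) (b6 : |(a₆ : ℝ)| ≤ T)
    (bs : |((α + α' : ℤ) : ℝ)| ≤ T) (bp : |((α * α' : ℤ) : ℝ)| ≤ T)
    (bt : |((α * n' + α' * n : ℤ) : ℝ)| ≤ T) (bm : |((n + n' : ℤ) : ℝ)| ≤ T)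
    (br : |((n * n' : ℤ) : ℝ)| ≤ T)
    (hc : IsCoprime a d) (hd : d ≠ 0) (h4 : a₄ ≠ 0) (h6 : a₆ ≠ 0) (hs : α + α' ≠ 0)
    (hn : a + n * d ≠ 0) (hn' : a + n' * d ≠ 0) {x y x' y' : ℚ}
    (h : (bgpW a₂ a₄ a₆).Nonsingular x y) (h' : (bgpW a₂ a₄ a₆).Nonsingular x' y')
    (hx : x = α * d / (a + n * d)) (hx' : x' = α' * d / (a + n' * d)) (hne : x ≠ x') :
    Real.log (max |(a : ℝ)| |(d : ℝ)|) ≤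
      20 * Real.log T + 2 * hgt (some x y h - some x' y' h') := by
  set R := some x y h - some x' y' h' with hR
  have hM := one_le_Mx R
  have hRne : R ≠ 0 := by
    rw [hR, sub_ne_zero]
    intro e; injection e with e1 e2; exact hne e1
  have hR2 : some x y h + some x' y' h' ≠ 0 := by
    rw [Ne, add_eq_zero_iff_eq_neg]
    obtain ⟨h1, e1⟩ := neg_pt h'
    rw [e1]
    intro e; injection e with e1 e2; exact hne e1
  obtain ⟨l, r0, r1, r2⟩ := rel (some x y h) (some x' y' h')
  rw [← hR] at r0 r1 r2
  have hV : pd R ≠ 0 := by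
    rcases hRR : R with _ | ⟨z, w, hz⟩
    · exact absurd hRR hRne
    · simp [pd]
  obtain ⟨c, hc0, hcn, hcd⟩ := xRep_pn R
  have eqq : F2 (x * x') (x + x') 1 * (pn R : ℚ) ^ 2 - F1 a₂ a₄ a₆ (x * x') (x + x') 1 *
      ((pn R : ℚ) * pd R) + F0 a₂ a₄ a₆ (x * x') (x + x') 1 * (pd R : ℚ) ^ 2 = 0 := by
    rcases hRR : R with _ | ⟨z, w, hz⟩
    · exact absurd hRR hRne
    rcases hSS : some x y h + some x' y' h' with _ | ⟨z', w', hz'⟩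
    · exact absurd hSS hR2
    rw [hRR, hSS] at r0 r1 r2
    rw [hRR] at hcn hcd
    simp at r0 r1 r2 hcn hcd
    rw [r0, r1, r2, hcn, hcd]
    ring
  have q1 : (a + n * d : ℚ) ≠ 0 := by exact_mod_cast hn
  have q2 : (a + n' * d : ℚ) ≠ 0 := by exact_mod_cast hn'
  have hcore := gap_core (M := Mx R) (U := pn R) (V := pd R) (a := a) (d := d) hT (by linarith)
    b2 b4 b6 bs bp bt bm br (le_max_left _ _) (le_max_right _ _) hc hd h4 h6 hs hV (by
      have : ((a + n * d) * (a + n' * d) : ℚ) ^ 2 * (F2 (x * x') (x + x') 1 * (pn R : ℚ) ^ 2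
        - F1 a₂ a₄ a₆ (x * x') (x + x') 1 *
        ((pn R : ℚ) * pd R) + F0 a₂ a₄ a₆ (x * x') (x + x') 1 * (pd R : ℚ) ^ 2) = 0 := by
        rw [eqq]; ring
      have e1 : (a + n * d : ℚ) * x = α * d := by rw [hx]; field_simp
      have e2 : (a + n' * d : ℚ) * x' = α' * d := by rw [hx']; field_simp
      have f1 : ((a + n * d) * (a + n' * d) : ℚ) * (x * x') = ((α * α' * d ^ 2 : ℤ) : ℚ) := by
        push_cast; linear_combination ((a + n' * d) * x') * e1 + α * d * e2
      have f2 : ((a + n * d) * (a + n' * d) : ℚ) * (x + x') =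
          ((d * ((α + α') * a + (α * n' + α' * n) * d) : ℤ) : ℚ) := by
        push_cast; linear_combination (a + n' * d) * e1 + (a + n * d) * e2
      have f3 : ((a + n * d) * (a + n' * d) : ℚ) * 1 =
          ((a ^ 2 + (n + n') * a * d + n * n' * d ^ 2 : ℤ) : ℚ) := by
        push_cast; ring
      have hom : ∀ z s t u : ℚ, z ^ 2 * (F2 s t u * (pn R : ℚ) ^ 2 - F1 a₂ a₄ a₆ s t u *
          ((pn R : ℚ) * pd R) + F0 a₂ a₄ a₆ s t u * (pd R : ℚ) ^ 2) =
          F2 (z * s) (z * t) (z * u) * (pn R : ℚ) ^ 2 - F1 a₂ a₄ a₆ (z * s) (z * t) (z * u) *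
          ((pn R : ℚ) * pd R) + F0 a₂ a₄ a₆ (z * s) (z * t) (z * u) * (pd R : ℚ) ^ 2 := by
        intro z s t u; unfold F0 F1 F2; ring
      rw [hom, f1, f2, f3] at this
      unfold F0 F1 F2 at this
      unfold G0 G1 G2
      exact_mod_cast this)
  have hd1 : (1 : ℝ) ≤ |(d : ℝ)| := by
    rw [← Int.cast_abs]; exact_mod_cast Int.one_le_abs hd
  have hpos : 0 < max |(a : ℝ)| |(d : ℝ)| := lt_of_lt_of_le (by linarith) (le_max_right _ _)
  have := Real.log_le_log hpos (max_le hcore.1 hcore.2)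
  rw [Real.log_mul (by positivity) (by positivity), Real.log_pow, Real.log_pow] at this
  unfold hgt
  exact_mod_cast this

end BGP

end PartB5

section PartB6


namespace BGP
open WeierstrassCurve.Affine WeierstrassCurve.Affine.Point

theorem nonsing {a₂ a₄ a₆ : ℤ} (hD : D a₂ a₄ a₆ ≠ 0) {x y : ℚ}
    (h : y ^ 2 = x ^ 3 + a₂ * x ^ 2 + a₄ * x + a₆) :
    (bgpW a₂ a₄ a₆).Nonsingular x y := by
  have hΔ : (bgpW a₂ a₄ a₆).Δ ≠ 0 := by
    have : (bgpW a₂ a₄ a₆).Δ = ((D a₂ a₄ a₆ : ℤ) : ℚ) := by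
      simp only [WeierstrassCurve.Δ, WeierstrassCurve.b₂, WeierstrassCurve.b₄, WeierstrassCurve.b₆,
        WeierstrassCurve.b₈, bgpW, D, dsc]
      push_cast
      ring
    rw [this]
    exact_mod_cast hD
  rw [← equation_iff_nonsingular_of_Δ_ne_zero hΔ, equation_iff]
  simpa [bgpW] using h

theorem D_ne {e1 e2 e3 : ℤ} (h12 : e1 ≠ e2) (h13 : e1 ≠ e3) (h23 : e2 ≠ e3) :
    D (-(e1 + e2 + e3)) (e1 * e2 + e1 * e3 + e2 * e3) (-(e1 * e2 * e3)) ≠ 0 := by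
  have : D (-(e1 + e2 + e3)) (e1 * e2 + e1 * e3 + e2 * e3) (-(e1 * e2 * e3)) =
    16 * ((e1 - e2) * (e1 - e3) * (e2 - e3)) ^ 2 := by
    unfold D dsc; ring
  rw [this]
  have h1 := sub_ne_zero.2 h12
  have h2 := sub_ne_zero.2 h13
  have h3 := sub_ne_zero.2 h23
  positivity

theorem Mx_le {a₂ a₄ a₆ : ℚ} {u v : ℤ} (hu : u ≠ 0) (hv : v ≠ 0) {x y : ℚ}
    (h : (bgpW a₂ a₄ a₆).Nonsingular x y) (hx : x = u / v) {B : ℝ} (hB : |(u : ℝ)| ≤ B)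
    (hB' : |(v : ℝ)| ≤ B) : Mx (some x y h) ≤ B := by
  have key : ∀ z g : ℤ, g ≠ 0 → z ∣ g → |(z : ℝ)| ≤ |(g : ℝ)| := by
    intro z g hg hz
    have := Int.natAbs_dvd_natAbs.2 hz
    have := Nat.le_of_dvd (Int.natAbs_pos.2 hg) this
    rw [← Int.cast_abs, ← Int.cast_abs, Int.abs_eq_natAbs, Int.abs_eq_natAbs]
    exact_mod_cast this
  have h1 : x.num ∣ u := by rw [hx, ← Rat.divInt_eq_div]; exact Rat.num_dvd _ hv
  have h2 : (x.den : ℤ) ∣ v := by rw [hx, ← Rat.divInt_eq_div]; exact Rat.den_dvd _ _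
  exact max_le ((key _ _ hu h1).trans hB) ((key _ _ hv h2).trans hB')

theorem X_inj {k t n t' n' N : ℕ} {a d : ℤ} (hc : IsCoprime a d) (hd : (N : ℤ) < d)
    (hk : 0 < k) (ht : 1 ≤ t) (htN : t ≤ N) (htN' : t' ≤ N)
    (hn : a + n * d ≠ 0) (hn' : a + n' * d ≠ 0)
    (h : (((k * t : ℕ) : ℤ) : ℚ) * d / (a + (n : ℤ) * d) =
      (((k * t' : ℕ) : ℤ) : ℚ) * d / (a + (n' : ℤ) * d)) :
    t = t' ∧ n = n' := by
  have q1 : (a + (n : ℤ) * d : ℚ) ≠ 0 := by exact_mod_cast hn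
  have q2 : (a + (n' : ℤ) * d : ℚ) ≠ 0 := by exact_mod_cast hn'
  rw [div_eq_div_iff q1 q2] at h
  have hd0 : d ≠ 0 := by omega
  have h' : ((k * t : ℕ) : ℤ) * d * (a + (n' : ℤ) * d) = ((k * t' : ℕ) : ℤ) * d * (a + (n : ℤ) * d) := by
    exact_mod_cast h
  have hk0 : (k : ℤ) ≠ 0 := by exact_mod_cast hk.ne'
  have e : (t : ℤ) * (a + n' * d) = t' * (a + n * d) := by
    apply mul_left_cancel₀ hk0
    apply mul_left_cancel₀ hd0
    push_cast at h'
    linear_combination h'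
  have hdv : d ∣ (t : ℤ) - t' := by
    refine hc.symm.dvd_of_dvd_mul_right ⟨t' * n - t * n', ?_⟩
    linear_combination e
  have ht' : (t : ℤ) - t' = 0 := Int.eq_zero_of_abs_lt_dvd hdv (by rw [abs_lt]; omega)
  have htt : t = t' := by omega
  refine ⟨htt, ?_⟩
  subst htt
  have ht0 : (t : ℤ) ≠ 0 := by omega
  have := mul_left_cancel₀ ht0 e
  have : (n' : ℤ) * d = n * d := by linarith
  have := mul_right_cancel₀ hd0 this
  omega

theorem pt_eq {k1 k2 k3 t n : ℕ} {a d g x0 x1 x2 x3 : ℤ}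
    (hn : a + n * d ≠ 0) (hg : g ≠ 0) (h0 : g * (a + n * d) = x0 ^ 2)
    (h1 : g * (a + (n + k1 * t) * d) = x1 ^ 2) (h2 : g * (a + (n + k2 * t) * d) = x2 ^ 2)
    (h3 : g * (a + (n + k3 * t) * d) = x3 ^ 2) {X : ℚ}
    (hX : X = (((k1 * k2 * k3 * t : ℕ) : ℤ) : ℚ) * d / (a + (n : ℤ) * d)) :
    (k1 * k2 * k3 * x1 * x2 * x3 / x0 ^ 3 : ℚ) ^ 2 =
      (X + k2 * k3) * (X + k1 * k3) * (X + k1 * k2) := by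
  have q1 : (a + (n : ℤ) * d : ℚ) ≠ 0 := by exact_mod_cast hn
  have q1' : (a + (n : ℚ) * d : ℚ) ≠ 0 := by exact_mod_cast q1
  have qg : (g : ℚ) ≠ 0 := by exact_mod_cast hg
  have j0 : (x0 : ℚ) ^ 2 = g * (a + n * d) := by exact_mod_cast h0.symm
  have j1 : (x1 : ℚ) ^ 2 = g * (a + (n + k1 * t) * d) := by exact_mod_cast h1.symm
  have j2 : (x2 : ℚ) ^ 2 = g * (a + (n + k2 * t) * d) := by exact_mod_cast h2.symm
  have j3 : (x3 : ℚ) ^ 2 = g * (a + (n + k3 * t) * d) := by exact_mod_cast h3.symm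
  have : (k1 * k2 * k3 * x1 * x2 * x3 / x0 ^ 3 : ℚ) ^ 2 =
    (k1 * k2 * k3) ^ 2 * x1 ^ 2 * x2 ^ 2 * x3 ^ 2 / (x0 ^ 2) ^ 3 := by
    rw [div_pow]; ring
  rw [this, j0, j1, j2, j3, hX]
  push_cast
  field_simp
  ring

theorem ec_bound {N : ℕ} (hN : 128 ≤ N) {k1 k2 k3 : ℕ} (h0 : 0 < k1) (h12 : k1 < k2) (h23 : k2 < k3)
    (h3 : k3 ≤ N) {a d g : ℤ} (hc : IsCoprime a d) (hd : 0 < d) (hg : 0 < g)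
    (P : Finset (ℕ × ℕ))
    (hP : ∀ p ∈ P, 1 ≤ p.1 ∧ p.1 ≤ N ∧ p.2 ≤ N ∧ a + p.2 * d ≠ 0 ∧ ∃ x0 x1 x2 x3 : ℤ,
      g * (a + p.2 * d) = x0 ^ 2 ∧ g * (a + (p.2 + k1 * p.1) * d) = x1 ^ 2 ∧
      g * (a + (p.2 + k2 * p.1) * d) = x2 ^ 2 ∧ g * (a + (p.2 + k3 * p.1) * d) = x3 ^ 2)
    (hB : 10000 * Real.log N ≤ Real.log d) :
    P.card ≤ (4 ^ ((exS (-(k2 * k3)) (-(k1 * k3)) (-(k1 * k2))).card + 2)) ^ 3 := by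
  have hNR : (128 : ℝ) ≤ N := by exact_mod_cast hN
  have hlogN : 0 < Real.log N := Real.log_pos (by linarith)
  have hdR : (0 : ℝ) < d := by exact_mod_cast hd
  have hNd : (N : ℤ) < d := by
    have : Real.log N < Real.log d := by linarith
    have := (Real.log_lt_log_iff (by linarith) hdR).1 this
    exact_mod_cast this
  set e1 : ℤ := -(k2 * k3) with he1
  set e2 : ℤ := -(k1 * k3) with he2
  set e3 : ℤ := -(k1 * k2) with he3
  have z0 : (0 : ℤ) < k1 := by exact_mod_cast h0
  have z12 : (k1 : ℤ) < k2 := by exact_mod_cast h12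
  have z23 : (k2 : ℤ) < k3 := by exact_mod_cast h23
  have q12 : e1 ≠ e2 := by rw [he1, he2]; intro h; nlinarith
  have q13 : e1 ≠ e3 := by rw [he1, he3]; intro h; nlinarith
  have q23 : e2 ≠ e3 := by rw [he2, he3]; intro h; nlinarith
  have hD := D_ne q12 q13 q23
  set a₂ : ℤ := -(e1 + e2 + e3) with ha2
  set a₄ : ℤ := e1 * e2 + e1 * e3 + e2 * e3 with ha4
  set a₆ : ℤ := -(e1 * e2 * e3) with ha6
  set T : ℝ := (N : ℝ) ^ 8 with hTdef
  have pw : ∀ {i j : ℕ}, i ≤ j → (N : ℝ) ^ i ≤ N ^ j := fun h => pow_le_pow_right₀ (by linarith) h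
  have hT : 128 ≤ T := hNR.trans (by simpa using pw (i := 1) (j := 8) (by norm_num))
  have r1 : (k1 : ℝ) ≤ N := by exact_mod_cast (by omega : k1 ≤ N)
  have r2 : (k2 : ℝ) ≤ N := by exact_mod_cast (by omega : k2 ≤ N)
  have r3 : (k3 : ℝ) ≤ N := by exact_mod_cast (by omega : k3 ≤ N)
  have p7 : (0 : ℝ) ≤ (N : ℝ) ^ 7 := by positivity
  have hT7 : 128 * (N : ℝ) ^ 7 ≤ T := by rw [hTdef, pow_succ _ 7]; nlinarith
  have b2 : |(a₂ : ℝ)| ≤ T := by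
    have : (a₂ : ℝ) = k2 * k3 + k1 * k3 + k1 * k2 := by
      rw [ha2, he1, he2, he3]; push_cast; ring
    rw [this, abs_of_nonneg (by positivity)]
    calc (k2 * k3 + k1 * k3 + k1 * k2 : ℝ) ≤ N * N + N * N + N * N := by gcongr
      _ = 3 * (N : ℝ) ^ 2 := by ring
      _ ≤ 3 * (N : ℝ) ^ 7 := by gcongr <;> [linarith; norm_num]
      _ ≤ T := by linarith
  have b4 : |(a₄ : ℝ)| ≤ T := by
    have : (a₄ : ℝ) = k1 * k2 * k3 * (k1 + k2 + k3) := by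
      rw [ha4, he1, he2, he3]; push_cast; ring
    rw [this, abs_of_nonneg (by positivity)]
    calc (k1 * k2 * k3 * (k1 + k2 + k3) : ℝ) ≤ N * N * N * (N + N + N) := by gcongr
      _ = 3 * (N : ℝ) ^ 4 := by ring
      _ ≤ 3 * (N : ℝ) ^ 7 := by gcongr <;> [linarith; norm_num]
      _ ≤ T := by linarith
  have e6 : a₆ = (k1 * k2 * k3) ^ 2 := by rw [ha6, he1, he2, he3]; ring
  have b6 : |(a₆ : ℝ)| ≤ T := by
    rw [e6]
    push_cast
    rw [abs_of_nonneg (by positivity)]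
    calc ((k1 * k2 * k3) ^ 2 : ℝ) ≤ (N * N * N) ^ 2 := by gcongr
      _ = (N : ℝ) ^ 6 := by ring
      _ ≤ T := pw (by norm_num)
  have n4 : a₄ ≠ 0 := by
    have : a₄ = k1 * k2 * k3 * (k1 + k2 + k3) := by rw [ha4, he1, he2, he3]; ring
    rw [this]
    have : (0 : ℤ) < k2 := by linarith
    have : (0 : ℤ) < k3 := by linarith
    positivity
  have n6 : a₆ ≠ 0 := by
    rw [e6]
    have : (0 : ℤ) < k2 := by linarith
    have : (0 : ℤ) < k3 := by linarith
    positivity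
  have hk : 0 < k1 * k2 * k3 := by
    have : 0 < k2 := by omega
    have : 0 < k3 := by omega
    positivity
  have hkN : ((k1 * k2 * k3 : ℕ) : ℝ) ≤ (N : ℝ) ^ 3 := by
    push_cast
    calc (k1 * k2 * k3 : ℝ) ≤ N * N * N := by gcongr
      _ = _ := by ring
  -- the points
  let X : ℕ × ℕ → ℚ := fun p => (((k1 * k2 * k3 * p.1 : ℕ) : ℤ) : ℚ) * d / (a + (p.2 : ℤ) * d)
  have hpt : ∀ p : P, ∃ y, (bgpW a₂ a₄ a₆).Nonsingular (X p.1) y := by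
    rintro ⟨p, hp⟩
    obtain ⟨-, -, -, hn, x0, x1, x2, x3, w0, w1, w2, w3⟩ := hP p hp
    refine ⟨_, nonsing hD ((pt_eq (X := X p) hn hg.ne' w0 w1 w2 w3 rfl).trans ?_)⟩
    rw [ha2, ha4, ha6, he1, he2, he3]
    push_cast
    ring
  choose Y hY using hpt
  let f : P → (bgpW a₂ a₄ a₆).Point := fun p => some (X p.1) (Y p) (hY p)
  have Xne : ∀ p p' : P, p ≠ p' → X p.1 ≠ X p'.1 := by
    intro p p' hne he
    obtain ⟨t1, t2, t3, t4, -⟩ := hP p.1 p.2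
    obtain ⟨t1', t2', t3', t4', -⟩ := hP p'.1 p'.2
    have := X_inj hc hNd hk t1 t2 t2' t4 t4' he
    exact hne (Subtype.ext (Prod.ext this.1 this.2))
  have finj : Function.Injective f := by
    intro p p' he
    by_contra hne
    injection he with he1 he2
    exact Xne p p' hne he1
  classical
  have hcard : (P.attach.image f).card = P.card := by
    rw [Finset.card_image_of_injective _ finj, Finset.card_attach]
  rw [← hcard]
  set B : ℝ := max |(a : ℝ)| |(d : ℝ)| with hBdef
  have hBd : (d : ℝ) ≤ B := (le_abs_self _).trans (le_max_right _ _)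
  have hBpos : 0 < B := by linarith
  have hlogB : 10000 * Real.log N ≤ Real.log B := hB.trans (Real.log_le_log hdR hBd)
  have hlogT : Real.log T = 8 * Real.log N := by rw [hTdef, Real.log_pow]; norm_num
  refine (bgp_packing (phi e1 e2 e3) (phi_spec q12 q13 q23 (by rw [ha2]; push_cast; rfl) (by rw [ha4]; push_cast; rfl)
    (by rw [ha6]; push_cast; rfl)) hgt (100 * Real.log T) hgt_nonneg
    (quasi_par hD hT b2 b4 b6) (northcott _ _ _) (P.attach.image f)
    (Real.log B + Real.log T) ((Real.log B - 20 * Real.log T) / 2) ?_ ?_ ?_ ?_).trans ?_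
  · intro R hR
    obtain ⟨p, -, rfl⟩ := Finset.mem_image.1 hR
    obtain ⟨t1, t2, t3, t4, -⟩ := hP p.1 p.2
    have t2R : ((p.1.1 : ℕ) : ℝ) ≤ N := by exact_mod_cast t2
    have t3R : ((p.1.2 : ℕ) : ℝ) ≤ N := by exact_mod_cast t3
    rw [← Real.log_mul hBpos.ne' (by linarith)]
    refine Real.log_le_log (by linarith [one_le_Mx (f p)]) ?_
    have hkt : 0 < k1 * k2 * k3 * p.1.1 := by positivity
    refine Mx_le (u := ((k1 * k2 * k3 * p.1.1 : ℕ) : ℤ) * d) (v := a + (p.1.2 : ℤ) * d)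
      (mul_ne_zero (by exact_mod_cast hkt.ne') hd.ne') t4 _ ?_ ?_ ?_
    · simp only [X]; push_cast; rfl
    · rw [Int.cast_mul, abs_mul, mul_comm]
      refine mul_le_mul (le_max_right _ _) ?_ (abs_nonneg _) hBpos.le
      rw [Int.cast_natCast, Nat.abs_cast, Nat.cast_mul]
      calc ((k1 * k2 * k3 : ℕ) : ℝ) * (p.1.1 : ℕ) ≤ (N : ℝ) ^ 3 * N := by gcongr
        _ = (N : ℝ) ^ 4 := by ring
        _ ≤ T := pw (by norm_num)
    · push_cast
      calc |(a : ℝ) + (p.1.2 : ℕ) * d| ≤ |(a : ℝ)| + |((p.1.2 : ℕ) : ℝ) * d| := abs_add_le _ _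
        _ ≤ B + N * B := by
          rw [abs_mul, Nat.abs_cast]
          gcongr
          · exact le_max_left _ _
          · exact le_max_right _ _
        _ = B * (1 + N) := by ring
        _ ≤ B * T := by
          gcongr
          have := pw (i := 1) (j := 7) (by norm_num)
          rw [pow_one] at this
          linarith
  · intro R hR R' hR' hne
    obtain ⟨p, -, rfl⟩ := Finset.mem_image.1 hR
    obtain ⟨p', -, rfl⟩ := Finset.mem_image.1 hR'
    have hpp : p ≠ p' := fun h => hne (by rw [h])
    obtain ⟨t1, t2, t3, t4, -⟩ := hP p.1 p.2
    obtain ⟨t1', t2', t3', t4', -⟩ := hP p'.1 p'.2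
    have s1 : ((p.1.1 : ℕ) : ℝ) ≤ N := by exact_mod_cast t2
    have s2 : ((p.1.2 : ℕ) : ℝ) ≤ N := by exact_mod_cast t3
    have s1' : ((p'.1.1 : ℕ) : ℝ) ≤ N := by exact_mod_cast t2'
    have s2' : ((p'.1.2 : ℕ) : ℝ) ≤ N := by exact_mod_cast t3'
    have A1 : ((k1 * k2 * k3 * p.1.1 : ℕ) : ℝ) ≤ (N : ℝ) ^ 4 := by
      rw [Nat.cast_mul]
      calc ((k1 * k2 * k3 : ℕ) : ℝ) * (p.1.1 : ℕ) ≤ (N : ℝ) ^ 3 * N := by gcongr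
        _ = _ := by ring
    have A2 : ((k1 * k2 * k3 * p'.1.1 : ℕ) : ℝ) ≤ (N : ℝ) ^ 4 := by
      rw [Nat.cast_mul]
      calc ((k1 * k2 * k3 : ℕ) : ℝ) * (p'.1.1 : ℕ) ≤ (N : ℝ) ^ 3 * N := by gcongr
        _ = _ := by ring
    have A1p : 0 < k1 * k2 * k3 * p.1.1 := by positivity
    set α := k1 * k2 * k3 * p.1.1 with hα
    set α' := k1 * k2 * k3 * p'.1.1 with hα'
    have := gap_points hT b2 b4 b6 (α := (α : ℤ)) (α' := (α' : ℤ)) (n := (p.1.2 : ℤ))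
      (n' := (p'.1.2 : ℤ)) ?_ ?_ ?_ ?_ ?_ hc hd.ne' n4 n6 (by positivity) t4 t4' (hY p) (hY p') rfl rfl
      (Xne p p' hpp)
    · have e : hgt (some (X p.1) (Y p) (hY p) - some (X p'.1) (Y p') (hY p')) = hgt (f p - f p') := rfl
      rw [e] at this
      linarith
    all_goals push_cast
    all_goals rw [abs_of_nonneg (by positivity)]
    · have := pw (i := 4) (j := 7) (by norm_num)
      linarith
    · calc (α : ℝ) * α' ≤ (N : ℝ) ^ 4 * N ^ 4 := by gcongr
        _ = T := by rw [hTdef]; ring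
    · calc (α : ℝ) * (p'.1.2 : ℕ) + α' * (p.1.2 : ℕ) ≤ (N : ℝ) ^ 4 * N + N ^ 4 * N := by gcongr
        _ = 2 * (N : ℝ) ^ 5 := by ring
        _ ≤ 2 * (N : ℝ) ^ 7 := by gcongr <;> [linarith; norm_num]
        _ ≤ T := by linarith
    · have := pw (i := 1) (j := 7) (by norm_num)
      rw [pow_one] at this
      linarith
    · calc ((p.1.2 : ℕ) : ℝ) * (p'.1.2 : ℕ) ≤ (N : ℝ) * N := by gcongr
        _ = (N : ℝ) ^ 2 := by ring
        _ ≤ T := pw (by norm_num)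
  · rw [hlogT]; linarith
  · rw [hlogT]; linarith
  · exact Nat.pow_le_pow_left (card_F _ _ _) 3

end BGP

end PartB6

section PartC1


namespace BGP

open scoped Classical in
theorem comb_bad (N K t : ℕ) (hK : 1 ≤ K) (ht : 1 ≤ t) (S : Finset ℕ) (hS : S ⊆ Finset.range N) :
    (S.filter fun n => ((Finset.Ioo 0 K).filter fun j => n + j * t ∈ S).card < 3).card ≤
      3 * (t * (N / t / K + 1)) := by
  set bad := S.filter fun n => ((Finset.Ioo 0 K).filter fun j => n + j * t ∈ S).card < 3 with hbad
  have := Finset.card_le_mul_card_image_of_maps_to (s := bad)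
    (t := Finset.range t ×ˢ Finset.range (N / t / K + 1)) (f := fun n => (n % t, n / t / K)) ?_ 3 ?_
  · simpa using this
  · intro n hn
    have hnN : n < N := Finset.mem_range.1 (hS (Finset.mem_filter.1 hn).1)
    rw [Finset.mem_product, Finset.mem_range, Finset.mem_range]
    refine ⟨Nat.mod_lt _ (by omega), Nat.lt_succ_of_le ?_⟩
    exact Nat.div_le_div_right (Nat.div_le_div_right hnN.le)
  · rintro ⟨b1, b2⟩ -
    by_contra! hlt
    set A := bad.filter fun n => (n % t, n / t / K) = (b1, b2) with hA
    have hne : A.Nonempty := Finset.card_pos.1 (by omega)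
    set n0 := A.min' hne with hn0
    have hn0A : n0 ∈ A := Finset.min'_mem _ _
    have hn0b : n0 ∈ bad := (Finset.mem_filter.1 hn0A).1
    have hmod0 := (Finset.mem_filter.1 hn0A).2
    have hlt3 := (Finset.mem_filter.1 hn0b).2
    have hcard : (A.erase n0).card ≤
        ((Finset.Ioo 0 K).filter fun j => n0 + j * t ∈ S).card := by
      refine Finset.card_le_card_of_injOn (fun n => n / t - n0 / t) ?_ ?_
      · intro n hn
        have hn := Finset.mem_coe.1 hn
        have hnA := Finset.mem_of_mem_erase hn
        have hnne := Finset.ne_of_mem_erase hn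
        have hle : n0 ≤ n := Finset.min'_le _ _ hnA
        have hnb := (Finset.mem_filter.1 hnA).1
        have hmod := (Finset.mem_filter.1 hnA).2
        have hnS := (Finset.mem_filter.1 hnb).1
        rw [Prod.mk.injEq] at hmod hmod0
        have d1 := Nat.div_add_mod n t
        have d0 := Nat.div_add_mod n0 t
        rw [hmod.1] at d1
        rw [hmod0.1] at d0
        have hdle : n0 / t ≤ n / t := Nat.div_le_div_right hle
        have hdne : n0 / t ≠ n / t := by
          intro h; rw [h] at d0; omega
        have c1 := Nat.div_add_mod (n / t) K
        have c0 := Nat.div_add_mod (n0 / t) K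
        have m1 := Nat.mod_lt (n / t) hK
        have m0 := Nat.mod_lt (n0 / t) hK
        rw [hmod.2] at c1
        rw [hmod0.2] at c0
        simp only [Finset.coe_filter, Finset.mem_Ioo, Set.mem_ofPred_eq]
        refine ⟨⟨by omega, by omega⟩, ?_⟩
        have : n0 + (n / t - n0 / t) * t = n := by
          rw [Nat.sub_mul, mul_comm (n / t), mul_comm (n0 / t)]
          have := Nat.mul_le_mul_left t hdle
          omega
        rwa [this]
      · intro n hn m hm he
        have hn := Finset.mem_coe.1 hn
        have hm := Finset.mem_coe.1 hm
        have hnA := Finset.mem_of_mem_erase hn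
        have hmA := Finset.mem_of_mem_erase hm
        have hle : n0 ≤ n := Finset.min'_le _ _ hnA
        have hle' : n0 ≤ m := Finset.min'_le _ _ hmA
        have hmod := (Finset.mem_filter.1 hnA).2
        have hmod' := (Finset.mem_filter.1 hmA).2
        rw [Prod.mk.injEq] at hmod hmod'
        have hdle : n0 / t ≤ n / t := Nat.div_le_div_right hle
        have hdle' : n0 / t ≤ m / t := Nat.div_le_div_right hle'
        have : n / t = m / t := by simp only at he; omega
        have d1 := Nat.div_add_mod n t
        have d0 := Nat.div_add_mod m t
        rw [hmod.1] at d1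
        rw [hmod'.1, ← this] at d0
        omega
    rw [Finset.card_erase_of_mem hn0A] at hcard
    omega

theorem three_ordered {A : Finset ℕ} (h : 3 ≤ A.card) :
    ∃ x : ℕ × ℕ × ℕ, x.1 ∈ A ∧ x.2.1 ∈ A ∧ x.2.2 ∈ A ∧ x.1 < x.2.1 ∧ x.2.1 < x.2.2 := by
  obtain ⟨a, b, c, ha, hb, hc, hab, hac, hbc⟩ := Finset.two_lt_card_iff.1 h
  rcases lt_or_gt_of_ne hab with h1 | h1 <;> rcases lt_or_gt_of_ne hac with h2 | h2 <;>
    rcases lt_or_gt_of_ne hbc with h3 | h3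
  · exact ⟨(a, b, c), ha, hb, hc, h1, h3⟩
  · exact ⟨(a, c, b), ha, hc, hb, h2, h3⟩
  · omega
  · exact ⟨(c, a, b), hc, ha, hb, h2, h1⟩
  · exact ⟨(b, a, c), hb, ha, hc, h1, h2⟩
  · omega
  · exact ⟨(b, c, a), hb, hc, ha, h3, h2⟩
  · exact ⟨(c, b, a), hc, hb, ha, h3, h1⟩

theorem comb {N K T M : ℕ} (hK : 1 ≤ K) (S : Finset ℕ) (hS : S ⊆ Finset.range N)
    (hsK : 12 * N ≤ S.card * K) (hTK : T * K ≤ N)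
    (hM : ∀ k1 k2 k3 : ℕ, 0 < k1 → k1 < k2 → k2 < k3 → k3 < K → ∀ P : Finset (ℕ × ℕ),
      (∀ p ∈ P, 1 ≤ p.1 ∧ p.1 ≤ T ∧ p.2 ∈ S ∧ p.2 + k1 * p.1 ∈ S ∧ p.2 + k2 * p.1 ∈ S ∧
        p.2 + k3 * p.1 ∈ S) → P.card ≤ M) :
    T * S.card ≤ 2 * (M * K ^ 3) := by
  classical
  let good : ℕ → Finset ℕ := fun t =>
    S.filter fun n => ¬ ((Finset.Ioo 0 K).filter fun j => n + j * t ∈ S).card < 3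
  have hgood : ∀ t ∈ Finset.Icc 1 T, S.card ≤ 2 * (good t).card := by
    intro t ht
    rw [Finset.mem_Icc] at ht
    have h1 := comb_bad N K t hK ht.1 S hS
    have h2 := Finset.card_filter_add_card_filter_not (s := S)
      (fun n => ((Finset.Ioo 0 K).filter fun j => n + j * t ∈ S).card < 3)
    have h3 : t * (N / t / K) * K ≤ N := by
      calc t * (N / t / K) * K = t * (N / t / K * K) := by ring
        _ ≤ t * (N / t) := Nat.mul_le_mul_left _ (Nat.div_mul_le_self _ _)
        _ ≤ N := Nat.mul_div_le _ _
    have h4 : t * K ≤ N := (Nat.mul_le_mul_right _ ht.2).trans hTK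
    have h5 : 3 * (t * (N / t / K + 1)) * K ≤ 6 * N := by
      calc 3 * (t * (N / t / K + 1)) * K = 3 * (t * (N / t / K) * K) + 3 * (t * K) := by ring
        _ ≤ _ := by omega
    have h6 : 2 * (3 * (t * (N / t / K + 1))) ≤ S.card := by
      refine Nat.le_of_mul_le_mul_right ?_ (show 0 < K by omega)
      calc 2 * (3 * (t * (N / t / K + 1))) * K = 2 * (3 * (t * (N / t / K + 1)) * K) := by ring
        _ ≤ 2 * (6 * N) := Nat.mul_le_mul_left _ h5
        _ ≤ _ := by omega
    show S.card ≤ 2 * (S.filter _).card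
    omega
  let Q : Finset (ℕ × ℕ) := ((Finset.Icc 1 T) ×ˢ S).filter fun p => p.2 ∈ good p.1
  have hQ : T * S.card ≤ 2 * Q.card := by
    have : Q.card = ∑ t ∈ Finset.Icc 1 T, (good t).card := by
      have e : Q = (Finset.Icc 1 T).biUnion fun t => (good t).image fun n => (t, n) := by
        ext ⟨t, n⟩
        simp only [Q, good, Finset.mem_filter, Finset.mem_product, Finset.mem_biUnion,
          Finset.mem_image, Prod.mk.injEq]
        constructor
        · rintro ⟨⟨h1, h2⟩, h3⟩
          exact ⟨t, h1, n, h3, rfl, rfl⟩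
        · rintro ⟨t', h1, n', h3, rfl, rfl⟩
          exact ⟨⟨h1, h3.1⟩, h3⟩
      rw [e, Finset.card_biUnion]
      · refine Finset.sum_congr rfl fun t _ => ?_
        exact Finset.card_image_of_injective _ (fun x y h => (Prod.mk.inj h).2)
      · intro x _ y _ hxy
        rw [Function.onFun, Finset.disjoint_left]
        rintro ⟨p, q⟩ h1 h2
        simp only [Finset.mem_image, Prod.mk.injEq] at h1 h2
        obtain ⟨_, _, h1, _⟩ := h1
        obtain ⟨_, _, h2, _⟩ := h2
        exact hxy (h1.trans h2.symm)
    rw [this, Finset.mul_sum]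
    calc T * S.card = ∑ t ∈ Finset.Icc 1 T, S.card := by simp
      _ ≤ _ := Finset.sum_le_sum hgood
  have hpat : ∀ p : ℕ × ℕ, ∃ x : ℕ × ℕ × ℕ, p ∈ Q → (x.1 ∈ (Finset.Ioo 0 K).filter fun j => p.2 + j * p.1 ∈ S) ∧
      (x.2.1 ∈ (Finset.Ioo 0 K).filter fun j => p.2 + j * p.1 ∈ S) ∧
      (x.2.2 ∈ (Finset.Ioo 0 K).filter fun j => p.2 + j * p.1 ∈ S) ∧ x.1 < x.2.1 ∧ x.2.1 < x.2.2 := by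
    intro p
    by_cases hp : p ∈ Q
    · have h1 := (Finset.mem_filter.1 (Finset.mem_filter.1 hp).2).2
      obtain ⟨x, hx⟩ := three_ordered (not_lt.1 h1)
      exact ⟨x, fun _ => hx⟩
    · exact ⟨(0, 0, 0), fun h => absurd h hp⟩
  choose f hf using hpat
  have hmain := Finset.card_le_mul_card_image_of_maps_to (s := Q) (f := f)
    (t := Finset.range K ×ˢ Finset.range K ×ˢ Finset.range K) ?_ M ?_
  · rw [Finset.card_product, Finset.card_product, Finset.card_range] at hmain
    calc T * S.card ≤ 2 * Q.card := hQ
      _ ≤ 2 * (M * (K * (K * K))) := Nat.mul_le_mul_left _ hmain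
      _ = _ := by ring
  · intro p hp
    obtain ⟨h1, h2, h3, -⟩ := hf p hp
    simp only [Finset.mem_filter, Finset.mem_Ioo] at h1 h2 h3
    simp only [Finset.mem_product, Finset.mem_range]
    exact ⟨h1.1.2, h2.1.2, h3.1.2⟩
  · rintro ⟨k1, k2, k3⟩ -
    by_cases hempty : (Q.filter fun p => f p = (k1, k2, k3)) = ∅
    · rw [hempty]; simp
    obtain ⟨p0, hp0⟩ := Finset.nonempty_iff_ne_empty.2 hempty
    have hprop : ∀ p ∈ Q.filter fun p => f p = (k1, k2, k3), (0 < k1 ∧ k1 < k2 ∧ k2 < k3 ∧ k3 < K) ∧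
        1 ≤ p.1 ∧ p.1 ≤ T ∧ p.2 ∈ S ∧ p.2 + k1 * p.1 ∈ S ∧ p.2 + k2 * p.1 ∈ S ∧
        p.2 + k3 * p.1 ∈ S := by
      intro p hp
      obtain ⟨hpQ, hfp⟩ := Finset.mem_filter.1 hp
      have h := hf p hpQ
      rw [hfp] at h
      simp only [Finset.mem_filter, Finset.mem_Ioo] at h
      have hq := (Finset.mem_filter.1 hpQ).1
      rw [Finset.mem_product, Finset.mem_Icc] at hq
      exact ⟨⟨h.1.1.1, h.2.2.2.1, h.2.2.2.2, h.2.2.1.1.2⟩, hq.1.1, hq.1.2, hq.2, h.1.2, h.2.1.2,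
        h.2.2.1.2⟩
    obtain ⟨⟨w1, w2, w3, w4⟩, -⟩ := hprop p0 hp0
    exact hM k1 k2 k3 w1 w2 w3 w4 _ (fun p hp => (hprop p hp).2)

/-- bound for the number of prime factors -/
theorem omega_bound (A m : ℕ) (hA : 2 ≤ A) (hm : m ≠ 0) :
    (m.primeFactors.card : ℝ) * Real.log A ≤ A * Real.log A + Real.log m := by
  classical
  have hsplit := Finset.card_filter_add_card_filter_not (s := m.primeFactors) (fun p => p < A)
  have h1 : (m.primeFactors.filter fun p => p < A).card ≤ A := by
    calc _ ≤ (Finset.range A).card := Finset.card_le_card (fun p hp => by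
          rw [Finset.mem_range]; exact (Finset.mem_filter.1 hp).2)
      _ = A := Finset.card_range A
  have h2 : A ^ (m.primeFactors.filter fun p => ¬ p < A).card ≤ m := by
    calc _ ≤ ∏ p ∈ m.primeFactors.filter fun p => ¬ p < A, p :=
          Finset.pow_card_le_prod _ _ _ (fun p hp => not_lt.1 (Finset.mem_filter.1 hp).2)
      _ ≤ ∏ p ∈ m.primeFactors, p := Finset.prod_le_prod_of_subset_of_one_le'
          (Finset.filter_subset _ _) (fun p hp _ => (Nat.prime_of_mem_primeFactors hp).one_lt.le)
      _ ≤ m := Nat.le_of_dvd (Nat.pos_of_ne_zero hm) (Nat.prod_primeFactors_dvd m)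
  have hA' : (2 : ℝ) ≤ A := by exact_mod_cast hA
  have hl : 0 ≤ Real.log A := Real.log_nonneg (by linarith)
  have h3 : ((m.primeFactors.filter fun p => ¬ p < A).card : ℝ) * Real.log A ≤ Real.log m := by
    rw [← Real.log_pow]
    exact Real.log_le_log (by positivity) (by exact_mod_cast h2)
  have h4 : (((m.primeFactors.filter fun p => p < A).card : ℕ) : ℝ) ≤ A := by exact_mod_cast h1
  rw [← hsplit]
  push_cast
  nlinarith

theorem omega_pow : ∃ C : ℝ, 0 < C ∧ ∀ m N : ℕ, m ≠ 0 → 1 ≤ N → m ≤ N ^ 6 →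
    (((4 ^ (m.primeFactors.card + 2)) ^ 3 : ℕ) : ℝ) ≤ C * (N : ℝ) ^ (1 / 10 : ℝ) := by
  obtain ⟨A, hA⟩ : ∃ A : ℕ, A = 2 ^ 360 := ⟨_, rfl⟩
  have hA2 : 2 ≤ A := by rw [hA]; exact (Nat.le_self_pow (by norm_num) 2)
  have hlogA : Real.log A = 360 * Real.log 2 := by rw [hA]; push_cast; rw [Real.log_pow]; norm_num
  have hl2 : 0 < Real.log 2 := Real.log_pos (by norm_num)
  refine ⟨Real.exp ((6 * A + 12) * Real.log 2), Real.exp_pos _, ?_⟩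
  intro m N hm hN hmN
  have h1 := omega_bound A m hA2 hm
  have hNR : (1 : ℝ) ≤ N := by exact_mod_cast hN
  have h2 : Real.log m ≤ 6 * Real.log N := by
    have : Real.log m ≤ Real.log ((N : ℝ) ^ 6) :=
      Real.log_le_log (by exact_mod_cast Nat.pos_of_ne_zero hm) (by exact_mod_cast hmN)
    rwa [Real.log_pow] at this
  rw [hlogA] at h1
  rw [Real.rpow_def_of_pos (by linarith), ← Real.exp_add]
  have : (((4 ^ (m.primeFactors.card + 2)) ^ 3 : ℕ) : ℝ) =
      Real.exp ((6 * m.primeFactors.card + 12) * Real.log 2) := by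
    have e : (4 ^ (m.primeFactors.card + 2)) ^ 3 = 2 ^ (6 * m.primeFactors.card + 12) := by
      rw [show (4 : ℕ) = 2 ^ 2 by norm_num, ← pow_mul, ← pow_mul]; congr 1; ring
    rw [e, mul_comm _ (Real.log 2), Real.exp_mul, Real.exp_log (by norm_num)]
    push_cast
    rw [← Real.rpow_natCast]
    push_cast
    rfl
  rw [this, Real.exp_le_exp]
  nlinarith

end BGP

end PartC1

section PartC2


namespace BGP
open Finset

lemma exS_card_aux {N k1 k2 k3 : ℕ} (h0 : 0 < k1) (h12 : k1 < k2) (h23 : k2 < k3) (h3 : k3 ≤ N) :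
    ∃ m : ℕ, m ≠ 0 ∧ m ≤ N ^ 6 ∧
      exS (-(k2 * k3)) (-(k1 * k3)) (-(k1 * k2)) = m.primeFactors := by
  refine ⟨k1 * k2 * k3 * ((k2 - k1) * (k3 - k1) * (k3 - k2)), ?_, ?_, ?_⟩
  · have : 0 < k2 - k1 := by omega
    have : 0 < k3 - k1 := by omega
    have : 0 < k3 - k2 := by omega
    have : 0 < k2 := by omega
    have : 0 < k3 := by omega
    positivity
  · calc k1 * k2 * k3 * ((k2 - k1) * (k3 - k1) * (k3 - k2)) ≤ N * N * N * (N * N * N) := by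
          gcongr <;> omega
      _ = N ^ 6 := by ring
  · unfold exS
    congr 1
    zify [h12.le, h23.le, (h12.trans h23).le]
    have e : ((-((k2:ℤ) * k3) - -(k1 * k3)) * (-(k2 * k3) - -(k1 * k2)) * (-(k1 * k3) - -(k1 * k2))) =
      -(k1 * k2 * k3 * ((k2 - k1) * (k3 - k1) * (k3 - k2))) := by ring
    rw [e, abs_neg, abs_of_nonneg]
    have h1 : (0:ℤ) ≤ k2 - k1 := by omega
    have h2 : (0:ℤ) ≤ k3 - k1 := by omega
    have h3 : (0:ℤ) ≤ k3 - k2 := by omega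
    positivity

lemma large_case : ∃ N₀ : ℕ, ∀ N : ℕ, N₀ ≤ N → ∀ a d g : ℤ, IsCoprime a d → 0 < d → 0 < g →
    10000 * Real.log N ≤ Real.log d → ∀ S : Finset ℕ, S ⊆ range N →
    (∀ n ∈ S, ∃ m : ℤ, g * (a + n * d) = m ^ 2) → (S.card : ℝ) ≤ (N : ℝ) ^ (2 / 3 : ℝ) := by
  obtain ⟨C, hC, hom⟩ := omega_pow
  have ht : Filter.Tendsto (fun N : ℕ => (N : ℝ) ^ (1 / 30 : ℝ)) Filter.atTop Filter.atTop :=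
    (tendsto_rpow_atTop (by norm_num)).comp tendsto_natCast_atTop_atTop
  obtain ⟨N1, hN1⟩ := Filter.eventually_atTop.1 (ht.eventually_ge_atTop (max 13 (4 * 28561 * C + 1)))
  refine ⟨max N1 128, ?_⟩
  intro N hN a d g hcop hd hg hlog S hS hsq
  have hN128 : 128 ≤ N := le_trans (le_max_right _ _) hN
  have hx := hN1 N (le_trans (le_max_left _ _) hN)
  set x : ℝ := (N : ℝ) ^ (1 / 30 : ℝ) with hxdef
  have hx13 : 13 ≤ x := le_trans (le_max_left _ _) hx
  have hxC : 4 * 28561 * C + 1 ≤ x := le_trans (le_max_right _ _) hx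
  have hNx : (N : ℝ) = x ^ 30 := by
    rw [hxdef, ← Real.rpow_natCast, ← Real.rpow_mul (by positivity)]; norm_num
  have h23 : (N : ℝ) ^ (2 / 3 : ℝ) = x ^ 20 := by
    rw [hxdef, ← Real.rpow_natCast, ← Real.rpow_mul (by positivity)]; norm_num
  have h110 : (N : ℝ) ^ (1 / 10 : ℝ) = x ^ 3 := by
    rw [hxdef, ← Real.rpow_natCast, ← Real.rpow_mul (by positivity)]; norm_num
  rw [h23]
  by_contra hs
  push Not at hs
  have hx0 : 0 < x := by linarith
  have hspos : 0 < S.card := by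
    have : (0:ℝ) < S.card := lt_trans (by positivity) hs
    exact_mod_cast this
  set K := 12 * N / S.card + 1 with hKdef
  have hsK : 12 * N ≤ S.card * K := by
    have := Nat.lt_mul_div_succ (12 * N) hspos
    exact this.le
  have hKx : (K : ℝ) ≤ 13 * x ^ 10 := by
    have h1 : ((12 * N / S.card : ℕ) : ℝ) ≤ ((12 * N : ℕ) : ℝ) / S.card := Nat.cast_div_le
    have h2 : ((12 * N : ℕ) : ℝ) / S.card ≤ 12 * x ^ 10 := by
      rw [div_le_iff₀ (by exact_mod_cast hspos)]
      push_cast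
      rw [hNx]
      nlinarith [mul_le_mul_of_nonneg_left hs.le (show 0 ≤ 12 * x ^ 10 by positivity)]
    have h3 : 1 ≤ x ^ 10 := one_le_pow₀ (by linarith)
    rw [hKdef]; push_cast; push_cast at h1 h2; linarith
  have hKN : K ≤ N := by
    have : (K : ℝ) ≤ N := by
      rw [hNx]
      refine hKx.trans ?_
      calc 13 * x ^ 10 ≤ x * x ^ 10 := by gcongr
        _ = x ^ 11 := by ring
        _ ≤ x ^ 30 := pow_le_pow_right₀ (by linarith) (by norm_num)
    exact_mod_cast this
  have hK1 : 1 ≤ K := Nat.succ_le_succ (Nat.zero_le _)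
  set T := N / K with hT
  have hTK : T * K ≤ N := Nat.div_mul_le_self _ _
  have hT1 : 1 ≤ T := (Nat.one_le_div_iff (by omega)).2 hKN
  have hT2 : N ≤ 2 * T * K := by
    have := Nat.lt_mul_div_succ N (show 0 < K by omega)
    rw [← hT] at this
    nlinarith
  have hTN : T ≤ N := Nat.div_le_self _ _
  have hdl : 0 < Real.log d := by
    have : 0 < Real.log N := Real.log_pos (by exact_mod_cast (by omega : 1 < N))
    linarith
  have hd1 : d ≠ 1 := by rintro rfl; simp at hdl
  have hne : ∀ n : ℕ, a + n * d ≠ 0 := by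
    intro n hn
    have hda : d ∣ a := ⟨-n, by linarith⟩
    have := hcop.symm.isUnit_of_dvd' (dvd_refl d) hda
    rcases Int.isUnit_iff.1 this with h | h
    · exact hd1 h
    · omega
  have key := comb (N := N) (K := K) (T := T) (M := ⌊C * x ^ 3⌋₊) hK1 S hS hsK hTK (by
    intro k1 k2 k3 h0 h12 h23' h3 P hP
    have h3N : k3 ≤ N := by omega
    have hb := ec_bound hN128 h0 h12 h23' h3N hcop hd hg P (by
      intro p hp
      obtain ⟨p1, p2, p3, p4, p5, p6⟩ := hP p hp
      have hp2 : p.2 ≤ N := (mem_range.1 (hS p3)).le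
      obtain ⟨x0, e0⟩ := hsq _ p3
      obtain ⟨x1, e1⟩ := hsq _ p4
      obtain ⟨x2, e2⟩ := hsq _ p5
      obtain ⟨x3, e3⟩ := hsq _ p6
      push_cast at e0 e1 e2 e3
      exact ⟨p1, p2.trans hTN, hp2, hne _, x0, x1, x2, x3, e0, e1, e2, e3⟩) hlog
    obtain ⟨m, hm0, hm6, hme⟩ := exS_card_aux h0 h12 h23' h3N
    rw [hme] at hb
    refine hb.trans (Nat.le_floor ?_)
    rw [← h110]
    exact hom m N hm0 (by omega) hm6)
  have hM : ((⌊C * x ^ 3⌋₊ : ℕ) : ℝ) ≤ C * x ^ 3 := Nat.floor_le (by positivity)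
  have keyR : (T : ℝ) * S.card ≤ 2 * ((⌊C * x ^ 3⌋₊ : ℕ) * (K:ℝ) ^ 3) := by exact_mod_cast key
  have hT2R : (N : ℝ) ≤ 2 * T * K := by exact_mod_cast hT2
  have f1 : (N : ℝ) * S.card ≤ 4 * (C * x ^ 3) * (13 * x ^ 10) ^ 4 := by
    calc (N : ℝ) * S.card ≤ (2 * T * K) * S.card := mul_le_mul_of_nonneg_right hT2R (Nat.cast_nonneg _)
      _ = 2 * K * (T * S.card) := by ring
      _ ≤ 2 * K * (2 * ((⌊C * x ^ 3⌋₊ : ℕ) * (K:ℝ) ^ 3)) := by gcongr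
      _ = 4 * (⌊C * x ^ 3⌋₊ : ℕ) * (K:ℝ) ^ 4 := by ring
      _ ≤ 4 * (C * x ^ 3) * (13 * x ^ 10) ^ 4 := by gcongr
  have f2 : x ^ 30 * x ^ 20 ≤ (N : ℝ) * S.card :=
    mul_le_mul hNx.ge hs.le (by positivity) (by positivity)
  have f3 : x ^ 43 * x ^ 7 ≤ x ^ 43 * (4 * 28561 * C) := by
    calc x ^ 43 * x ^ 7 = x ^ 30 * x ^ 20 := by ring
      _ ≤ 4 * (C * x ^ 3) * (13 * x ^ 10) ^ 4 := f2.trans f1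
      _ = _ := by ring
  have f4 := le_of_mul_le_mul_left f3 (by positivity)
  have f5 : x ≤ x ^ 7 := le_self_pow₀ (by linarith) (by norm_num)
  linarith

end BGP

end PartC2

section PartD1


namespace BGP
open Finset

lemma mertens_lower {n : ℕ} (hn : 1 ≤ n) :
    Real.log n - 1 ≤ ∑ p ∈ Nat.primesLE n, Real.log p / ((p : ℝ) - 1) := by
  have hn0 : (0:ℝ) < n := by exact_mod_cast hn
  have h1 : (n : ℝ) * Real.log n - n ≤ Real.log (n.factorial) := by
    have hst := Stirling.le_log_factorial_stirling (n := n) (by omega)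
    have : 0 ≤ Real.log n := Real.log_natCast_nonneg n
    have : 0 ≤ Real.log (2 * Real.pi) := Real.log_nonneg (by linarith [Real.pi_gt_three])
    linarith
  have h2 : Real.log (n.factorial) ≤ ∑ p ∈ Nat.primesLE n, n * (Real.log p / ((p : ℝ) - 1)) := by
    rw [Real.log_nat_eq_sum_factorization, Finsupp.sum]
    calc _ ≤ ∑ p ∈ n.factorial.factorization.support, n * (Real.log p / ((p : ℝ) - 1)) := by
          refine sum_le_sum fun p hp => ?_
          have hp' : p.Prime := by
            rw [Nat.support_factorization] at hp
            exact Nat.prime_of_mem_primeFactors hp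
          have : Fact p.Prime := ⟨hp'⟩
          have h3 := sub_one_mul_padicValNat_factorial_lt_of_ne_zero (p := p) (n := n) (by omega)
          rw [Nat.factorization_def _ hp']
          have h4 : ((p:ℝ) - 1) * (padicValNat p n.factorial : ℝ) ≤ n := by
            have h5 : (((p - 1) * padicValNat p n.factorial : ℕ) : ℝ) ≤ n := by exact_mod_cast h3.le
            push_cast [Nat.cast_sub hp'.one_le] at h5
            exact h5
          have hp1 : (0:ℝ) < (p:ℝ) - 1 := by
            have : (1:ℝ) < p := by exact_mod_cast hp'.one_lt
            linarith
          have hl : 0 ≤ Real.log p := Real.log_natCast_nonneg p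
          rw [← mul_div_assoc, le_div_iff₀ hp1]
          nlinarith
      _ ≤ _ := by
          refine sum_le_sum_of_subset_of_nonneg ?_ ?_
          · intro p hp
            rw [Nat.support_factorization, Nat.mem_primeFactors] at hp
            rw [Nat.mem_primesLE]
            exact ⟨(hp.1.dvd_factorial).1 hp.2.1, hp.1⟩
          · intro p hp _
            rw [Nat.mem_primesLE] at hp
            have : (1:ℝ) < p := by exact_mod_cast hp.2.one_lt
            have hl : 0 ≤ Real.log p := Real.log_natCast_nonneg p
            have : (0:ℝ) ≤ (p:ℝ) - 1 := by linarith
            positivity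
  rw [← mul_sum] at h2
  have h3 : (n:ℝ) * (Real.log n - 1) ≤ n * ∑ p ∈ Nat.primesLE n, Real.log p / ((p : ℝ) - 1) := by
    linarith
  exact le_of_mul_le_mul_left h3 hn0

lemma sum_log_le_of_dvd {A : Finset ℕ} {m : ℕ} (hm : m ≠ 0) (hA : ∀ p ∈ A, p.Prime ∧ p ∣ m) :
    ∑ p ∈ A, Real.log p ≤ Real.log m := by
  have h1 : ∏ p ∈ A, p ∣ m :=
    Finset.prod_primes_dvd m (fun p hp => (hA p hp).1.prime) (fun p hp => (hA p hp).2)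
  have h2 := Nat.le_of_dvd (Nat.pos_of_ne_zero hm) h1
  have h0 : ∀ p ∈ A, (p : ℝ) ≠ 0 := fun p hp => by exact_mod_cast (hA p hp).1.ne_zero
  rw [← Real.log_prod h0]
  apply Real.log_le_log
  · exact prod_pos fun p hp => by exact_mod_cast (hA p hp).1.pos
  · have h3 : ((∏ p ∈ A, p : ℕ) : ℝ) ≤ m := by exact_mod_cast h2
    rwa [Nat.cast_prod] at h3

lemma sieve_core {N : ℕ} (S : Finset ℕ) (hS : S ⊆ range N) (A : Finset ℕ)
    (hA : ∀ p ∈ A, p.Prime ∧ 2 * (S.image (· % p)).card ≤ p + 1) :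
    ∑ p ∈ A, 2 * (S.card : ℝ) ^ 2 * (Real.log p / ((p : ℝ) + 1)) ≤
      S.card * ∑ p ∈ A, Real.log p + (S.card : ℝ) ^ 2 * Real.log N := by
  have low : ∀ p ∈ A, 2 * (S.card : ℝ) ^ 2 * (Real.log p / ((p : ℝ) + 1)) ≤
      ∑ i ∈ S, ∑ j ∈ S, if i % p = j % p then Real.log p else 0 := by
    intro p hp
    obtain ⟨hpp, hc⟩ := hA p hp
    have hl : 0 ≤ Real.log p := Real.log_natCast_nonneg p
    set I := S.image (· % p) with hI
    have e1 : (∑ i ∈ S, ∑ j ∈ S, if i % p = j % p then (1:ℕ) else 0) =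
        ∑ r ∈ I, ((S.filter fun i => i % p = r).card) ^ 2 := by
      have : ∀ i ∈ S, i % p ∈ I := fun i hi => mem_image_of_mem (· % p) hi
      rw [← sum_fiberwise_of_maps_to this]
      refine sum_congr rfl fun r hr => ?_
      rw [sq, ← smul_eq_mul, ← sum_const]
      refine sum_congr rfl fun i hi => ?_
      rw [(mem_filter.1 hi).2, sum_boole]
      simp [eq_comm]
    have e2 : S.card ^ 2 ≤ I.card * ∑ r ∈ I, ((S.filter fun i => i % p = r).card) ^ 2 := by
      have : ∀ i ∈ S, i % p ∈ I := fun i hi => mem_image_of_mem (· % p) hi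
      rw [card_eq_sum_card_fiberwise (f := (· % p)) this]
      exact sq_sum_le_card_mul_sum_sq
    set W := ∑ r ∈ I, ((S.filter fun i => i % p = r).card) ^ 2 with hW
    have e3 : (∑ i ∈ S, ∑ j ∈ S, if i % p = j % p then Real.log p else 0) = W * Real.log p := by
      rw [← e1]
      push_cast
      rw [sum_mul]
      refine sum_congr rfl fun i _ => ?_
      rw [sum_mul]
      refine sum_congr rfl fun j _ => ?_
      split_ifs <;> simp
    rw [e3]
    have e4 : 2 * (S.card:ℝ) ^ 2 ≤ ((p:ℝ) + 1) * W := by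
      have : 2 * S.card ^ 2 ≤ (p + 1) * W := by
        calc 2 * S.card ^ 2 ≤ 2 * (I.card * W) := by gcongr
          _ = (2 * I.card) * W := by ring
          _ ≤ _ := by gcongr
      exact_mod_cast this
    rw [← mul_div_assoc, div_le_iff₀ (by positivity)]
    nlinarith
  have hup : ∀ i ∈ S, ∀ j ∈ S, (∑ p ∈ A, if i % p = j % p then Real.log p else 0) ≤
      (if i = j then ∑ p ∈ A, Real.log p else 0) + Real.log N := by
    intro i hi j hj
    have hi' := mem_range.1 (hS hi)
    have hj' := mem_range.1 (hS hj)
    have hlN : 0 ≤ Real.log N := Real.log_natCast_nonneg N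
    by_cases hij : i = j
    · simp [hij, hlN]
    · rw [if_neg hij, zero_add, ← sum_filter]
      have hne : ((i:ℤ) - j).natAbs ≠ 0 := by omega
      refine (sum_log_le_of_dvd (m := ((i:ℤ) - j).natAbs) hne ?_).trans ?_
      · intro p hp
        rw [mem_filter] at hp
        refine ⟨(hA p hp.1).1, ?_⟩
        have h1 : j ≡ i [MOD p] := hp.2.symm
        have h2 := h1.dvd
        exact Int.natCast_dvd.1 h2
      · apply Real.log_le_log
        · exact_mod_cast Nat.pos_of_ne_zero hne
        · have : ((i:ℤ) - j).natAbs ≤ N := by omega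
          exact_mod_cast this
  calc _ ≤ ∑ p ∈ A, ∑ i ∈ S, ∑ j ∈ S, (if i % p = j % p then Real.log p else 0) := sum_le_sum low
    _ = ∑ i ∈ S, ∑ j ∈ S, ∑ p ∈ A, (if i % p = j % p then Real.log p else 0) := by
        rw [sum_comm]
        exact sum_congr rfl fun i _ => sum_comm
    _ ≤ ∑ i ∈ S, ∑ j ∈ S, ((if i = j then ∑ p ∈ A, Real.log p else 0) + Real.log N) :=
        sum_le_sum fun i hi => sum_le_sum fun j hj => hup i hi j hj
    _ = ∑ i ∈ S, (∑ p ∈ A, Real.log p + S.card * Real.log N) := by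
        refine sum_congr rfl fun i hi => ?_
        rw [sum_add_distrib, sum_ite_eq, if_pos hi, sum_const, nsmul_eq_mul]
    _ = _ := by
        rw [sum_const, nsmul_eq_mul]; ring

lemma residue_bound {p : ℕ} (hp : p.Prime) (hp2 : p ≠ 2) {a d e : ℤ} (he : Squarefree e)
    (hpd : ¬ (p : ℤ) ∣ d) (S : Finset ℕ)
    (hS : ∀ n ∈ S, ∃ w : ℤ, e * (a + n * d) = w ^ 2) :
    2 * (S.image (· % p)).card ≤ p + 1 := by
  have : Fact p.Prime := ⟨hp⟩
  have hd0 : (d : ZMod p) ≠ 0 := by rwa [Ne, ZMod.intCast_zmod_eq_zero_iff_dvd]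
  have hodd : p % 2 = 1 := hp.eq_two_or_odd.resolve_left hp2
  by_cases hpe : (p : ℤ) ∣ e
  · have : (S.image (· % p)).card ≤ 1 := by
      have hsub : S.image (· % p) ⊆ {(-(a : ZMod p) / d).val} := by
        intro r hr
        obtain ⟨n, hn, rfl⟩ := mem_image.1 hr
        obtain ⟨w, hw⟩ := hS n hn
        have hpp : Prime (p : ℤ) := Nat.prime_iff_prime_int.1 hp
        have hpw : (p : ℤ) ∣ w := hpp.dvd_of_dvd_pow (hw ▸ Dvd.dvd.mul_right hpe _)
        obtain ⟨u, rfl⟩ := hpw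
        obtain ⟨f, rfl⟩ := hpe
        have hpf : ¬ (p : ℤ) ∣ f := by
          rintro ⟨t, rfl⟩
          exact hpp.not_isUnit (he p ⟨t, by ring⟩)
        have h1 : f * (a + n * d) = p * u ^ 2 := by
          have : (p : ℤ) ≠ 0 := hpp.ne_zero
          apply mul_left_cancel₀ this
          linarith
        have h2 : (p : ℤ) ∣ a + n * d := (hpp.dvd_or_dvd ⟨_, h1⟩).resolve_left hpf
        rw [← ZMod.intCast_zmod_eq_zero_iff_dvd] at h2
        push_cast at h2
        rw [mem_singleton, ← ZMod.val_natCast]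
        congr 1
        rw [eq_div_iff hd0]
        linear_combination h2
      simpa using card_le_card hsub
    have := hp.two_le
    omega
  · have he0 : (e : ZMod p) ≠ 0 := by rwa [Ne, ZMod.intCast_zmod_eq_zero_iff_dvd]
    have h1 : S.image (· % p) = (S.image fun n : ℕ => ((e * (a + n * d) : ℤ) : ZMod p)).image
        (fun z : ZMod p => ((z / (e : ZMod p) - (a : ZMod p)) / (d : ZMod p)).val) := by
      rw [image_image]
      refine image_congr fun n _ => ?_
      simp only [Function.comp]
      rw [← ZMod.val_natCast]
      congr 1
      push_cast
      field_simp
      ring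
    have h2 : (S.image fun n : ℕ => ((e * (a + n * d) : ℤ) : ZMod p)) ⊆
        (range (p / 2 + 1)).image (fun k : ℕ => (k : ZMod p) ^ 2) := by
      intro z hz
      obtain ⟨n, hn, rfl⟩ := mem_image.1 hz
      obtain ⟨w, hw⟩ := hS n hn
      rw [mem_image]
      refine ⟨((w : ZMod p).valMinAbs).natAbs, ?_, ?_⟩
      · have := ZMod.natAbs_valMinAbs_le (w : ZMod p)
        rw [mem_range]; omega
      · rw [hw]
        push_cast
        have h5 : ((((w : ZMod p).valMinAbs).natAbs : ℤ) : ZMod p) ^ 2 = (w : ZMod p) ^ 2 := by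
          rw [← Int.cast_pow, Int.natAbs_sq, Int.cast_pow, ZMod.coe_valMinAbs]
        simpa using h5
    have h3 := card_le_card h2
    have h4 : ((range (p / 2 + 1)).image (fun k : ℕ => (k : ZMod p) ^ 2)).card ≤ p / 2 + 1 := by
      simpa using card_image_le (s := range (p / 2 + 1)) (f := fun k : ℕ => (k : ZMod p) ^ 2)
    have h5 : (S.image (· % p)).card ≤
        (S.image fun n : ℕ => ((e * (a + n * d) : ℤ) : ZMod p)).card := by
      rw [h1]; exact card_image_le
    have h6 := h5.trans (h3.trans h4)
    omega

end BGP

end PartD1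

section PartD2


namespace BGP
open Finset

lemma sieve_case : ∃ N₀ : ℕ, ∀ N : ℕ, N₀ ≤ N → ∀ a d e : ℤ, 0 < d → Squarefree e →
    Real.log d < 10000 * Real.log N → ∀ S : Finset ℕ, S ⊆ range N →
    (∀ n ∈ S, ∃ m : ℤ, e * (a + n * d) = m ^ 2) → (S.card : ℝ) ≤ (N : ℝ) ^ (2 / 3 : ℝ) := by
  have ht : Filter.Tendsto (fun N : ℕ => Real.log (N : ℝ)) Filter.atTop Filter.atTop :=
    Real.tendsto_log_atTop.comp tendsto_natCast_atTop_atTop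
  obtain ⟨N1, hN1⟩ := Filter.eventually_atTop.1 (ht.eventually_ge_atTop (10 ^ 8 : ℝ))
  refine ⟨max N1 2, ?_⟩
  intro N hN a d e hd he hlog S hS hsq
  have hL := hN1 N (le_trans (le_max_left _ _) hN)
  have hN2 : 2 ≤ N := le_trans (le_max_right _ _) hN
  set L : ℝ := Real.log N with hLdef
  have hNR : (1:ℝ) ≤ N := by exact_mod_cast (by omega : 1 ≤ N)
  set Y : ℝ := (N : ℝ) ^ (2 / 3 : ℝ) with hY
  have hY1 : 1 ≤ Y := Real.one_le_rpow hNR (by norm_num)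
  have hY0 : 0 < Y := by linarith
  have hlogY : Real.log Y = 2 / 3 * L := by
    rw [hY, Real.log_rpow (by linarith)]
  set y : ℕ := ⌊Y⌋₊ with hy
  have hy1 : 1 ≤ y := Nat.le_floor (by exact_mod_cast hY1)
  have hyY : (y : ℝ) ≤ Y := Nat.floor_le hY0.le
  have hlogy : 2 / 3 * L - 1 ≤ Real.log y := by
    have h1 : Y ≤ 2 * y := by
      have := Nat.lt_floor_add_one Y
      have h2 : (1:ℝ) ≤ y := by exact_mod_cast hy1
      rw [← hy] at this
      linarith
    have h2 := Real.log_le_log hY0 h1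
    rw [hlogY, Real.log_mul (by norm_num) (by positivity)] at h2
    have := Real.log_two_lt_d9
    linarith
  set f : ℕ → ℝ := fun p => Real.log p / ((p : ℝ) - 1) with hf
  have hf0 : ∀ p ∈ Nat.primesLE y, 0 ≤ f p := by
    intro p hp
    rw [Nat.mem_primesLE] at hp
    have h1 : (1:ℝ) < p := by exact_mod_cast hp.2.one_lt
    exact div_nonneg (Real.log_natCast_nonneg p) (by linarith)
  have hmer : Real.log y - 1 ≤ ∑ p ∈ Nat.primesLE y, f p := mertens_lower hy1
  set A := ((Nat.primesLE y).filter fun p => 1000000 < p).filter fun p : ℕ => ¬ (p : ℤ) ∣ d with hA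
  have hsplit1 := sum_filter_add_sum_filter_not (Nat.primesLE y) (fun p => 1000000 < p) f
  have hsplit2 := sum_filter_add_sum_filter_not ((Nat.primesLE y).filter fun p => 1000000 < p)
    (fun p : ℕ => (p : ℤ) ∣ d) f
  have hsmall : ∑ p ∈ (Nat.primesLE y).filter (fun p => ¬ 1000000 < p), f p ≤ 1000001 := by
    have h1 : ∀ p ∈ (Nat.primesLE y).filter (fun p => ¬ 1000000 < p), f p ≤ 1 := by
      intro p hp
      rw [mem_filter, Nat.mem_primesLE] at hp
      have h1 : (1:ℝ) < p := by exact_mod_cast hp.1.2.one_lt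
      rw [hf]
      simp only
      rw [div_le_one (by linarith)]
      exact Real.log_le_sub_one_of_pos (by linarith)
    refine (sum_le_card_nsmul _ _ _ h1).trans ?_
    have h2 : (Nat.primesLE y).filter (fun p => ¬ 1000000 < p) ⊆ range 1000001 := by
      intro p hp
      rw [mem_filter] at hp
      rw [mem_range]; omega
    have h3 := card_le_card h2
    rw [card_range] at h3
    rw [nsmul_eq_mul, mul_one]
    exact_mod_cast h3
  have hdiv : ∑ p ∈ ((Nat.primesLE y).filter fun p => 1000000 < p).filter (fun p : ℕ => (p : ℤ) ∣ d), f p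
      ≤ 0.01 * L := by
    have h1 : ∀ p ∈ ((Nat.primesLE y).filter fun p => 1000000 < p).filter (fun p : ℕ => (p : ℤ) ∣ d),
        f p ≤ 1 / 1000000 * Real.log p := by
      intro p hp
      rw [mem_filter, mem_filter] at hp
      have h1 : (1000001:ℝ) ≤ p := by exact_mod_cast hp.1.2
      have h2 : 0 ≤ Real.log p := Real.log_natCast_nonneg p
      rw [hf]
      simp only
      rw [div_le_iff₀ (by linarith)]
      nlinarith
    refine (sum_le_sum h1).trans ?_
    rw [← mul_sum]
    have h2 := sum_log_le_of_dvd
      (A := ((Nat.primesLE y).filter fun p => 1000000 < p).filter (fun p : ℕ => (p : ℤ) ∣ d))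
      (m := d.natAbs) (by omega) (by
        intro p hp
        rw [mem_filter, mem_filter, Nat.mem_primesLE] at hp
        exact ⟨hp.1.1.2, Int.natCast_dvd.1 hp.2⟩)
    have h3 : ((d.natAbs : ℕ) : ℝ) = (d : ℝ) := by
      rw [Nat.cast_natAbs, abs_of_pos hd]
    rw [h3] at h2
    linarith
  have hcore := sieve_core S hS A (by
    intro p hp
    rw [hA, mem_filter, mem_filter, Nat.mem_primesLE] at hp
    exact ⟨hp.1.1.2, residue_bound hp.1.1.2 (by omega) he hp.2 S hsq⟩)
  have hcomp : 0.99 * ∑ p ∈ A, f p ≤ ∑ p ∈ A, Real.log p / ((p : ℝ) + 1) := by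
    rw [mul_sum]
    refine sum_le_sum fun p hp => ?_
    rw [hA, mem_filter, mem_filter] at hp
    have h1 : (1000001:ℝ) ≤ p := by exact_mod_cast hp.1.2
    have h2 : 0 ≤ Real.log p := Real.log_natCast_nonneg p
    rw [hf]
    simp only
    rw [← mul_div_assoc, div_le_div_iff₀ (by linarith) (by linarith)]
    nlinarith
  have htheta : ∑ p ∈ A, Real.log p ≤ 2 * Y := by
    have h1 : ∑ p ∈ A, Real.log p ≤ ∑ p ∈ Nat.primesLE y, Real.log p :=
      sum_le_sum_of_subset_of_nonneg ((filter_subset _ _).trans (filter_subset _ _))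
        (fun p _ _ => Real.log_natCast_nonneg p)
    rw [← Chebyshev.theta_eq_sum_primesLE_log] at h1
    have h2 := Chebyshev.theta_le_log4_mul_x (x := (y : ℝ)) (by positivity)
    have h3 : Real.log 4 ≤ 2 := by
      have : (4:ℝ) = 2 ^ 2 := by norm_num
      rw [this, Real.log_pow]
      have := Real.log_two_lt_d9
      push_cast
      linarith
    have h4 : Real.log 4 * (y : ℝ) ≤ 2 * Y := mul_le_mul h3 hyY (by positivity) (by norm_num)
    linarith
  rw [← mul_sum] at hcore
  have hsum : 0.65 * L - 1000004 ≤ ∑ p ∈ A, f p := by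
    rw [hA]
    linarith
  have hbig : L + 2 ≤ 2 * ∑ p ∈ A, Real.log p / ((p : ℝ) + 1) := by
    linarith
  rcases Nat.eq_zero_or_pos S.card with h0 | hpos
  · rw [h0]; simpa using hY0.le
  have hs : (0:ℝ) < S.card := by exact_mod_cast hpos
  have h1 : (S.card : ℝ) * (S.card * (L + 2)) ≤ S.card * (2 * Y + S.card * L) := by
    calc (S.card : ℝ) * (S.card * (L + 2)) ≤
        S.card * (S.card * (2 * ∑ p ∈ A, Real.log p / ((p : ℝ) + 1))) := by
          apply mul_le_mul_of_nonneg_left _ hs.le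
          exact mul_le_mul_of_nonneg_left hbig hs.le
      _ = 2 * (S.card : ℝ) ^ 2 * ∑ p ∈ A, Real.log p / ((p : ℝ) + 1) := by ring
      _ ≤ _ := hcore
      _ = S.card * (∑ p ∈ A, Real.log p + S.card * L) := by ring
      _ ≤ _ := by
          apply mul_le_mul_of_nonneg_left _ hs.le
          linarith
  have h2 := le_of_mul_le_mul_left h1 hs
  linarith

end BGP

end PartD2

theorem BGP.reduce (a d : ℤ) (hd : 1 ≤ d) : ∃ a' d' e : ℤ, IsCoprime a' d' ∧ 0 < d' ∧ 0 < e ∧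
    Squarefree e ∧ ∀ n : ℕ, (∃ m : ℤ, a + (n : ℤ) * d = m ^ 2) →
      ∃ m : ℤ, e * (a' + n * d') = m ^ 2 := by
  have hg : 0 < Int.gcd a d := Int.gcd_pos_of_ne_zero_right _ (by omega)
  obtain ⟨g, hgd⟩ : ∃ g : ℕ, Int.gcd a d = g := ⟨_, rfl⟩
  have ha := Int.gcd_dvd_left a d
  have hd' := Int.gcd_dvd_right a d
  rw [hgd] at hg ha hd'
  obtain ⟨e, f, he, hf, hef, hsq⟩ := Nat.sq_mul_squarefree_of_pos hg
  obtain ⟨a', ha⟩ := ha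
  obtain ⟨d', hd'⟩ := hd'
  have hgR : (0:ℤ) < g := by exact_mod_cast hg
  refine ⟨a', d', e, ?_, ?_, by exact_mod_cast he, ?_, ?_⟩
  · rw [Int.isCoprime_iff_gcd_eq_one]
    have h1 : g = g * Int.gcd a' d' := by
      rw [ha, hd', Int.gcd_mul_left, Int.natAbs_natCast] at hgd
      exact hgd.symm
    exact Nat.eq_of_mul_eq_mul_left hg (by rw [mul_one]; exact h1.symm)
  · by_contra h
    push Not at h
    have : d ≤ 0 := by rw [hd']; exact mul_nonpos_of_nonneg_of_nonpos hgR.le h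
    omega
  · exact Int.squarefree_natCast.2 hsq
  · rintro n ⟨m, hm⟩
    have hgz : (g : ℤ) = (f : ℤ) ^ 2 * e := by exact_mod_cast hef.symm
    have h1 : (f : ℤ) ^ 2 * (e * (a' + n * d')) = m ^ 2 := by
      rw [← hm]
      rw [ha, hd', hgz]
      ring
    have hfm : (f : ℤ) ∣ m := (Int.pow_dvd_pow_iff (by norm_num)).1 ⟨_, h1.symm⟩
    obtain ⟨w, rfl⟩ := hfm
    refine ⟨w, ?_⟩
    have hf0 : (f : ℤ) ^ 2 ≠ 0 := by positivity
    apply mul_left_cancel₀ hf0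
    rw [h1]; ring

open scoped Classical in
theorem BGP.squaresInAP_le (N : ℕ) (a d : ℤ) : squaresInAP N a d ≤
    (Finset.filter (fun n : ℕ => ∃ m : ℤ, a + (n : ℤ) * d = m ^ 2) (Finset.range N)).card := by
  unfold squaresInAP
  refine le_trans (Finset.card_le_card ?_) (Finset.card_image_le (f := fun n : ℕ => (n : ℤ)))
  intro z hz
  rw [Finset.mem_filter] at hz
  obtain ⟨hz1, hz2⟩ := hz
  simp only [Finset.bind_def, Finset.pure_def, Finset.mem_sup, Finset.mem_singleton] at hz1
  obtain ⟨n, hn, rfl⟩ := hz1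
  exact Finset.mem_image.2 ⟨n, Finset.mem_filter.2 ⟨hn, hz2⟩, rfl⟩

theorem bombieri_granville_pintz (c : ℝ) (hc : 2 / 3 < c) :
    ∃ N₀ : ℕ, ∀ N : ℕ, N₀ ≤ N →
      ∀ a d : ℤ, 1 ≤ d → (squaresInAP N a d : ℝ) < (N : ℝ) ^ c := by
  classical
  obtain ⟨N1, h1⟩ := BGP.large_case
  obtain ⟨N2, h2⟩ := BGP.sieve_case
  refine ⟨max (max N1 N2) 2, ?_⟩
  intro N hN a d hd
  have hN1 : N1 ≤ N := by omega
  have hN2 : N2 ≤ N := by omega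
  have hN3 : (1:ℝ) < N := by exact_mod_cast (by omega : 1 < N)
  obtain ⟨a', d', e, hcop, hd', he, hsq, hS⟩ := BGP.reduce a d hd
  refine lt_of_le_of_lt ?_ (Real.rpow_lt_rpow_of_exponent_lt hN3 hc)
  refine le_trans (Nat.cast_le.2 (BGP.squaresInAP_le N a d)) ?_
  rcases le_or_gt (10000 * Real.log N) (Real.log d') with h | h
  · refine h1 N hN1 a' d' e hcop hd' he h _ ?_ ?_
    · exact Finset.filter_subset _ _
    · exact fun n hn => hS n (Finset.mem_filter.1 hn).2
  · refine h2 N hN2 a' d' e hd' hsq h _ ?_ ?_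
    · exact Finset.filter_subset _ _
    · exact fun n hn => hS n (Finset.mem_filter.1 hn).2
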